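/- arXiv:2304.11991 — 2 statements merged into one kernel-verified Lean document; each statement's English description precedes it below -/
import Mathlib

section
/- Let F(x_1,x_2,x_3) ∈ ℤ[x_1,x_2,x_3] define an absolutely irreducible surface of degree d ≥ 1, and let B_1, B_2, B_3 ≥ 1. Put T = max{B_1^{e_1} B_2^{e_2} B_3^{e_3}}, the maximum over all (e_1,e_2,e_3) ∈ ℤ_{≥0}³ such that x_1^{e_1} x_2^{e_2} x_3^{e_3} occurs in F with nonzero coefficient, and put V_3 = exp( ((log B_1 · log B_2 · log B_3)/log T)^{1/2} ). Then for every ε > 0 there exist polynomials g_1,…,g_J ∈ ℤ[x_1,x_2,x_3] and a finite set Z ⊂ ℤ³, with J ≤ c(d,ε)·T^ε·V_3 and |Z| ≤ c(d,ε)·T^ε·V_3², such that: (i) each g_j is coprime to F (shares no common factor with F) and has total degree at most c(d,ε); and (ii) if x ∈ ℤ³ with |x_1| ≤ B_1, |x_2| ≤ B_2, |x_3| ≤ B_3, x ∉ Z and F(x) = 0, then g_j(x) = 0 for some j. -/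
open Finset in
/-- Edge-isoperimetric inequality in a finite power of a set, in logarithmic form: the average
over `x ∈ A` of the sum of the logarithms of the sizes of the lines of `A` through `x` is at most
the logarithm of the size of `A`. -/
theorem sum_log_card_line_le {P : Type*} [Fintype P] [DecidableEq P] :
    ∀ (l : ℕ) (A : Finset (Fin l → P)),
      ∑ x ∈ A, ∑ i, Real.log (#{v | Function.update x i v ∈ A} : ℕ) ≤ #A * Real.log #A
  | 0, A => by
    simp only [univ_eq_empty, sum_empty, sum_const_zero]
    exact mul_nonneg (Nat.cast_nonneg _) (Real.log_natCast_nonneg _)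
  | l + 1, A => by
    classical
    set S : P → Finset (Fin l → P) := fun v => {y | (Fin.cons v y : Fin (l + 1) → P) ∈ A} with hS
    set a : (Fin l → P) → ℕ := fun y => #{v | (Fin.cons v y : Fin (l + 1) → P) ∈ A} with ha
    have hsum : ∀ f : (Fin (l + 1) → P) → ℝ,
        ∑ x ∈ A, f x = ∑ v, ∑ y ∈ S v, f (Fin.cons v y) := by
      intro f
      have h1 : ∑ x ∈ A, f x = ∑ x : Fin (l + 1) → P, if x ∈ A then f x else 0 := by
        rw [← sum_filter]; congr 1; ext; simp
      rw [h1, ← (Fin.consEquiv (fun _ => P)).sum_comp, Fintype.sum_prod_type]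
      refine sum_congr rfl fun v _ => ?_
      rw [hS, sum_filter]
      rfl
    have hcard : (#A : ℝ) = ∑ v, (#(S v) : ℝ) := by
      have := hsum (fun _ => 1)
      simpa using this
    have hcard' : (#A : ℝ) = ∑ y, (a y : ℝ) := by
      rw [hcard]
      have h1 : ∀ v, (#(S v) : ℝ) = ∑ y, if (Fin.cons v y : Fin (l + 1) → P) ∈ A then 1 else 0 := by
        intro v; rw [hS]; simp
      simp_rw [h1]
      rw [sum_comm]
      refine sum_congr rfl fun y _ => ?_
      rw [ha]; simp
    have hIH := fun v => sum_log_card_line_le l (S v)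
    rw [hsum]
    have hterm : ∀ v, ∀ y ∈ S v,
        ∑ i, Real.log (#{w | Function.update (Fin.cons v y : Fin (l + 1) → P) i w ∈ A} : ℕ)
          = Real.log (a y) + ∑ i, Real.log (#{w | Function.update y i w ∈ S v} : ℕ) := by
      intro v y _
      rw [Fin.sum_univ_succ]
      congr 1
      · congr 4; ext w; rw [Fin.update_cons_zero]
      · refine sum_congr rfl fun i _ => ?_
        congr 4; ext w
        simp [hS, Fin.cons_update]
    rw [sum_congr rfl fun v _ => sum_congr rfl (hterm v)]
    simp_rw [sum_add_distrib]
    rcases A.eq_empty_or_nonempty with rfl | hA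
    · simp [hS]
    have hApos : (0 : ℝ) < #A := by exact_mod_cast hA.card_pos
    have key : ∀ v, ∀ y ∈ S v,
        Real.log (a y) ≤ Real.log #A - Real.log #(S v) + (#(S v) * a y / #A - 1) := by
      intro v y hy
      have h1 : (0 : ℝ) < a y := by
        have : 0 < a y := card_pos.2 ⟨v, by simpa [hS] using hy⟩
        exact_mod_cast this
      have h2 : (0 : ℝ) < #(S v) := by exact_mod_cast card_pos.2 ⟨y, hy⟩
      have h3 := Real.log_le_sub_one_of_pos (show (0 : ℝ) < #(S v) * a y / #A by positivity)
      rw [Real.log_div (by positivity) (by positivity),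
        Real.log_mul (by positivity) (by positivity)] at h3
      linarith
    have h4 : ∑ v, ∑ y ∈ S v, Real.log (a y) ≤ ∑ v, ∑ y ∈ S v,
        (Real.log #A - Real.log #(S v) + (#(S v) * a y / #A - 1)) :=
      sum_le_sum fun v _ => sum_le_sum (key v)
    have h5 : ∑ v, ∑ y ∈ S v, ((#(S v) : ℝ) * a y / #A - 1) ≤ 0 := by
      have : ∀ v, ∑ y ∈ S v, ((#(S v) : ℝ) * a y / #A - 1) ≤ #(S v) * 1 - #(S v) := by
        intro v
        rw [sum_sub_distrib]
        simp only [sum_const, nsmul_eq_mul, mul_one]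
        gcongr
        rw [← sum_div, ← mul_sum, div_le_iff₀ hApos]
        gcongr
        rw [hcard']
        exact sum_le_sum_of_subset_of_nonneg (subset_univ _) fun _ _ _ => Nat.cast_nonneg _
      calc _ ≤ ∑ v, ((#(S v) : ℝ) * 1 - #(S v)) := sum_le_sum fun v _ => this v
        _ = 0 := by simp
    have h6 : ∑ v, ∑ y ∈ S v, (Real.log #A - Real.log #(S v) + ((#(S v) : ℝ) * a y / #A - 1))
        = #A * Real.log #A - ∑ v, #(S v) * Real.log #(S v)
          + ∑ v, ∑ y ∈ S v, ((#(S v) : ℝ) * a y / #A - 1) := by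
      simp_rw [sum_add_distrib, sum_sub_distrib]
      simp only [sum_const, nsmul_eq_mul]
      rw [← sum_mul, ← hcard]
    have h7 : ∑ v, ∑ y ∈ S v, ∑ i, Real.log (#{w | Function.update y i w ∈ S v} : ℕ)
        ≤ ∑ v, #(S v) * Real.log #(S v) := sum_le_sum fun v _ => hIH v
    linarith

theorem log_mul_le_log_of_le {N a : ℝ} (hN : 2 ≤ N) (h1 : 1 ≤ a) (ha : a ≤ N) :
    Real.log N - 2 * Real.log N * (1 - a / N) ≤ Real.log a := by
  have hlog : 0 ≤ Real.log N := Real.log_nonneg (by linarith)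
  have hN1 : 0 < N - 1 := by linarith
  have hc := strictConcaveOn_log_Ioi.concaveOn.2 (Set.mem_Ioi.2 one_pos)
    (Set.mem_Ioi.2 (by linarith : 0 < N))
    (div_nonneg (by linarith : 0 ≤ N - a) hN1.le) (div_nonneg (by linarith : 0 ≤ a - 1) hN1.le)
    (by rw [← add_div, div_eq_one_iff_eq hN1.ne']; ring)
  simp only [smul_eq_mul, Real.log_one, mul_zero, zero_add, mul_one] at hc
  have e : (N - a) / (N - 1) + (a - 1) / (N - 1) * N = a := by field_simp; ring
  rw [e] at hc
  refine le_trans ?_ hc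
  have : 1 - 2 * (1 - a / N) ≤ (a - 1) / (N - 1) := by
    rw [le_div_iff₀ hN1]
    have h : a / N * N = a := by field_simp
    have h' : a / N ≤ 1 := by rw [div_le_one (by linarith)]; exact ha
    nlinarith
  nlinarith

open Finset in
theorem exists_large_fiber {P V : Type*} [Fintype P] [DecidableEq P] [AddCommGroup V] [Module ℚ V]
    [FiniteDimensional ℚ V] (W : Finset P → Submodule ℚ V) (hW : Antitone W) (t L : ℕ)
    (hL : 0 < L) (hprop : ∀ I : Finset P, t ≤ #I → W I ≠ ⊤)
    (hN : 2 * (t + L) ^ 2 ≤ Fintype.card P) :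
    ∃ l, t ≤ l ∧ l < t + L ∧ ∃ W₀ : Submodule ℚ V, W₀ ≠ ⊤ ∧
      ∃ A : Finset (Fin l → P), (∀ I ∈ A, W (univ.image I) = W₀) ∧
      (Fintype.card P : ℝ) ^ ((l : ℝ) - 8 * l * Module.finrank ℚ V / L) ≤ #A := by
  classical
  set N := Fintype.card P with hNdef
  set s := Module.finrank ℚ V with hs
  have hN2 : 2 ≤ N := by
    have : 1 ≤ (t + L) ^ 2 := Nat.one_le_pow _ _ (by omega)
    omega
  have hNpos : (0 : ℝ) < N := by exact_mod_cast (by omega : 0 < N)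
  have hLpos : (0 : ℝ) < L := by exact_mod_cast hL
  let r : ℕ → ℕ := fun l => ∑ I : Fin l → P, Module.finrank ℚ (W (univ.image I))
  let chg : ℕ → ℕ := fun l =>
    #{p : P × (Fin l → P) | W (insert p.1 (univ.image p.2)) ≠ W (univ.image p.2)}
  have hr : ∀ l, r (l + 1) + chg l ≤ N * r l := by
    intro l
    have h1 : r (l + 1) = ∑ p : P × (Fin l → P),
        Module.finrank ℚ (W (insert p.1 (univ.image p.2))) := by
      simp only [r]
      rw [← (Fin.consEquiv (fun _ => P)).sum_comp]
      refine sum_congr rfl fun p _ => ?_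
      have : univ.image ((Fin.consEquiv fun _ => P) p) = insert p.1 (univ.image p.2) := by
        ext x
        simp [Fin.consEquiv, Fin.exists_fin_succ, eq_comm]
      rw [this]
    have h2 : N * r l = ∑ p : P × (Fin l → P), Module.finrank ℚ (W (univ.image p.2)) := by
      rw [Fintype.sum_prod_type]
      change _ = ∑ _v : P, r l
      rw [sum_const, smul_eq_mul, card_univ]
    have h3 : chg l = ∑ p : P × (Fin l → P),
        if W (insert p.1 (univ.image p.2)) ≠ W (univ.image p.2) then 1 else 0 := by
      simp only [chg, card_filter]
    rw [h1, h2, h3, ← sum_add_distrib]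
    refine sum_le_sum fun p _ => ?_
    have hle : W (insert p.1 (univ.image p.2)) ≤ W (univ.image p.2) := hW (subset_insert _ _)
    split_ifs with h
    · exact Submodule.finrank_lt_finrank_of_lt (lt_of_le_of_ne hle h)
    · exact Submodule.finrank_mono hle
  have hrle : ∀ l, (r l : ℝ) ≤ s * N ^ l := by
    intro l
    have : r l ≤ ∑ _I : Fin l → P, s := sum_le_sum fun I _ => Submodule.finrank_le _
    have h2 : ∑ _I : Fin l → P, s = s * N ^ l := by
      simp [hNdef, mul_comm]
    rw [h2] at this; exact_mod_cast this
  obtain ⟨l, htl, hlL, hchg⟩ : ∃ l, t ≤ l ∧ l < t + L ∧ (chg l : ℝ) ≤ s / L * N ^ (l + 1) := by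
    by_contra! hcon
    have hstep : ∀ k ≤ L, k ≠ 0 → (r (t + k) : ℝ) < (s - k * (s / L)) * N ^ (t + k) := by
      intro k
      induction k with
      | zero => simp
      | succ k ih =>
        intro hk _
        have h1 := hcon (t + k) (by omega) (by omega)
        have h2 : (r (t + k + 1) : ℝ) + chg (t + k) ≤ N * r (t + k) := by exact_mod_cast hr (t + k)
        have h3 : (r (t + k) : ℝ) ≤ (s - k * (s / L)) * N ^ (t + k) := by
          rcases Nat.eq_zero_or_pos k with rfl | hk0
          · simpa using hrle t
          · exact (ih (by omega) hk0.ne').le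
        have h4 : N * (r (t + k) : ℝ) ≤ N * ((s - k * (s / L)) * N ^ (t + k)) := by gcongr
        rw [← add_assoc]
        push_cast
        rw [pow_succ] at h1 ⊢
        nlinarith
    have h1 := hstep L le_rfl hL.ne'
    have h2 : (s : ℝ) - L * (s / L) = 0 := by field_simp; ring
    rw [h2, zero_mul] at h1
    exact absurd h1 (not_lt.2 (Nat.cast_nonneg _))
  refine ⟨l, htl, hlL, ?_⟩
  set c : (Fin l → P) → Submodule ℚ V := fun I => W (univ.image I) with hc
  have hswap : ∀ i : Fin l,
      #{p : P × (Fin l → P) | c (Function.update p.2 i p.1) ≠ c p.2} ≤ 2 * chg l := by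
    intro i
    have hins : ∀ (I : Fin l → P) (v : P),
        insert (I i) (univ.image (Function.update I i v)) = insert v (univ.image I) := by
      intro I v
      ext x
      simp only [mem_insert, mem_image, mem_univ, true_and]
      constructor
      · rintro (rfl | ⟨j, rfl⟩)
        · exact Or.inr ⟨i, rfl⟩
        · by_cases hj : j = i
          · subst hj; simp
          · exact Or.inr ⟨j, by simp [hj]⟩
      · rintro (rfl | ⟨j, rfl⟩)
        · exact Or.inr ⟨i, by simp⟩
        · by_cases hj : j = i
          · subst hj; simp
          · exact Or.inr ⟨j, by simp [hj]⟩
    let T1 : Finset (P × (Fin l → P)) :=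
      {p | W (insert p.1 (univ.image p.2)) ≠ W (univ.image p.2)}
    have hsub : ({p : P × (Fin l → P) | c (Function.update p.2 i p.1) ≠ c p.2} : Finset _) ⊆
        T1 ∪ T1.image (fun p => (p.2 i, Function.update p.2 i p.1)) := by
      intro p hp
      simp only [mem_filter, mem_univ, true_and] at hp
      rw [mem_union, mem_image]
      by_cases h1 : p ∈ T1
      · exact Or.inl h1
      · right
        refine ⟨(p.2 i, Function.update p.2 i p.1), ?_, by ext <;> simp⟩
        simp only [T1, mem_filter, mem_univ, true_and, not_not] at h1 ⊢
        rw [hins, h1]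
        exact fun h => hp h.symm
    calc _ ≤ _ := card_le_card hsub
      _ ≤ _ := card_union_le _ _
      _ ≤ #T1 + #T1 := by exact Nat.add_le_add_left card_image_le _
      _ = 2 * chg l := by simp only [T1, chg]; ring
  set bad : (Fin l → P) → ℕ := fun I => ∑ i, #{v | c (Function.update I i v) ≠ c I} with hbad
  have hbadsum : ((∑ I, bad I : ℕ) : ℝ) ≤ l * (2 * (s / L * N ^ (l + 1))) := by
    have h1 : ∑ I, bad I = ∑ i : Fin l,
        #{p : P × (Fin l → P) | c (Function.update p.2 i p.1) ≠ c p.2} := by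
      simp only [hbad]
      rw [sum_comm]
      refine sum_congr rfl fun i _ => ?_
      simp only [card_filter]
      rw [Fintype.sum_prod_type, sum_comm]
    have h2 : ∑ I, bad I ≤ l * (2 * chg l) := by
      rw [h1]
      refine (sum_le_sum fun i _ => hswap i).trans ?_
      simp
    calc ((∑ I, bad I : ℕ) : ℝ) ≤ ((l * (2 * chg l) : ℕ) : ℝ) := by exact_mod_cast h2
      _ = l * (2 * (chg l : ℝ)) := by push_cast; ring
      _ ≤ _ := by gcongr
  have hgood : (N : ℝ) ^ l / 2 ≤ #{I : Fin l → P | c I ≠ ⊤} := by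
    have h1 : #{I : Fin l → P | Function.Injective I} ≤ #{I : Fin l → P | c I ≠ ⊤} := by
      refine card_le_card fun I hI => ?_
      simp only [mem_filter, mem_univ, true_and] at hI ⊢
      refine hprop _ ?_
      rw [card_image_of_injective _ hI]; simpa using htl
    have h2 : #{I : Fin l → P | Function.Injective I} = N.descFactorial l := by
      have := Fintype.card_embedding_eq (α := Fin l) (β := P)
      rw [Fintype.card_fin] at this
      rw [← this, ← Fintype.card_coe]
      refine Fintype.card_congr ((Equiv.subtypeEquivRight ?_).trans
        (Equiv.subtypeInjectiveEquivEmbedding (Fin l) P))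
      simp
    have hlN : l ^ 2 * 2 ≤ N := le_trans (by nlinarith) hN
    have h3 := Nat.pow_sub_le_descFactorial N l
    have hlN' : l ≤ N := le_trans (by nlinarith) hlN
    have h4 : ((N : ℝ) + 1 - l) ^ l ≤ N.descFactorial l := by
      have : (((N + 1 - l : ℕ) : ℝ)) = (N : ℝ) + 1 - l := by
        rw [Nat.cast_sub (by omega)]; push_cast; ring
      rw [← this]; exact_mod_cast h3
    have h5 : (N : ℝ) ^ l / 2 ≤ ((N : ℝ) + 1 - l) ^ l := by
      have hb := one_add_mul_le_pow (R := ℝ) (a := -(l / N)) (by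
        have : (l : ℝ) / N ≤ 1 := by rw [div_le_one hNpos]; exact_mod_cast hlN'
        linarith) l
      have h6 : (l : ℝ) * (l / N) ≤ 1 / 2 := by
        rw [← mul_div_assoc, div_le_iff₀ hNpos]
        have : ((l ^ 2 * 2 : ℕ) : ℝ) ≤ N := by exact_mod_cast hlN
        push_cast at this; nlinarith
      have h7 : (1 : ℝ) / 2 ≤ (1 + -(l / N)) ^ l := by linarith
      calc (N : ℝ) ^ l / 2 = N ^ l * (1 / 2) := by ring
        _ ≤ N ^ l * (1 + -(l / N)) ^ l := by gcongr
        _ = ((N : ℝ) - l) ^ l := by rw [← mul_pow]; congr 1; field_simp; ring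
        _ ≤ _ := by
          have : (l : ℝ) ≤ N := by exact_mod_cast hlN'
          gcongr; linarith
    calc _ ≤ _ := h5
      _ ≤ _ := h4
      _ ≤ _ := by rw [← h2]; exact_mod_cast h1
  -- a colour class with few outgoing edges
  set G : Finset (Fin l → P) := {I | c I ≠ ⊤} with hG
  obtain ⟨W₀, hW₀, hW₀ne, hout⟩ : ∃ W₀ ∈ G.image c, W₀ ≠ ⊤ ∧
      (∑ I with c I = W₀, (bad I : ℝ)) ≤
        4 * l * (s / L) * N * #{I : Fin l → P | c I = W₀} := by
    by_contra! hcon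
    have hne : (G.image c).Nonempty := by
      rw [image_nonempty, ← card_pos]
      have : (0 : ℝ) < #G := lt_of_lt_of_le (by positivity) hgood
      exact_mod_cast this
    have hG1 : ∀ W₀ ∈ G.image c, W₀ ≠ ⊤ := by
      intro W₀ h
      obtain ⟨I, hI, rfl⟩ := mem_image.1 h
      simpa [hG] using hI
    have h1 := sum_lt_sum_of_nonempty hne fun W₀ h => hcon W₀ h (hG1 W₀ h)
    have hfil : ∀ W₀ ∈ G.image c, ({I | c I = W₀} : Finset (Fin l → P)) = {I ∈ G | c I = W₀} := by
      intro W₀ h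
      ext I
      simp only [mem_filter, mem_univ, true_and, hG]
      exact ⟨fun h' => ⟨h' ▸ hG1 W₀ h, h'⟩, fun h' => h'.2⟩
    have h2 : ∑ W₀ ∈ G.image c, ∑ I with c I = W₀, (bad I : ℝ) = ∑ I ∈ G, (bad I : ℝ) := by
      rw [sum_congr rfl fun W₀ h => by rw [hfil W₀ h]]
      exact sum_fiberwise_of_maps_to (fun I hI => mem_image_of_mem c hI) _
    have h3 : ∑ W₀ ∈ G.image c, 4 * l * (s / L) * N * (#{I : Fin l → P | c I = W₀} : ℝ)
        = 4 * l * (s / L) * N * #G := by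
      rw [← mul_sum]
      congr 1
      rw [card_eq_sum_card_image c G]
      push_cast
      exact sum_congr rfl fun W₀ h => by rw [hfil W₀ h]
    rw [h2, h3] at h1
    have h4 : ∑ I ∈ G, (bad I : ℝ) ≤ ((∑ I, bad I : ℕ) : ℝ) := by
      push_cast
      exact sum_le_sum_of_subset_of_nonneg (subset_univ _) fun _ _ _ => Nat.cast_nonneg _
    have h5 : 4 * l * (s / L) * N * ((N : ℝ) ^ l / 2) ≤ 4 * l * (s / L) * N * #G := by
      gcongr
    have h6 : 4 * l * (s / L) * N * ((N : ℝ) ^ l / 2) = l * (2 * (s / L * N ^ (l + 1))) := by ring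
    linarith
  refine ⟨W₀, hW₀ne, ({I | c I = W₀} : Finset _), fun I hI => by simpa [hc] using hI, ?_⟩
  set A : Finset (Fin l → P) := {I | c I = W₀} with hA
  have hAne : A.Nonempty := by
    obtain ⟨I, _, h⟩ := mem_image.1 hW₀
    exact ⟨I, by simp [hA, h]⟩
  have hApos : (0 : ℝ) < #A := by exact_mod_cast hAne.card_pos
  have hline : ∀ x ∈ A, l * Real.log N - 2 * Real.log N * (bad x / N) ≤
      ∑ i, Real.log (#{v | Function.update x i v ∈ A} : ℕ) := by
    intro x hx
    have hxA : c x = W₀ := by simpa [hA] using hx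
    have h1 : ∀ i : Fin l, Real.log N - 2 * Real.log N *
        (#{v | c (Function.update x i v) ≠ c x} / N) ≤
        Real.log (#{v | Function.update x i v ∈ A} : ℕ) := by
      intro i
      have h2 : #{v | Function.update x i v ∈ A} + #{v | c (Function.update x i v) ≠ c x} = N := by
        have := card_filter_add_card_filter_not (s := (univ : Finset P))
          (fun v => Function.update x i v ∈ A)
        rw [card_univ] at this
        rw [hNdef, ← this]
        congr 2
        ext v
        simp [hA, hxA]
      have h3 : 1 ≤ #{v | Function.update x i v ∈ A} := card_pos.2 ⟨x i, by simpa using hx⟩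
      have h4 : (#{v | c (Function.update x i v) ≠ c x} : ℝ) / N
          = 1 - (#{v | Function.update x i v ∈ A} : ℝ) / N := by
        rw [eq_sub_iff_add_eq, ← add_div, div_eq_one_iff_eq hNpos.ne', add_comm]
        exact_mod_cast h2
      rw [h4]
      refine log_mul_le_log_of_le (by exact_mod_cast hN2) (by exact_mod_cast h3) ?_
      exact_mod_cast (by omega : #{v | Function.update x i v ∈ A} ≤ N)
    refine le_trans (le_of_eq ?_) (sum_le_sum fun i _ => h1 i)
    rw [sum_sub_distrib, ← mul_sum, ← sum_div]
    simp [hbad]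
  have h1 := sum_log_card_line_le l A
  have h2 := (sum_le_sum hline).trans h1
  rw [sum_sub_distrib, ← mul_sum (s := A) (a := 2 * Real.log N), ← sum_div] at h2
  simp only [sum_const, nsmul_eq_mul] at h2
  have h3 : 2 * Real.log N * ((∑ x ∈ A, (bad x : ℝ)) / N) ≤
      2 * Real.log N * (4 * l * (s / L) * #A) := by
    have : 0 ≤ Real.log N := Real.log_natCast_nonneg _
    gcongr
    rw [div_le_iff₀ hNpos]
    linarith
  have h4 : #A * (((l : ℝ) - 8 * l * s / L) * Real.log N) ≤ #A * Real.log #A := by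
    have : #A * (((l : ℝ) - 8 * l * s / L) * Real.log N) =
      #A * (l * Real.log N) - 2 * Real.log N * (4 * l * (s / L) * #A) := by ring
    linarith
  have h5 := le_of_mul_le_mul_left h4 hApos
  rw [Real.rpow_def_of_pos hNpos, ← Real.le_log_iff_exp_le hApos]
  linarith

/-- The vector of values at `x` of the monomials with exponents in `E`. -/
def monomialVec {σ : Type*} [Fintype σ] (E : Finset (σ →₀ ℕ)) (x : σ → ℤ) : E → ℚ :=
  fun e => ((∏ i, x i ^ e.1 i : ℤ) : ℚ)

open Finset MvPolynomial in
theorem exists_poly_vanishing_of_ne_top {σ : Type*} [Fintype σ] {E : Finset (σ →₀ ℕ)}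
    {W : Submodule ℚ (E → ℚ)} (hW : W ≠ ⊤) :
    ∃ g : MvPolynomial σ ℤ, g ≠ 0 ∧ g.support ⊆ E ∧
      ∀ x, monomialVec E x ∈ W → eval x g = 0 := by
  classical
  obtain ⟨f, hf, hWf⟩ := Submodule.exists_le_ker_of_lt_top W (lt_top_iff_ne_top.2 hW)
  obtain ⟨b, hb⟩ := IsLocalization.exist_integer_multiples_of_finset (nonZeroDivisors ℤ)
    (univ.image fun e : E => f (Pi.single e 1))
  choose! a ha using hb
  set c : E → ℤ := fun e => a (f (Pi.single e 1)) with hc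
  have hca : ∀ e, ((c e : ℤ) : ℚ) = (b : ℤ) * f (Pi.single e 1) := by
    intro e
    have := ha (f (Pi.single e 1)) (by simp)
    simpa [hc, Algebra.smul_def] using this
  have hb0 : ((b : ℤ) : ℚ) ≠ 0 := by
    simp
  have hfx : ∀ v : E → ℚ, f v = ∑ e, v e * f (Pi.single e 1) := by
    intro v
    conv_lhs => rw [← univ_sum_single v]
    rw [map_sum]
    refine sum_congr rfl fun e _ => ?_
    rw [← smul_eq_mul, ← map_smul, ← Pi.single_smul, smul_eq_mul, mul_one]
  refine ⟨∑ e : E, monomial e.1 (c e), ?_, ?_, ?_⟩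
  · intro h0
    apply hf
    have : ∀ e, f (Pi.single e 1) = 0 := by
      intro e
      have h1 := congrArg (coeff e.1) h0
      rw [coeff_sum, sum_eq_single e] at h1
      · simp only [coeff_monomial, if_true, coeff_zero] at h1
        have h2 := hca e
        rw [h1] at h2
        simpa [hb0] using h2.symm
      · intro e' _ hne
        rw [coeff_monomial, if_neg]
        exact fun h => hne (Subtype.ext h)
      · simp
    ext v
    rw [LinearMap.comp_apply, hfx]; simp [this]
  · refine MvPolynomial.support_sum.trans ?_
    intro e he
    rw [mem_biUnion] at he
    obtain ⟨e', _, he⟩ := he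
    have := support_monomial_subset he
    rw [mem_singleton] at this
    exact this ▸ e'.2
  · intro x hx
    have h1 : f (monomialVec E x) = 0 := hWf hx
    rw [hfx] at h1
    have h2 : ((eval x (∑ e : E, monomial e.1 (c e)) : ℤ) : ℚ) = 0 := by
      rw [map_sum]
      push_cast
      simp only [eval_monomial, Int.cast_mul, hca]
      rw [← mul_zero ((b : ℤ) : ℚ), ← h1, mul_sum]
      refine sum_congr rfl fun e _ => ?_
      rw [Finsupp.prod_fintype _ _ (by simp)]
      simp only [monomialVec]
      ring
    exact_mod_cast h2

theorem exists_det_ne_zero_of_span_image_eq_top {ι X : Type*} [Fintype ι] [DecidableEq ι]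
    {v : X → ι → ℚ} {S : Set X} (hS : Submodule.span ℚ (v '' S) = ⊤) :
    ∃ y : ι → X, (∀ k, y k ∈ S) ∧ (Matrix.of fun k e => v (y k) e).det ≠ 0 := by
  obtain ⟨B, hBS, hBspan, hBli⟩ := exists_linearIndependent ℚ (v '' S)
  let bas : Module.Basis B ℚ (ι → ℚ) := Module.Basis.mk hBli (by
    rw [Subtype.range_coe, hBspan, hS])
  have : Fintype B := FiniteDimensional.fintypeBasisIndex bas
  have hcard : Fintype.card B = Fintype.card ι := by
    rw [← Module.finrank_eq_card_basis bas, Module.finrank_fintype_fun_eq_card]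
  obtain ⟨φ⟩ := Fintype.card_eq.1 hcard
  have hy : ∀ b : B, ∃ y ∈ S, v y = b := fun b => hBS b.2
  choose y hyS hy using hy
  refine ⟨fun k => y (φ.symm k), fun k => hyS _, ?_⟩
  have hli : LinearIndependent ℚ (Matrix.of fun k e => v (y (φ.symm k)) e).row := by
    have h1 : LinearIndependent ℚ fun k : ι => ((φ.symm k : B) : ι → ℚ) :=
      hBli.comp _ φ.symm.injective
    have h2 : (Matrix.of fun k e => v (y (φ.symm k)) e).row
        = fun k : ι => ((φ.symm k : B) : ι → ℚ) := by
      ext k e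
      simp [Matrix.row, hy]
    rw [h2]; exact h1
  have hu := Matrix.linearIndependent_rows_iff_isUnit.1 hli
  rwa [Matrix.isUnit_iff_isUnit_det, isUnit_iff_ne_zero] at hu

open Finset MvPolynomial in
theorem exists_det_ne_zero_of_span_eq_top {σ : Type*} [Fintype σ] {E : Finset (σ →₀ ℕ)}
    [DecidableEq E] {S : Set (σ → ℤ)} (hS : Submodule.span ℚ (monomialVec E '' S) = ⊤) :
    ∃ y : E → σ → ℤ, (∀ k, y k ∈ S) ∧
      (Matrix.of fun k e : E => ∏ i, y k i ^ e.1 i).det ≠ 0 := by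
  obtain ⟨y, hyS, hy⟩ := exists_det_ne_zero_of_span_image_eq_top hS
  refine ⟨y, hyS, fun h0 => hy ?_⟩
  have h3 : (Matrix.of fun k e : E => monomialVec E (y k) e)
      = (Int.castRingHom ℚ).mapMatrix (Matrix.of fun k e : E => ∏ i, y k i ^ e.1 i) := by
    ext k e
    simp [monomialVec]
  rw [h3, ← RingHom.map_det, h0, map_zero]

open Finset MvPolynomial in
theorem exists_poly_or_exists_det_ne_zero {σ : Type*} [Fintype σ] (E : Finset (σ →₀ ℕ))
    [DecidableEq E]
    (S : Set (σ → ℤ)) :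
    (∃ g : MvPolynomial σ ℤ, g ≠ 0 ∧ g.support ⊆ E ∧ ∀ x ∈ S, eval x g = 0) ∨
    ∃ y : E → σ → ℤ, (∀ k, y k ∈ S) ∧
      (Matrix.of fun k e : E => ∏ i, y k i ^ e.1 i).det ≠ 0 := by
  by_cases h : Submodule.span ℚ (monomialVec E '' S) = ⊤
  · exact Or.inr (exists_det_ne_zero_of_span_eq_top h)
  · obtain ⟨g, h0, hE, hg⟩ := exists_poly_vanishing_of_ne_top h
    exact Or.inl ⟨g, h0, hE, fun x hx => hg x (Submodule.subset_span ⟨x, hx, rfl⟩)⟩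

open Finset MvPolynomial in
theorem exists_le_mem_support_of_dvd {σ K : Type*} [Fintype σ] [CommRing K] [IsDomain K]
    {F g : MvPolynomial σ K} {m : σ →₀ ℕ} (ω : σ → ℕ) (hm : m ∈ F.support)
    (hω : ∀ e ∈ F.support, e ≠ m → ∑ i, ω i * e i < ∑ i, ω i * m i) (hg : g ≠ 0) (hFg : F ∣ g) :
    ∃ e ∈ g.support, m ≤ e := by
  classical
  obtain ⟨h, rfl⟩ := hFg
  have hh : h ≠ 0 := right_ne_zero_of_mul hg
  obtain ⟨e', he', hmax⟩ := exists_max_image h.support (fun e => ∑ i, ω i * e i)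
    (support_nonempty.2 hh)
  refine ⟨m + e', ?_, le_self_add⟩
  rw [mem_support_iff, coeff_mul, sum_eq_single (m, e')]
  · exact mul_ne_zero (mem_support_iff.1 hm) (mem_support_iff.1 he')
  · rintro ⟨a, b⟩ hab hne
    rw [HasAntidiagonal.mem_antidiagonal] at hab
    dsimp only at hab ⊢
    by_contra h0
    have ha := mem_support_iff.2 (left_ne_zero_of_mul h0)
    have hb := mem_support_iff.2 (right_ne_zero_of_mul h0)
    have h1 := hmax b hb
    have h2 : ∑ i, ω i * a i + ∑ i, ω i * b i = ∑ i, ω i * m i + ∑ i, ω i * e' i := by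
      simp only [← sum_add_distrib, ← mul_add, ← Finsupp.add_apply, hab]
    by_cases ham : a = m
    · subst ham
      exact hne (by rw [add_left_cancel hab])
    · have := hω a ha ham
      omega
  · simp

open Finset in
theorem exists_maximal_exponent (w : Fin 3 → ℕ) (d : ℕ) (s : Finset (Fin 3 →₀ ℕ)) (hs : s.Nonempty)
    (hd : ∀ e ∈ s, ∀ i, e i ≤ d) :
    ∃ m ∈ s, (∀ e ∈ s, ∑ i, w i * e i ≤ ∑ i, w i * m i) ∧
      ∃ ω : Fin 3 → ℕ, ∀ e ∈ s, e ≠ m → ∑ i, ω i * e i < ∑ i, ω i * m i := by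
  let κ : (Fin 3 →₀ ℕ) → ℕ := fun e => e 0 + e 1 * (d + 1) + e 2 * (d + 1) ^ 2
  have hκ : ∀ e ∈ s, κ e < (d + 1) ^ 3 := by
    intro e he
    have h0 := hd e he 0
    have h1 := Nat.mul_le_mul_right (d + 1) (hd e he 1)
    have h2 := Nat.mul_le_mul_right ((d + 1) ^ 2) (hd e he 2)
    simp only [κ]
    nlinarith
  have hinj : ∀ e ∈ s, ∀ e' ∈ s, κ e = κ e' → e = e' := by
    intro e he e' he' h
    have key : ∀ a b c : ℕ, a ≤ d → b ≤ d → (a + b * (d + 1) + c * (d + 1) ^ 2) % (d + 1) = a ∧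
        (a + b * (d + 1) + c * (d + 1) ^ 2) / (d + 1) % (d + 1) = b ∧
        (a + b * (d + 1) + c * (d + 1) ^ 2) / (d + 1) / (d + 1) = c := by
      intro a b c ha hb
      have e1 : a + b * (d + 1) + c * (d + 1) ^ 2 = a + (d + 1) * (b + (d + 1) * c) := by ring
      have e2 : (a + (d + 1) * (b + (d + 1) * c)) / (d + 1) = b + (d + 1) * c := by
        rw [Nat.add_mul_div_left _ _ (by omega), Nat.div_eq_of_lt (by omega), zero_add]
      rw [e1, e2]
      refine ⟨?_, ?_, ?_⟩
      · rw [Nat.add_mul_mod_self_left, Nat.mod_eq_of_lt (by omega)]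
      · rw [Nat.add_mul_mod_self_left, Nat.mod_eq_of_lt (by omega)]
      · rw [Nat.add_mul_div_left _ _ (by omega), Nat.div_eq_of_lt (by omega), zero_add]
    obtain ⟨a0, a1, a2⟩ := key (e 0) (e 1) (e 2) (hd e he 0) (hd e he 1)
    obtain ⟨b0, b1, b2⟩ := key (e' 0) (e' 1) (e' 2) (hd e' he' 0) (hd e' he' 1)
    simp only [κ] at h
    rw [h] at a0 a1 a2
    ext i
    fin_cases i
    · exact a0.symm.trans b0
    · exact a1.symm.trans b1
    · exact a2.symm.trans b2
  have hsum : ∀ e : Fin 3 →₀ ℕ, ∑ i, ((d + 1) ^ 3 * w i + (d + 1) ^ (i : ℕ)) * e i =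
      (d + 1) ^ 3 * (∑ i, w i * e i) + κ e := by
    intro e
    simp [Fin.sum_univ_three, κ]
    ring
  obtain ⟨m, hm, hmax⟩ := exists_max_image s
    (fun e => ∑ i, ((d + 1) ^ 3 * w i + (d + 1) ^ (i : ℕ)) * e i) hs
  refine ⟨m, hm, ?_, fun i => (d + 1) ^ 3 * w i + (d + 1) ^ (i : ℕ), ?_⟩
  · intro e he
    have h1 := hmax e he
    rw [hsum, hsum] at h1
    have h2 := hκ m hm
    by_contra! hlt
    have h3 : (d + 1) ^ 3 * (∑ i, w i * m i + 1) ≤ (d + 1) ^ 3 * ∑ i, w i * e i :=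
      Nat.mul_le_mul_left _ hlt
    rw [mul_add] at h3
    omega
  · intro e he hne
    refine lt_of_le_of_ne (hmax e he) fun h => hne ?_
    have hw : ∀ e ∈ s, ((d + 1) ^ 3 * (∑ i, w i * e i) + κ e) % (d + 1) ^ 3 = κ e := by
      intro e he
      rw [Nat.mul_add_mod, Nat.mod_eq_of_lt (hκ e he)]
    refine hinj e he m hm ?_
    rw [← hw e he, ← hw m hm, ← hsum, ← hsum]
    exact congrArg (· % (d + 1) ^ 3) h

open Finset MvPolynomial in
theorem exists_eq_C_mul_primitive {σ : Type*} {g : MvPolynomial σ ℤ} (hg : g ≠ 0) :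
    ∃ (c : ℤ) (g' : MvPolynomial σ ℤ), c ≠ 0 ∧ g = C c * g' ∧
      ∀ k : ℤ, C k ∣ g' → IsUnit k := by
  set c := g.support.gcd g.coeff with hc
  have hdvd : C c ∣ g := by
    rw [C_dvd_iff_dvd_coeff]
    intro e
    by_cases he : e ∈ g.support
    · exact gcd_dvd he
    · rw [notMem_support_iff.1 he]; exact dvd_zero _
  obtain ⟨g', hg'⟩ := hdvd
  have hc0 : c ≠ 0 := by
    rintro h
    rw [h, C_0, zero_mul] at hg'
    exact hg hg'
  refine ⟨c, g', hc0, hg', fun k hk => ?_⟩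
  have h1 : c * k ∣ c := by
    conv_rhs => rw [hc]
    refine dvd_gcd fun e _ => ?_
    have : C (c * k) ∣ g := by
      rw [hg', C_mul]; exact mul_dvd_mul_left _ hk
    exact (C_dvd_iff_dvd_coeff _ _).1 this e
  obtain ⟨a, ha⟩ := h1
  refine IsUnit.of_mul_eq_one a (mul_left_cancel₀ hc0 ?_)
  rw [← mul_assoc, ← ha, mul_one]

open MvPolynomial in
theorem exists_coprime_of_not_map_dvd {σ : Type*} {F g : MvPolynomial σ ℤ}
    (hF : Irreducible (map (Int.castRingHom ℂ) F))
    (hg : ¬ map (Int.castRingHom ℂ) F ∣ map (Int.castRingHom ℂ) g) :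
    ∃ g' : MvPolynomial σ ℤ, (∀ q, q ∣ F → q ∣ g' → IsUnit q) ∧
      g'.totalDegree ≤ g.totalDegree ∧ ∀ x, eval x g = 0 → eval x g' = 0 := by
  have hinj : Function.Injective (Int.castRingHom ℂ) := Int.cast_injective
  have hg0 : g ≠ 0 := by rintro rfl; simp at hg
  obtain ⟨c, g', hc, hgg', hprim⟩ := exists_eq_C_mul_primitive hg0
  refine ⟨g', ?_, ?_, ?_⟩
  · rintro q ⟨r, hr⟩ hqg
    have h1 : map (Int.castRingHom ℂ) F = map (Int.castRingHom ℂ) q * map (Int.castRingHom ℂ) r := by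
      rw [hr, map_mul]
    rcases hF.isUnit_or_isUnit h1 with hu | hu
    · have hdeg : q.totalDegree = 0 := by
        have h2 : (map (Int.castRingHom ℂ) q).totalDegree = q.totalDegree := by
          simp only [totalDegree, support_map_of_injective _ hinj]
        rw [← h2]
        obtain ⟨a, ha, ha'⟩ := MvPolynomial.isUnit_iff_eq_C_of_isReduced.1 hu
        rw [ha', totalDegree_C]
      rw [totalDegree_eq_zero_iff_eq_C] at hdeg
      rw [hdeg] at hqg ⊢
      exact (hprim _ hqg).map C
    · refine absurd ?_ hg
      rw [h1]
      refine (hu.mul_right_dvd).2 ?_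
      refine map_dvd _ (hqg.trans ?_)
      rw [hgg']; exact dvd_mul_left _ _
  · rw [hgg', totalDegree_mul_of_isDomain (by simpa using hc) (by rintro rfl; simp [hgg'] at hg0)]
    simp
  · intro x hx
    rw [hgg', map_mul, eval_C] at hx
    exact (mul_eq_zero.1 hx).resolve_left hc

open MvPolynomial in
theorem exists_eval_add_single_eq {σ R : Type*} [DecidableEq σ] [CommRing R] (F : MvPolynomial σ R)
    (x : σ → R) (j : σ) (t : R) :
    ∃ k, eval (x + Pi.single j t) F = eval x F + t * eval x (pderiv j F) + k * t ^ 2 := by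
  induction F using MvPolynomial.induction_on with
  | C a => exact ⟨0, by simp⟩
  | add p q hp hq =>
    obtain ⟨k, hk⟩ := hp
    obtain ⟨l, hl⟩ := hq
    exact ⟨k + l, by simp only [map_add, hk, hl]; ring⟩
  | mul_X p i hp =>
    obtain ⟨k, hk⟩ := hp
    by_cases hij : i = j
    · subst hij
      refine ⟨k * (x i + t) + eval x (pderiv i p), ?_⟩
      simp only [map_mul, hk, eval_X, Derivation.leibniz, smul_eq_mul, pderiv_X_self, map_add,
        Pi.add_apply, Pi.single_eq_same, map_one]
      ring
    · refine ⟨k * x i, ?_⟩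
      simp only [map_mul, hk, eval_X, Derivation.leibniz, smul_eq_mul, pderiv_X_of_ne hij,
        map_add, Pi.add_apply, Pi.single_eq_of_ne hij, map_zero]
      ring

open MvPolynomial in
theorem eval_modEq {σ : Type*} (F : MvPolynomial σ ℤ) {x y : σ → ℤ} {n : ℤ}
    (h : ∀ i, x i ≡ y i [ZMOD n]) : eval x F ≡ eval y F [ZMOD n] := by
  induction F using MvPolynomial.induction_on with
  | C a => simp [Int.ModEq.refl]
  | add p q hp hq => simpa using hp.add hq
  | mul_X p i hp => simpa using hp.mul (h i)

open MvPolynomial in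
/-- Hensel's lemma: modulo any power of `p`, the zeros of `F` near a smooth zero of its reduction
are polynomial functions of all but one of the coordinates. -/
theorem exists_parametrization {r : ℕ} (F : MvPolynomial (Fin (r + 1)) ℤ) (j : Fin (r + 1)) {p : ℕ}
    (hp : p.Prime) (P : Fin (r + 1) → ℤ) (hP : ¬ (p : ℤ) ∣ eval P (pderiv j F)) (n : ℕ) :
    ∃ s : Fin (r + 1) → MvPolynomial (Fin r) ℤ, ∀ x, eval x F = 0 →
      (∀ i, x i ≡ P i [ZMOD p]) →
      ∀ i, eval (fun i => x (j.succAbove i) - P (j.succAbove i)) (s i) ≡ x i [ZMOD p ^ (n + 1)] := by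
  have hcop : IsCoprime (eval P (pderiv j F)) (p : ℤ) :=
    ((Nat.prime_iff_prime_int.1 hp).coprime_iff_not_dvd.2 hP).symm
  obtain ⟨α, β, hαβ⟩ := hcop
  suffices H : ∃ h : MvPolynomial (Fin r) ℤ, ∀ x, eval x F = 0 → (∀ i, x i ≡ P i [ZMOD p]) →
      eval (fun i => x (j.succAbove i) - P (j.succAbove i)) h ≡ x j [ZMOD p ^ (n + 1)] by
    obtain ⟨h, hh⟩ := H
    refine ⟨j.insertNth h fun i => X i + C (P (j.succAbove i)), fun x hx hxP i => ?_⟩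
    rcases Fin.eq_self_or_eq_succAbove j i with rfl | ⟨i, rfl⟩
    · simpa using hh x hx hxP
    · simp [Int.ModEq.refl]
  induction n with
  | zero =>
    refine ⟨C (P j), fun x _ hxP => ?_⟩
    simpa using (hxP j).symm
  | succ n ih =>
    obtain ⟨h, hh⟩ := ih
    refine ⟨h - C α * aeval (j.insertNth h fun i => X i + C (P (j.succAbove i)) :
      Fin (r + 1) → MvPolynomial (Fin r) ℤ) F, fun x hx hxP => ?_⟩
    have h1 := hh x hx hxP
    set u : Fin r → ℤ := fun i => x (j.succAbove i) - P (j.succAbove i) with hu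
    obtain ⟨t, ht⟩ := h1.symm.dvd
    have h2 : eval u (aeval (j.insertNth h fun i => X i + C (P (j.succAbove i)) :
        Fin (r + 1) → MvPolynomial (Fin r) ℤ) F) =
        eval (x + Pi.single j (p ^ (n + 1) * t)) F := by
      rw [← aeval_eq_eval, ← AlgHom.comp_apply, comp_aeval, ← aeval_eq_eval]
      refine congrArg (fun f => aeval f F) ?_
      funext i
      rcases Fin.eq_self_or_eq_succAbove j i with rfl | ⟨i, rfl⟩
      · simp [← ht]
      · simp [hu, Fin.succAbove_ne]
    obtain ⟨k, hk⟩ := exists_eval_add_single_eq F x j (p ^ (n + 1) * t)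
    rw [hx, zero_add] at hk
    obtain ⟨c, hc⟩ := (eval_modEq (pderiv j F) hxP).dvd
    apply Int.ModEq.symm
    rw [Int.modEq_iff_dvd]
    rw [map_sub, map_mul, eval_C, h2, hk]
    have h3 : eval u h = x j + p ^ (n + 1) * t := by linarith
    have h4 : eval x (pderiv j F) = eval P (pderiv j F) - p * c := by linarith
    rw [h3, h4]
    refine ⟨t * (β + α * c) - α * k * t ^ 2 * p ^ n, ?_⟩
    linear_combination (p : ℤ) ^ (n + 1) * t * (-hαβ)

open Finset in
theorem mul_card_le_sum_degree {ι : Type*} [Fintype ι] {κ : ι → Fin 2 →₀ ℕ}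
    (hκ : Function.Injective κ) (D : ℕ) :
    6 * D * Fintype.card ι ≤ 6 * ∑ e, (κ e).degree + D * (D + 1) * (D + 2) := by
  classical
  have hdeg : ∀ e, (κ e).degree = κ e 0 + κ e 1 := fun e => by
    rw [Finsupp.degree_eq_sum, Fin.sum_univ_two]
  have h1 : D * Fintype.card ι ≤ ∑ e, (κ e).degree + ∑ e, (D - (κ e).degree) := by
    rw [← sum_add_distrib, mul_comm, ← smul_eq_mul, ← card_univ, ← sum_const]
    exact sum_le_sum fun e _ => by omega
  have h2 : ∑ e, (D - (κ e).degree) ≤ ∑ n ∈ range D, (n + 1) * (D - n) := by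
    have h3 : ∑ n ∈ range D, (n + 1) * (D - n) =
        ∑ p ∈ (range D).sigma fun n => antidiagonal n, (D - p.1) := by
      rw [sum_sigma]
      simp
    rw [h3]
    let φ : ι → (_ : ℕ) × ℕ × ℕ := fun e => ⟨(κ e).degree, κ e 0, κ e 1⟩
    have hφ : Function.Injective φ := by
      intro a b hab
      apply hκ
      simp only [φ, Sigma.mk.injEq] at hab
      have h4 := eq_of_heq hab.2
      rw [Prod.mk.injEq] at h4
      ext i
      fin_cases i
      · exact h4.1
      · exact h4.2
    have h4 : ∑ e, (D - (κ e).degree) = ∑ e with (κ e).degree < D, (D - (κ e).degree) := by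
      rw [sum_filter]
      refine sum_congr rfl fun e _ => ?_
      split_ifs <;> omega
    rw [h4]
    have h5 : ∑ e with (κ e).degree < D, (D - (κ e).degree) =
        ∑ p ∈ ({e | (κ e).degree < D} : Finset ι).image φ, (D - p.1) := by
      rw [sum_image fun a _ b _ h => hφ h]
    rw [h5]
    refine sum_le_sum_of_subset fun p hp => ?_
    obtain ⟨e, he, rfl⟩ := mem_image.1 hp
    simp only [mem_filter, mem_univ, true_and] at he
    simp [φ, he, ← hdeg]
  have h3 : ∀ D, 6 * ∑ n ∈ range D, (n + 1) * (D - n) = D * (D + 1) * (D + 2) := by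
    intro D
    induction D with
    | zero => simp
    | succ D ih =>
      have h4 : ∑ n ∈ range (D + 1), (n + 1) * (D + 1 - n) =
          ∑ n ∈ range D, (n + 1) * (D - n) + ∑ n ∈ range (D + 1), (n + 1) := by
        have : ∑ n ∈ range D, (n + 1) * (D - n) = ∑ n ∈ range (D + 1), (n + 1) * (D - n) := by
          simp [sum_range_succ]
        rw [this, ← sum_add_distrib]
        refine sum_congr rfl fun n hn => ?_
        rw [mem_range] at hn
        rw [show D + 1 - n = (D - n) + 1 by omega]; ring
      have h5 : 2 * ∑ n ∈ range (D + 1), (n + 1) = (D + 1) * (D + 2) := by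
        have := sum_range_id_mul_two (D + 2)
        rw [sum_range_succ'] at this
        simp only [add_zero] at this
        rw [mul_comm, this]
        simp; ring
      rw [h4, mul_add, ih]
      nlinarith
  nlinarith [h3 D]

open Finset MvPolynomial in
theorem pow_dvd_det_eval_smul {ι : Type*} [Fintype ι] [DecidableEq ι] (p : ℤ)
    (Q : ι → MvPolynomial (Fin 2) ℤ) (v : ι → Fin 2 → ℤ) (A D : ℕ)
    (hA : 6 * A + D * (D + 1) * (D + 2) ≤ 6 * D * Fintype.card ι) :
    p ^ A ∣ (Matrix.of fun e k => eval (fun i => p * v k i) (Q e)).det := by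
  classical
  have h1 : (Matrix.of fun e k => eval (fun i => p * v k i) (Q e)) = fun e =>
      ∑ κ ∈ (Q e).support, (coeff κ (Q e) * p ^ κ.degree) • fun k => ∏ i, v k i ^ κ i := by
    funext e
    funext k
    simp only [Matrix.of_apply, eval_eq', Finset.sum_apply, Pi.smul_apply, smul_eq_mul]
    refine sum_congr rfl fun κ _ => ?_
    rw [Finsupp.degree_eq_sum, ← prod_pow_eq_pow_sum, mul_assoc, ← prod_mul_distrib]
    simp only [mul_pow]
  have h2 : (Matrix.of fun e k => eval (fun i => p * v k i) (Q e)).det =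
      Matrix.detRowAlternating (R := ℤ) fun e =>
      ∑ κ ∈ (Q e).support, (coeff κ (Q e) * p ^ κ.degree) • fun k => ∏ i, v k i ^ κ i :=
    congrArg Matrix.det h1
  rw [h2]
  have h3 := (Matrix.detRowAlternating (R := ℤ) (n := ι)).toMultilinearMap.map_sum_finset
    (fun e κ => (coeff κ (Q e) * p ^ κ.degree) • fun k => ∏ i, v k i ^ κ i)
    (fun e => (Q e).support)
  rw [AlternatingMap.coe_multilinearMap] at h3
  rw [h3]
  refine dvd_sum fun κ _ => ?_
  have h4 := (Matrix.detRowAlternating (R := ℤ) (n := ι)).toMultilinearMap.map_smul_univ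
    (fun e => coeff (κ e) (Q e) * p ^ (κ e).degree) (fun e k => ∏ i, v k i ^ κ e i)
  rw [AlternatingMap.coe_multilinearMap] at h4
  rw [h4]
  by_cases hκ : Function.Injective κ
  · refine Dvd.dvd.mul_right ?_ _
    rw [prod_mul_distrib, prod_pow_eq_pow_sum]
    refine Dvd.dvd.mul_left (pow_dvd_pow _ ?_) _
    have := mul_card_le_sum_degree hκ D
    omega
  · rw [AlternatingMap.map_eq_zero_of_not_injective, smul_zero]
    · exact dvd_zero _
    · intro h
      apply hκ
      intro a b hab
      apply h
      simp only [hab]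

open Finset in
theorem det_modEq {ι : Type*} [Fintype ι] [DecidableEq ι] {n : ℤ} {M N : Matrix ι ι ℤ}
    (h : ∀ i j, M i j ≡ N i j [ZMOD n]) : M.det ≡ N.det [ZMOD n] := by
  rw [Matrix.det_apply', Matrix.det_apply']
  exact Int.ModEq.sum fun σ _ => (Int.ModEq.prod fun i _ => h _ _).mul_left _

open Finset MvPolynomial in
theorem pow_dvd_det_of_modEq {E : Finset (Fin 3 →₀ ℕ)} [DecidableEq E] {F : MvPolynomial (Fin 3) ℤ}
    {j : Fin 3} {p : ℕ} (hp : p.Prime) (y : E → Fin 3 → ℤ) (P : Fin 3 → ℤ)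
    (hP : ¬ (p : ℤ) ∣ eval P (pderiv j F))
    (hy : ∀ k, eval (y k) F = 0) (hyP : ∀ k i, y k i ≡ P i [ZMOD p]) {A D : ℕ}
    (hA : 6 * A + D * (D + 1) * (D + 2) ≤ 6 * D * #E) :
    (p : ℤ) ^ A ∣ (Matrix.of fun k e : E => ∏ i, y k i ^ e.1 i).det := by
  obtain ⟨s, hs⟩ := exists_parametrization F j hp P hP A
  have hv : ∀ k i, ∃ v, y k i - P i = p * v := fun k i => (hyP k i).symm.dvd
  choose v hv using hv
  have h1 := pow_dvd_det_eval_smul (p : ℤ) (fun e : E => ∏ i, s i ^ e.1 i)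
    (fun k i => v k (j.succAbove i)) A D (by simpa using hA)
  rw [← Matrix.det_transpose]
  rw [← Int.modEq_zero_iff_dvd] at h1 ⊢
  refine Int.ModEq.trans (det_modEq fun e k => ?_) h1
  simp only [Matrix.transpose_apply, Matrix.of_apply, map_prod, map_pow]
  refine Int.ModEq.prod fun i _ => Int.ModEq.pow _ ?_
  have h2 := (hs (y k) (hy k) (hyP k) i).of_dvd (pow_dvd_pow (p : ℤ) (Nat.le_succ A))
  simp only [hv] at h2
  exact h2.symm

open Finset in
theorem abs_det_le_of_abs_le {ι : Type*} [Fintype ι] [DecidableEq ι] {M : Matrix ι ι ℤ} {c : ι → ℝ}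
    (h : ∀ k e, |(M k e : ℝ)| ≤ c e) :
    |(M.det : ℝ)| ≤ (Fintype.card ι).factorial * ∏ e, c e := by
  rw [Matrix.det_apply']
  push_cast
  refine (abs_sum_le_sum_abs _ _).trans ?_
  have : ∀ σ : Equiv.Perm ι, |((Equiv.Perm.sign σ : ℤ) : ℝ) * ∏ i, (M (σ i) i : ℝ)| ≤ ∏ e, c e := by
    intro σ
    rw [abs_mul, abs_prod]
    have h1 : |((Equiv.Perm.sign σ : ℤ) : ℝ)| = 1 := by
      rcases Int.units_eq_one_or (Equiv.Perm.sign σ) with h | h <;> simp [h]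
    rw [h1, one_mul]
    exact prod_le_prod (fun _ _ => abs_nonneg _) fun i _ => h _ _
  refine (sum_le_sum fun σ _ => this σ).trans ?_
  rw [sum_const, card_univ, Fintype.card_perm, nsmul_eq_mul]

open Finset in
theorem abs_monomial_le {σ : Type*} [Fintype σ] {B : σ → ℝ} {x : σ → ℤ} (hx : ∀ i, |(x i : ℝ)| ≤ B i)
    (e : σ →₀ ℕ) : |((∏ i, x i ^ e i : ℤ) : ℝ)| ≤ ∏ i, B i ^ e i := by
  push_cast
  rw [abs_prod]
  refine prod_le_prod (fun _ _ => abs_nonneg _) fun i _ => ?_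
  rw [abs_pow]
  exact pow_le_pow_left₀ (abs_nonneg _) (hx i) _

open Finset MvPolynomial in
theorem det_eq_zero_of_modEq {E : Finset (Fin 3 →₀ ℕ)} [DecidableEq E] {F : MvPolynomial (Fin 3) ℤ}
    {j : Fin 3} {I : Finset ℕ} (hI : ∀ p ∈ I, p.Prime) {B : Fin 3 → ℝ} (y : E → Fin 3 → ℤ)
    (P : Fin 3 → ℤ) (hP : ∀ p ∈ I, ¬ (p : ℤ) ∣ eval P (pderiv j F))
    (hy : ∀ k, eval (y k) F = 0) (hyP : ∀ p ∈ I, ∀ k i, y k i ≡ P i [ZMOD p])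
    (hyB : ∀ k i, |(y k i : ℝ)| ≤ B i) {A D : ℕ}
    (hA : 6 * A + D * (D + 1) * (D + 2) ≤ 6 * D * #E)
    (hbig : (#E).factorial * ∏ e ∈ E, ∏ i, B i ^ e i < (∏ p ∈ I, (p : ℝ)) ^ A) :
    (Matrix.of fun k e : E => ∏ i, y k i ^ e.1 i).det = 0 := by
  by_contra h0
  have h1 : (∏ p ∈ I, (p : ℤ)) ^ A ∣ (Matrix.of fun k e : E => ∏ i, y k i ^ e.1 i).det := by
    rw [← prod_pow]
    refine prod_dvd_of_coprime (fun p hp q hq hpq => ?_) fun p hp =>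
      pow_dvd_det_of_modEq (hI p hp) y P (hP p hp) hy (hyP p hp) hA
    refine IsCoprime.pow ?_
    rw [Nat.isCoprime_iff_coprime]
    exact (Nat.coprime_primes (hI p hp) (hI q hq)).2 hpq
  have h2 := Int.le_of_dvd (abs_pos.2 h0) ((dvd_abs _ _).2 h1)
  have h3 := abs_det_le_of_abs_le (M := Matrix.of fun k e : E => ∏ i, y k i ^ e.1 i)
    (c := fun e => ∏ i, B i ^ e.1 i) fun k e => abs_monomial_le (hyB k) e.1
  rw [Fintype.card_coe, prod_coe_sort E fun e => ∏ i, B i ^ e i] at h3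
  have h4 : (((∏ p ∈ I, (p : ℤ)) ^ A : ℤ) : ℝ) ≤
      ((|(Matrix.of fun k e : E => ∏ i, y k i ^ e.1 i).det| : ℤ) : ℝ) := by exact_mod_cast h2
  simp only [Int.cast_abs, Int.cast_pow, Int.cast_prod, Int.cast_natCast] at h4
  linarith

open Finset in
/-- The lattice points of the triangle `u y + v z ≤ n`. -/
def latticeTriangle (u v n : ℕ) : Finset ((_ : ℕ) × ℕ) :=
  (range (n / u + 1)).sigma fun y => range ((n - u * y) / v + 1)

open Finset in
theorem mem_latticeTriangle {u v n : ℕ} (hu : 0 < u) (hv : 0 < v) {p : (_ : ℕ) × ℕ} :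
    p ∈ latticeTriangle u v n → u * p.1 + v * p.2 ≤ n := by
  intro h
  simp only [latticeTriangle, mem_sigma, mem_range, Nat.lt_succ_iff] at h
  rw [Nat.le_div_iff_mul_le hu, Nat.le_div_iff_mul_le hv, mul_comm, mul_comm p.2] at h
  omega

open Finset in
theorem sq_le_card_latticeTriangle {u v : ℕ} (n : ℕ) (hu : 0 < u) (hv : 0 < v) :
    n ^ 2 ≤ 2 * u * v * #(latticeTriangle u v n) := by
  have h1 : ∀ q, u * q ≤ n → u * ((q + 1) * (2 * n)) ≤
      2 * u * v * ∑ y ∈ range (q + 1), ((n - u * y) / v + 1) + u * (u * q * (q + 1)) := by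
    intro q
    induction q with
    | zero =>
      intro _
      have := Nat.lt_mul_div_succ n hv
      simp only [sum_range_one, mul_zero, Nat.sub_zero, zero_add, zero_mul, add_zero]
      nlinarith
    | succ q ih =>
      intro hq
      have h2 := ih (le_trans (Nat.mul_le_mul_left _ (Nat.le_succ q)) hq)
      rw [sum_range_succ]
      have h3 := Nat.lt_mul_div_succ (n - u * (q + 1)) hv
      have h4 : n < v * ((n - u * (q + 1)) / v + 1) + u * (q + 1) := by omega
      have h5 := Nat.mul_le_mul_left (2 * u) h4.le
      nlinarith
  have h2 := h1 (n / u) (Nat.mul_div_le n u)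
  have h3 : #(latticeTriangle u v n) = ∑ y ∈ range (n / u + 1), ((n - u * y) / v + 1) := by
    simp [latticeTriangle]
  rw [← h3] at h2
  have h4 := Nat.lt_mul_div_succ n hu
  have h5 := Nat.mul_div_le n u
  nlinarith [Nat.mul_le_mul_left (u * (n / u + 1)) h5]

open Finset in
/-- The exponents of weight at most `k` that do not dominate `m`. -/
def weightedExponents (w m : ℕ × ℕ × ℕ) (k : ℕ) : Finset (ℕ × ℕ × ℕ) :=
  {e ∈ range (k + 1) ×ˢ range (k + 1) ×ˢ range (k + 1) |
    w.1 * e.1 + w.2.1 * e.2.1 + w.2.2 * e.2.2 ≤ k ∧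
      ¬ (m.1 ≤ e.1 ∧ m.2.1 ≤ e.2.1 ∧ m.2.2 ≤ e.2.2)}

open Finset in
theorem mem_weightedExponents {w m : ℕ × ℕ × ℕ} (hw : 0 < w.1 ∧ 0 < w.2.1 ∧ 0 < w.2.2) {k : ℕ}
    {e : ℕ × ℕ × ℕ} : e ∈ weightedExponents w m k ↔
      w.1 * e.1 + w.2.1 * e.2.1 + w.2.2 * e.2.2 ≤ k ∧
        ¬ (m.1 ≤ e.1 ∧ m.2.1 ≤ e.2.1 ∧ m.2.2 ≤ e.2.2) := by
  simp only [weightedExponents, mem_filter, mem_product, mem_range, Nat.lt_succ_iff,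
    and_iff_right_iff_imp]
  rintro ⟨h, -⟩
  have h1 := Nat.le_mul_of_pos_left e.1 hw.1
  have h2 := Nat.le_mul_of_pos_left e.2.1 hw.2.1
  have h3 := Nat.le_mul_of_pos_left e.2.2 hw.2.2
  omega

open Finset in
theorem card_weightedExponents_le (w m : ℕ × ℕ × ℕ) (k : ℕ) :
    #(weightedExponents w m k) ≤ (m.1 + m.2.1 + m.2.2) * (k + 1) ^ 2 := by
  have : weightedExponents w m k ⊆
      range m.1 ×ˢ range (k + 1) ×ˢ range (k + 1) ∪
      range (k + 1) ×ˢ range m.2.1 ×ˢ range (k + 1) ∪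
      range (k + 1) ×ˢ range (k + 1) ×ˢ range m.2.2 := by
    intro e he
    simp only [weightedExponents, mem_filter, mem_product, mem_range, mem_union] at he ⊢
    omega
  refine (card_le_card this).trans ((card_union_le _ _).trans
    ((Nat.add_le_add_right (card_union_le _ _) _).trans (le_of_eq ?_)))
  simp only [card_product, card_range]
  ring

open Finset in
theorem le_card_weightedExponents {w m : ℕ × ℕ × ℕ} (hw : 0 < w.1 ∧ 0 < w.2.1 ∧ 0 < w.2.2) (n : ℕ) :
    (w.1 * m.1 + w.2.1 * m.2.1 + w.2.2 * m.2.2) * n ^ 2 ≤ 2 * (w.1 * w.2.1 * w.2.2) *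
      #(weightedExponents w m (w.1 * m.1 + w.2.1 * m.2.1 + w.2.2 * m.2.2 + n)) := by
  obtain ⟨u, v, t⟩ := w
  obtain ⟨a, b, c⟩ := m
  obtain ⟨hu, hv, ht⟩ := hw
  dsimp only at *
  set E := weightedExponents (u, v, t) (a, b, c) (u * a + v * b + t * c + n) with hE
  have hmem : ∀ e, e ∈ E ↔ _ := fun e => mem_weightedExponents (m := (a, b, c)) ⟨hu, hv, ht⟩
  dsimp only at hmem
  have h1 : a * #(latticeTriangle v t n) ≤ #{e ∈ E | e.1 < a} := by
    rw [show a * #(latticeTriangle v t n) = #(range a ×ˢ latticeTriangle v t n) by simp]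
    refine card_le_card_of_injOn (fun p => (p.1, p.2.1, p.2.2)) ?_ ?_
    · intro p hp
      rw [mem_coe, mem_product, mem_range] at hp
      have h := mem_latticeTriangle hv ht hp.2
      have h' := Nat.mul_le_mul_left u hp.1.le
      rw [mem_coe, mem_filter, hmem]
      dsimp only
      omega
    · rintro ⟨p, q, r⟩ _ ⟨p', q', r'⟩ _ h
      simpa using h
  have h2 : b * #(latticeTriangle u t n) ≤ #{e ∈ E | a ≤ e.1 ∧ e.2.1 < b} := by
    rw [show b * #(latticeTriangle u t n) = #(range b ×ˢ latticeTriangle u t n) by simp]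
    refine card_le_card_of_injOn (fun p => (a + p.2.1, p.1, p.2.2)) ?_ ?_
    · intro p hp
      rw [mem_coe, mem_product, mem_range] at hp
      have h := mem_latticeTriangle hu ht hp.2
      have h' := Nat.mul_le_mul_left v hp.1.le
      rw [mem_coe, mem_filter, hmem]
      dsimp only
      rw [mul_add]
      omega
    · rintro ⟨p, q, r⟩ _ ⟨p', q', r'⟩ _ h
      simp at h ⊢; tauto
  have h3 : c * #(latticeTriangle u v n) ≤ #{e ∈ E | a ≤ e.1 ∧ b ≤ e.2.1} := by
    rw [show c * #(latticeTriangle u v n) = #(range c ×ˢ latticeTriangle u v n) by simp]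
    refine card_le_card_of_injOn (fun p => (a + p.2.1, b + p.2.2, p.1)) ?_ ?_
    · intro p hp
      rw [mem_coe, mem_product, mem_range] at hp
      have h := mem_latticeTriangle hu hv hp.2
      have h' := Nat.mul_le_mul_left t hp.1.le
      rw [mem_coe, mem_filter, hmem]
      dsimp only
      rw [mul_add, mul_add]
      omega
    · rintro ⟨p, q, r⟩ _ ⟨p', q', r'⟩ _ h
      simp at h ⊢; tauto
  have h4 : #{e ∈ E | e.1 < a} + #{e ∈ E | a ≤ e.1 ∧ e.2.1 < b} +
      #{e ∈ E | a ≤ e.1 ∧ b ≤ e.2.1} = #E := by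
    simp only [card_filter, card_eq_sum_ones E, ← sum_add_distrib]
    refine sum_congr rfl fun e _ => ?_
    split_ifs <;> omega
  have g1 := Nat.mul_le_mul_left (u * a) (sq_le_card_latticeTriangle n hv ht)
  have g2 := Nat.mul_le_mul_left (v * b) (sq_le_card_latticeTriangle n hu ht)
  have g3 := Nat.mul_le_mul_left (t * c) (sq_le_card_latticeTriangle n hu hv)
  have h5 := Nat.mul_le_mul_left (2 * (u * v * t)) (Nat.add_le_add (Nat.add_le_add h1 h2) h3)
  rw [h4] at h5
  refine le_trans ?_ h5
  nlinarith

open Finset in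
theorem sum_weight_weightedExponents {w m : ℕ × ℕ × ℕ} (hw : 0 < w.1 ∧ 0 < w.2.1 ∧ 0 < w.2.2)
    (x : ℕ) :
    ∑ e ∈ weightedExponents w m x, (w.1 * e.1 + w.2.1 * e.2.1 + w.2.2 * e.2.2) +
      ∑ k ∈ range x, #(weightedExponents w m k) = x * #(weightedExponents w m x) := by
  have h1 : ∀ k ∈ range x, #(weightedExponents w m k) = ∑ e ∈ weightedExponents w m x,
      if w.1 * e.1 + w.2.1 * e.2.1 + w.2.2 * e.2.2 ≤ k then 1 else 0 := by
    intro k hk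
    rw [← card_filter]
    congr 1
    ext e
    rw [mem_range] at hk
    rw [mem_filter, mem_weightedExponents hw, mem_weightedExponents hw]
    omega
  rw [sum_congr rfl h1, sum_comm, ← sum_add_distrib, mul_comm, ← smul_eq_mul, ← sum_const]
  refine sum_congr rfl fun e he => ?_
  rw [mem_weightedExponents hw] at he
  rw [← card_filter]
  have : ({k ∈ range x | w.1 * e.1 + w.2.1 * e.2.1 + w.2.2 * e.2.2 ≤ k} : Finset ℕ) =
      Ico (w.1 * e.1 + w.2.1 * e.2.1 + w.2.2 * e.2.2) x := by
    ext k
    simp only [mem_filter, mem_range, mem_Ico]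
    omega
  rw [this, Nat.card_Ico]
  omega

set_option maxHeartbeats 1000000 in
open Finset in
theorem exists_sum_le_mul_of_quadratic_growth {ρ δ C : ℝ} (hρ : 0 < ρ) (hδ : 0 < δ) (M : ℕ)
    (s : ℕ → ℕ) (hs : ∀ n : ℕ, (n : ℝ) ^ 2 ≤ 2 * ρ ^ 2 * s (M + n))
    (hC : ∀ k, (s k : ℝ) ≤ C * (k + 1) ^ 2) :
    ∃ x A D : ℕ, 1 ≤ A ∧ 6 * A + D * (D + 1) * (D + 2) ≤ 6 * D * s x ∧
      (x : ℝ) * s x - ∑ k ∈ range x, (s k : ℝ) ≤ (ρ + δ) * A := by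
  have hC0 : 0 ≤ C := by
    have := (Nat.cast_nonneg (α := ℝ) (s 0)).trans (hC 0)
    simpa using this
  set c : ℝ := 1 / (2 * ρ ^ 2) with hc
  have hcpos : 0 < c := by positivity
  set K : ℝ := C * (M + 2) ^ 2 with hK
  set K1 : ℝ := ρ * K + 1 / (2 * ρ) + 1 / 3 + ρ with hK1
  set K2 : ℝ := M * K + c / 2 with hK2
  have hKpos : 0 ≤ K := by positivity
  have hK1pos : 0 < K1 := by positivity
  have hK2pos : 0 < K2 := by positivity
  obtain ⟨n, hn⟩ := exists_nat_ge ((ρ / δ * (K1 + K2) + K1) * (3 / (2 * c)) + 1)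
  have hn1 : (1 : ℝ) ≤ n := by
    refine le_trans ?_ hn
    have : 0 ≤ (ρ / δ * (K1 + K2) + K1) * (3 / (2 * c)) := by positivity
    linarith
  have hlarge : ρ / δ * (K1 + K2) ≤ 2 * c / 3 * n - K1 := by
    have h1 : (ρ / δ * (K1 + K2) + K1) * (3 / (2 * c)) ≤ n := by linarith
    have h2 : 2 * c / 3 * ((ρ / δ * (K1 + K2) + K1) * (3 / (2 * c))) ≤ 2 * c / 3 * n := by gcongr
    have h3 : 2 * c / 3 * ((ρ / δ * (K1 + K2) + K1) * (3 / (2 * c))) =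
      ρ / δ * (K1 + K2) + K1 := by field_simp
    linarith
  set S : ℝ := (s (M + n) : ℝ) with hS
  have hSlow : c * n ^ 2 ≤ S := by
    have := hs n
    rw [hc, one_div_mul_eq_div, div_le_iff₀ (by positivity)]
    linarith
  have hSup : S ≤ K * n ^ 2 := by
    refine (hC (M + n)).trans ?_
    rw [hK, mul_assoc, ← mul_pow]
    push_cast
    gcongr
    nlinarith [Nat.cast_nonneg (α := ℝ) M]
  have hsum : c * (n ^ 3 / 3 - n ^ 2 / 2) ≤ ∑ k ∈ range (M + n), (s k : ℝ) := by
    have h1 : ∑ i ∈ range n, c * (i : ℝ) ^ 2 ≤ ∑ k ∈ range (M + n), (s k : ℝ) := by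
      rw [sum_range_add]
      have : 0 ≤ ∑ k ∈ range M, (s k : ℝ) := sum_nonneg fun _ _ => Nat.cast_nonneg _
      have h2 : ∑ i ∈ range n, c * (i : ℝ) ^ 2 ≤ ∑ i ∈ range n, (s (M + i) : ℝ) := by
        refine sum_le_sum fun i _ => ?_
        rw [hc, one_div_mul_eq_div, div_le_iff₀ (by positivity)]
        linarith [hs i]
      linarith
    refine le_trans ?_ h1
    rw [← mul_sum]
    gcongr
    have : ∀ n : ℕ, (n : ℝ) ^ 3 / 3 - n ^ 2 / 2 ≤ ∑ i ∈ range n, (i : ℝ) ^ 2 := by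
      intro n
      induction n with
      | zero => simp
      | succ n ih =>
        rw [sum_range_succ]; push_cast; nlinarith
    exact this n
  set D := ⌊(n : ℝ) / ρ⌋₊ with hD
  have hD1 : ρ * D ≤ n := by
    have := Nat.floor_le (show 0 ≤ (n : ℝ) / ρ by positivity)
    rw [le_div_iff₀ hρ] at this
    linarith
  have hD2 : n - ρ ≤ ρ * D := by
    have := Nat.lt_floor_add_one ((n : ℝ) / ρ)
    rw [div_lt_iff₀ hρ] at this
    linarith
  have hDnn : (0 : ℝ) ≤ D := Nat.cast_nonneg _
  have hq : ρ * ((D : ℝ) * (D + 1) * (D + 2) / 6) ≤ c * n ^ 3 / 3 + (1 / (2 * ρ) + 1 / 3) * n ^ 2 := by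
    have hDle : (D : ℝ) ≤ n / ρ := by rw [le_div_iff₀ hρ]; linarith
    have e3 : ρ * (D : ℝ) ^ 3 ≤ ρ * (n / ρ) ^ 3 := by gcongr
    have e2 : ρ * (D : ℝ) ^ 2 ≤ ρ * (n / ρ) ^ 2 := by gcongr
    have e1 : (n : ℝ) ≤ n ^ 2 := by nlinarith
    have f3 : ρ * ((n : ℝ) / ρ) ^ 3 = 2 * c * n ^ 3 := by rw [hc]; field_simp
    have f2 : ρ * ((n : ℝ) / ρ) ^ 2 = 2 * (1 / (2 * ρ)) * n ^ 2 := by field_simp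
    rw [f3] at e3
    rw [f2] at e2
    linarith
  -- the exponent `A`
  set A := (6 * D * s (M + n) - D * (D + 1) * (D + 2)) / 6 with hA
  have hAlow : (D : ℝ) * S - D * (D + 1) * (D + 2) / 6 - 1 ≤ A := by
    have h1 : 6 * D * s (M + n) ≤ D * (D + 1) * (D + 2) + 6 * A + 6 := by omega
    have h2 : 6 * (D : ℝ) * S ≤ D * (D + 1) * (D + 2) + 6 * A + 6 := by
      rw [hS]; exact_mod_cast h1
    linarith
  have hρA : n * S - c * n ^ 3 / 3 - K1 * n ^ 2 ≤ ρ * A := by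
    have h1 : ρ * ((D : ℝ) * S - D * (D + 1) * (D + 2) / 6 - 1) ≤ ρ * A := by gcongr
    have h2 : (n - ρ) * S ≤ ρ * D * S := by
      have : 0 ≤ S := Nat.cast_nonneg _
      gcongr
    have h3 : ρ * S ≤ ρ * (K * n ^ 2) := by gcongr
    have h4 : ρ * 1 ≤ ρ * (n : ℝ) ^ 2 := by gcongr; nlinarith
    rw [hK1]
    linarith
  have hA0 : n ^ 2 * (ρ / δ * (K1 + K2)) ≤ ρ * A := by
    have h1 : (n : ℝ) * (c * n ^ 2) ≤ n * S := by gcongr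
    have h2 : (n : ℝ) ^ 2 * (ρ / δ * (K1 + K2)) ≤ n ^ 2 * (2 * c / 3 * n - K1) := by gcongr
    nlinarith
  have hAδ : n ^ 2 * (K1 + K2) ≤ δ * A := by
    have h1 : (n : ℝ) ^ 2 * (ρ / δ * (K1 + K2)) = ρ * (n ^ 2 * (K1 + K2) / δ) := by field_simp
    rw [h1] at hA0
    have := le_of_mul_le_mul_left hA0 hρ
    rw [div_le_iff₀ hδ] at this
    linarith
  have hApos : 1 ≤ A := by
    have h1 : 0 < δ * A := lt_of_lt_of_le (by positivity) hAδ
    have h2 : (0 : ℝ) < A := pos_of_mul_pos_right h1 hδ.le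
    exact_mod_cast h2
  refine ⟨M + n, A, D, hApos, ?_, ?_⟩
  · omega
  · have h1 : (M : ℝ) * S ≤ M * (K * n ^ 2) := by gcongr
    push_cast
    rw [← hS]
    nlinarith

open Finset in
theorem exists_weighted_exponent_set {w : Fin 3 → ℕ} (hw : ∀ i, 0 < w i) {m : Fin 3 →₀ ℕ}
    (hm : 0 < ∑ i, w i * m i) {δ : ℝ} (hδ : 0 < δ) :
    ∃ E : Finset (Fin 3 →₀ ℕ), (∀ e ∈ E, ¬ m ≤ e) ∧ ∃ A D : ℕ, 1 ≤ A ∧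
      6 * A + D * (D + 1) * (D + 2) ≤ 6 * D * #E ∧
      ∑ e ∈ E, ∑ i, (w i : ℝ) * e i ≤
        (Real.sqrt ((∏ i, (w i : ℝ)) / ∑ i, (w i : ℝ) * m i) + δ) * A := by
  set w' : ℕ × ℕ × ℕ := (w 0, w 1, w 2) with hw'
  set m' : ℕ × ℕ × ℕ := (m 0, m 1, m 2) with hm'
  have hwpos : 0 < w'.1 ∧ 0 < w'.2.1 ∧ 0 < w'.2.2 := ⟨hw 0, hw 1, hw 2⟩
  have hM : (0 : ℝ) < ∑ i, (w i : ℝ) * m i := by exact_mod_cast hm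
  have hW : (0 : ℝ) < ∏ i, (w i : ℝ) := prod_pos fun i _ => by exact_mod_cast hw i
  obtain ⟨x, A, D, hA, hAD, hsum⟩ := exists_sum_le_mul_of_quadratic_growth
    (ρ := Real.sqrt ((∏ i, (w i : ℝ)) / ∑ i, (w i : ℝ) * m i)) (C := ((m 0 + m 1 + m 2 : ℕ) : ℝ))
    (by positivity) hδ (w 0 * m 0 + w 1 * m 1 + w 2 * m 2) (fun k => #(weightedExponents w' m' k))
    (by
      intro n
      have h1 := le_card_weightedExponents (m := m') hwpos n
      rw [Real.sq_sqrt (by positivity), mul_div_assoc', div_mul_eq_mul_div, le_div_iff₀ hM, mul_comm]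
      simp only [Fin.sum_univ_three, Fin.prod_univ_three]
      exact_mod_cast h1)
    (by
      intro k
      exact_mod_cast card_weightedExponents_le w' m' k)
  let φ : ℕ × ℕ × ℕ ↪ (Fin 3 →₀ ℕ) :=
    ⟨fun e => Finsupp.equivFunOnFinite.symm ![e.1, e.2.1, e.2.2], by
      rintro ⟨a, b, c⟩ ⟨a', b', c'⟩ h
      have h := Finsupp.equivFunOnFinite.symm.injective h
      simpa using h⟩
  refine ⟨(weightedExponents w' m' x).map φ, ?_, A, D, hA, by simpa using hAD, ?_⟩
  · intro e he hle
    obtain ⟨t, ht, rfl⟩ := mem_map.1 he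
    rw [mem_weightedExponents hwpos] at ht
    exact ht.2 ⟨hle 0, hle 1, hle 2⟩
  · have h2 := sum_weight_weightedExponents (m := m') hwpos x
    have h3 : ∑ e ∈ (weightedExponents w' m' x).map φ, ∑ i, (w i : ℝ) * e i =
        ((∑ e ∈ weightedExponents w' m' x, (w'.1 * e.1 + w'.2.1 * e.2.1 + w'.2.2 * e.2.2) : ℕ) : ℝ) := by
      rw [sum_map]
      push_cast
      refine sum_congr rfl fun e _ => ?_
      rw [Fin.sum_univ_three]
      rfl
    have h4 : ((∑ e ∈ weightedExponents w' m' x,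
        (w'.1 * e.1 + w'.2.1 * e.2.1 + w'.2.2 * e.2.2) : ℕ) : ℝ) +
        ∑ k ∈ range x, (#(weightedExponents w' m' k) : ℝ) = x * #(weightedExponents w' m' x) := by
      exact_mod_cast h2
    rw [h3]
    linarith

open Finset in
theorem card_filter_small_fiber_le {X Y : Type*} [DecidableEq Y] (S : Finset X) (φ : X → Y) {a : ℝ}
    (ha : 0 ≤ a) :
    (#{x ∈ S | (#{y ∈ S | φ y = φ x} : ℝ) < a} : ℝ) ≤ a * #(S.image φ) := by
  have h1 : #{x ∈ S | (#{y ∈ S | φ y = φ x} : ℝ) < a} ≤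
      ⌊a⌋₊ * #({x ∈ S | (#{y ∈ S | φ y = φ x} : ℝ) < a}.image φ) := by
    refine card_le_mul_card_image _ _ fun c hc => ?_
    obtain ⟨x, hx, rfl⟩ := mem_image.1 hc
    rw [mem_filter] at hx
    refine Nat.le_floor ?_
    refine le_trans ?_ hx.2.le
    exact_mod_cast card_le_card fun y hy => by
      simp only [mem_filter] at hy ⊢; exact ⟨hy.1.1, hy.2⟩
  have h2 : #({x ∈ S | (#{y ∈ S | φ y = φ x} : ℝ) < a}.image φ) ≤ #(S.image φ) :=
    card_le_card (image_subset_image (filter_subset _ _))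
  calc (#{x ∈ S | (#{y ∈ S | φ y = φ x} : ℝ) < a} : ℝ)
      ≤ ⌊a⌋₊ * #({x ∈ S | (#{y ∈ S | φ y = φ x} : ℝ) < a}.image φ) := by exact_mod_cast h1
    _ ≤ a * #(S.image φ) := by
        gcongr
        exact Nat.floor_le ha

open Finset in
theorem exists_few_small_fibers {X Q α : Type*} [DecidableEq α] {S : Finset X} (hS : S.Nonempty)
    {pool : Finset Q} (hpool : pool.Nonempty) (cls : Q → X → α) {K β : ℝ} (hK0 : 0 < K) (hβ : 0 ≤ β)
    (hK : ∀ p ∈ pool, (#(S.image (cls p)) : ℝ) ≤ K) (t L : ℕ) :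
    ∃ x ∈ S, ∀ l, t ≤ l → l < t + L →
      (#{I ∈ Fintype.piFinset fun _ : Fin l => pool |
        (#{y ∈ S | ∀ i, cls (I i) y = cls (I i) x} : ℝ) < β * #S / K ^ l} : ℝ) ≤
        L * β * #pool ^ l := by
  classical
  set N : ℝ := (#pool : ℝ) with hN
  have hNpos : 0 < N := by
    rw [hN]; exact_mod_cast hpool.card_pos
  let bad : X → ℕ → ℕ := fun x l => #{I ∈ Fintype.piFinset fun _ : Fin l => pool |
        (#{y ∈ S | ∀ i, cls (I i) y = cls (I i) x} : ℝ) < β * #S / K ^ l}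
  have hbad : ∀ l, ∑ x ∈ S, (bad x l : ℝ) ≤ N ^ l * (β * #S) := by
    intro l
    have h1 : ∑ x ∈ S, (bad x l : ℝ) = ∑ I ∈ Fintype.piFinset fun _ : Fin l => pool,
        (#{x ∈ S | (#{y ∈ S | ∀ i, cls (I i) y = cls (I i) x} : ℝ) < β * #S / K ^ l} : ℝ) := by
      simp only [bad, card_filter]
      push_cast
      rw [sum_comm]
    rw [h1]
    have h2 : ∀ I ∈ Fintype.piFinset fun _ : Fin l => pool,
        (#{x ∈ S | (#{y ∈ S | ∀ i, cls (I i) y = cls (I i) x} : ℝ) < β * #S / K ^ l} : ℝ) ≤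
        β * #S := by
      intro I hI
      rw [Fintype.mem_piFinset] at hI
      have h3 := card_filter_small_fiber_le S (fun x (i : Fin l) => cls (I i) x)
        (a := β * #S / K ^ l) (by positivity)
      simp only [funext_iff] at h3
      refine h3.trans ?_
      have h4 : (#(S.image fun x (i : Fin l) => cls (I i) x) : ℝ) ≤ K ^ l := by
        have h5 : S.image (fun x (i : Fin l) => cls (I i) x) ⊆
            Fintype.piFinset fun i => S.image (cls (I i)) := by
          intro f hf
          obtain ⟨x, hx, rfl⟩ := mem_image.1 hf
          rw [Fintype.mem_piFinset]
          exact fun i => mem_image_of_mem _ hx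
        have h6 := card_le_card h5
        rw [Fintype.card_piFinset] at h6
        calc (#(S.image fun x (i : Fin l) => cls (I i) x) : ℝ)
            ≤ ∏ i, (#(S.image (cls (I i))) : ℝ) := by exact_mod_cast h6
          _ ≤ ∏ _i : Fin l, K := prod_le_prod (fun _ _ => Nat.cast_nonneg _) fun i _ => hK _ (hI i)
          _ = K ^ l := by simp
      calc β * #S / K ^ l * (#(S.image fun x (i : Fin l) => cls (I i) x) : ℝ)
          ≤ β * #S / K ^ l * K ^ l := by gcongr
        _ = β * #S := by field_simp
    refine (sum_le_sum h2).trans ?_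
    rw [sum_const, Fintype.card_piFinset, nsmul_eq_mul]
    simp [hN]
  by_contra! hcon
  have h1 : ∀ x ∈ S, (L : ℝ) * β < ∑ l ∈ Ico t (t + L), (bad x l : ℝ) / N ^ l := by
    intro x hx
    obtain ⟨l, hl1, hl2, hl⟩ := hcon x hx
    refine lt_of_lt_of_le ?_ (single_le_sum (f := fun l => (bad x l : ℝ) / N ^ l)
      (fun _ _ => by positivity) (mem_Ico.2 ⟨hl1, hl2⟩))
    rw [lt_div_iff₀ (by positivity)]
    exact hl
  have h2 := sum_lt_sum_of_nonempty hS h1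
  rw [sum_comm, sum_const, nsmul_eq_mul] at h2
  have h3 : ∑ l ∈ Ico t (t + L), ∑ x ∈ S, (bad x l : ℝ) / N ^ l ≤
      ∑ l ∈ Ico t (t + L), β * #S := by
    refine sum_le_sum fun l _ => ?_
    rw [← sum_div, div_le_iff₀ (by positivity)]
    linarith [hbad l]
  rw [sum_const, Nat.card_Ico, nsmul_eq_mul, Nat.add_sub_cancel_left] at h3
  linarith

open Finset in
theorem exists_dense_subspace {X Q α V : Type*} [DecidableEq X] [DecidableEq Q] [DecidableEq α]
    [AddCommGroup V] [Module ℚ V] [FiniteDimensional ℚ V] {S : Finset X} (hS : S.Nonempty)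
    {pool : Finset Q} (cls : Q → X → α) (good : X → Finset Q) (vec : X → V) {t L m₀ : ℕ} {K R H : ℝ}
    (hL : 0 < L) (hm₀ : 1 ≤ m₀) (hR1 : 1 ≤ R) (hRK : R ≤ K) (hH1 : 1 ≤ H)
    (hgood : ∀ x ∈ S, good x ⊆ pool) (hhalf : ∀ x ∈ S, #pool ≤ 2 * #(good x))
    (hR : ∀ x ∈ S, R ≤ #(good x)) (hN : ∀ x ∈ S, 2 * (t + L) ^ 2 ≤ #(good x))
    (hK : ∀ p ∈ pool, (#(S.image (cls p)) : ℝ) ≤ K)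
    (hm : ∀ x ∈ S, ∀ y ∈ S, y ≠ x → #{p ∈ pool | cls p y = cls p x} ≤ m₀)
    (hH : (#pool : ℝ) ^ (8 * ((t + L : ℕ) : ℝ) * Module.finrank ℚ V / L) ≤ H)
    (hprop : ∀ x ∈ S, ∀ I ⊆ good x, t ≤ #I →
      Submodule.span ℚ (vec '' {y | y ∈ S ∧ ∀ p ∈ I, cls p y = cls p x}) ≠ ⊤)
    (hbig : 4 * L * 2 ^ (t + L) * H * K ^ (t + L) ≤ #S) :
    ∃ W₀ : Submodule ℚ V, W₀ ≠ ⊤ ∧ ∃ S' ⊆ S, (∀ y ∈ S', vec y ∈ W₀) ∧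
      (#S : ℝ) ≤ 8 * L * 2 ^ (t + L) * H ^ 2 * (K * m₀ / R) ^ (t + L) * #S' := by
  classical
  have hK1 : 1 ≤ K := hR1.trans hRK
  have hLpos : (0 : ℝ) < L := by exact_mod_cast hL
  have hpool : pool.Nonempty := by
    obtain ⟨x, hx⟩ := hS
    have h1 : (0 : ℝ) < #(good x) := by linarith [hR x hx]
    exact (card_pos.1 (by exact_mod_cast h1)).mono (hgood x hx)
  set β : ℝ := 1 / (2 * L * 2 ^ (t + L) * H) with hβdef
  have hβ : 0 < β := by positivity
  obtain ⟨x, hxS, hx⟩ := exists_few_small_fibers hS hpool cls (by linarith) hβ.le hK t L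
  set P := {p // p ∈ good x} with hP
  set n := #(good x) with hn
  have hcardP : Fintype.card P = n := Fintype.card_coe _
  have hnpos : (0 : ℝ) < n := by linarith [hR x hxS]
  obtain ⟨l, htl, hlL, W₀, hW₀, A, hAW, hA⟩ := exists_large_fiber (P := P)
    (fun I => Submodule.span ℚ (vec '' {y | y ∈ S ∧ ∀ p ∈ I, cls p.1 y = cls p.1 x}))
    (fun I J hIJ => Submodule.span_mono (Set.image_mono fun y hy =>
      ⟨hy.1, fun p hp => hy.2 p (hIJ hp)⟩)) t L hL
    (fun I hI => by
      have h1 := hprop x hxS (I.map (Function.Embedding.subtype _))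
        (fun p hp => by
          obtain ⟨q, _, rfl⟩ := mem_map.1 hp
          exact q.2) (by rwa [card_map])
      convert h1 using 6
      simp [P])
    (by rw [hcardP]; exact hN x hxS)
  rw [hcardP] at hA
  refine ⟨W₀, hW₀, ?_⟩
  set N : ℝ := (#pool : ℝ) with hNdef
  have hN2 : N ≤ 2 * n := by
    rw [hNdef]; exact_mod_cast hhalf x hxS
  have hnN : (n : ℝ) ≤ N := by
    rw [hNdef]; exact_mod_cast card_le_card (hgood x hxS)
  have hA1 : (n : ℝ) ^ l / H ≤ #A := by
    refine le_trans ?_ hA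
    rw [Real.rpow_sub hnpos, Real.rpow_natCast]
    have h1 : (n : ℝ) ^ (8 * (l : ℝ) * Module.finrank ℚ V / L) ≤ H := by
      refine le_trans ?_ hH
      have h2 : (n : ℝ) ^ (8 * (l : ℝ) * Module.finrank ℚ V / L) ≤
          N ^ (8 * (l : ℝ) * Module.finrank ℚ V / L) :=
        Real.rpow_le_rpow hnpos.le hnN (by positivity)
      refine h2.trans (Real.rpow_le_rpow_of_exponent_le (by linarith [hR x hxS]) ?_)
      have : (l : ℝ) ≤ ((t + L : ℕ) : ℝ) := by exact_mod_cast hlL.le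
      gcongr
    gcongr
  set a : ℝ := β * #S / K ^ l with ha
  have hSpos : (0 : ℝ) < #S := by exact_mod_cast hS.card_pos
  have ha2 : 2 ≤ a := by
    rw [ha, le_div_iff₀ (by positivity), hβdef, div_mul_eq_mul_div, le_div_iff₀ (by positivity)]
    have : K ^ l ≤ K ^ (t + L) := pow_le_pow_right₀ hK1 hlL.le
    calc 2 * K ^ l * (2 * L * 2 ^ (t + L) * H) ≤ 2 * K ^ (t + L) * (2 * L * 2 ^ (t + L) * H) := by
          gcongr
      _ = 4 * L * 2 ^ (t + L) * H * K ^ (t + L) := by ring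
      _ ≤ 1 * #S := by linarith
  -- the points agreeing with `x` modulo the primes of a tuple
  set C : (Fin l → P) → Finset X := fun I => {y ∈ S | ∀ i, cls (I i).1 y = cls (I i).1 x} with hC
  set A' : Finset (Fin l → P) := {I ∈ A | a ≤ #(C I)} with hA'
  have hbad : (#{I ∈ A | ¬ a ≤ #(C I)} : ℝ) ≤ L * β * N ^ l := by
    refine le_trans ?_ (hx l htl hlL)
    have : #{I ∈ A | ¬ a ≤ #(C I)} ≤ #{I ∈ Fintype.piFinset fun _ : Fin l => pool |
        (#{y ∈ S | ∀ i, cls (I i) y = cls (I i) x} : ℝ) < β * #S / K ^ l} := by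
      refine card_le_card_of_injOn (fun I i => (I i).1) ?_ ?_
      · intro I hI
        rw [mem_coe, mem_filter, not_le] at hI
        rw [mem_coe, mem_filter, Fintype.mem_piFinset]
        exact ⟨fun i => hgood x hxS (I i).2, hI.2⟩
      · intro I _ J _ hIJ
        funext i
        exact Subtype.ext (congrFun hIJ i)
    exact_mod_cast this
  have hA'card : (n : ℝ) ^ l / (2 * H) ≤ #A' := by
    have h1 : (#A : ℝ) = #A' + #{I ∈ A | ¬ a ≤ #(C I)} := by
      exact_mod_cast (card_filter_add_card_filter_not (s := A) (fun I => a ≤ #(C I))).symm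
    have h2 : L * β * N ^ l ≤ (n : ℝ) ^ l / (2 * H) := by
      have h3 : N ^ l ≤ (2 * n : ℝ) ^ l := by gcongr
      have h4 : (2 : ℝ) ^ l ≤ 2 ^ (t + L) := pow_le_pow_right₀ one_le_two hlL.le
      calc L * β * N ^ l ≤ L * β * (2 * n : ℝ) ^ l := by gcongr
        _ = L * β * 2 ^ l * n ^ l := by rw [mul_pow]; ring
        _ ≤ L * β * 2 ^ (t + L) * n ^ l := by gcongr
        _ = (n : ℝ) ^ l / (2 * H) := by rw [hβdef]; field_simp
    have h5 : (n : ℝ) ^ l / H = 2 * (n ^ l / (2 * H)) := by field_simp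
    linarith
  set S' : Finset X := {y ∈ S | vec y ∈ W₀} with hS'
  refine ⟨S', filter_subset _ _, fun y hy => (mem_filter.1 hy).2, ?_⟩
  have hcount : (#A' : ℝ) * (a / 2) ≤ m₀ ^ l * #S' := by
    have h1 : (#A' : ℝ) * (a / 2) ≤ ∑ I ∈ A', (#((C I).erase x) : ℝ) := by
      rw [← nsmul_eq_mul, ← sum_const]
      refine sum_le_sum fun I hI => ?_
      have h2 : a ≤ #(C I) := (mem_filter.1 hI).2
      have h3 : (#(C I) : ℝ) ≤ #((C I).erase x) + 1 := by
        exact_mod_cast (Nat.sub_le_iff_le_add.1 pred_card_le_card_erase)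
      linarith
    refine h1.trans ?_
    have h2 : ∑ I ∈ A', #((C I).erase x) ≤ ∑ y ∈ S', m₀ ^ l := by
      have h3 : ∀ I ∈ A', #((C I).erase x) = ∑ y ∈ S', if y ∈ (C I).erase x then 1 else 0 := by
        intro I hI
        rw [← card_filter]
        congr 1
        ext y
        simp only [mem_filter, hS']
        refine ⟨fun hy => ⟨⟨(mem_filter.1 (mem_erase.1 hy).2).1, ?_⟩, hy⟩, fun hy => hy.2⟩
        have hy2 := mem_filter.1 (mem_erase.1 hy).2
        rw [← hAW I (mem_filter.1 hI).1]
        refine Submodule.subset_span ⟨y, ⟨hy2.1, fun p hp => ?_⟩, rfl⟩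
        obtain ⟨i, _, rfl⟩ := mem_image.1 hp
        exact hy2.2 i
      rw [sum_congr rfl h3, sum_comm]
      refine sum_le_sum fun y hy => ?_
      rw [← card_filter]
      have hyS : y ∈ S := (mem_filter.1 hy).1
      by_cases hyx : y = x
      · simp [hyx]
      have h4 : #{I ∈ A' | y ∈ (C I).erase x} ≤
          #(Fintype.piFinset fun _ : Fin l => {p ∈ pool | cls p y = cls p x}) := by
        refine card_le_card_of_injOn (fun I i => (I i).1) ?_ ?_
        · intro I hI
          rw [mem_coe, mem_filter] at hI
          rw [mem_coe, Fintype.mem_piFinset]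
          intro i
          exact mem_filter.2 ⟨hgood x hxS (I i).2, (mem_filter.1 (mem_erase.1 hI.2).2).2 i⟩
        · intro I _ J _ hIJ
          funext i
          exact Subtype.ext (congrFun hIJ i)
      refine h4.trans ?_
      rw [Fintype.card_piFinset, prod_const, card_univ, Fintype.card_fin]
      exact Nat.pow_le_pow_left (hm x hxS y hyS hyx) l
    rw [sum_const, smul_eq_mul, mul_comm] at h2
    exact_mod_cast h2
  have hm₀' : (1 : ℝ) ≤ m₀ := by exact_mod_cast hm₀
  have h1 : (n : ℝ) ^ l / (2 * H) * (a / 2) ≤ m₀ ^ l * #S' := by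
    refine le_trans ?_ hcount
    gcongr
  have h2 : R ^ l / (2 * H) * (a / 2) ≤ m₀ ^ l * #S' := by
    refine le_trans ?_ h1
    have := hR x hxS
    gcongr
  have h3 : (#S : ℝ) ≤ 8 * L * 2 ^ (t + L) * H ^ 2 * (K * m₀ / R) ^ l * #S' := by
    have h4 : R ^ l / (2 * H) * (a / 2) = #S * (R ^ l / (8 * L * 2 ^ (t + L) * H ^ 2 * K ^ l)) := by
      rw [ha, hβdef]; field_simp; ring
    rw [h4, mul_div_assoc', div_le_iff₀ (by positivity)] at h2
    rw [div_pow, mul_pow]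
    have h5 : 8 * L * 2 ^ (t + L) * H ^ 2 * (K ^ l * m₀ ^ l / R ^ l) * #S' =
      m₀ ^ l * #S' * (8 * L * 2 ^ (t + L) * H ^ 2 * K ^ l) / R ^ l := by ring
    rw [h5, le_div_iff₀ (by positivity)]
    exact h2
  refine h3.trans ?_
  have h6 : 1 ≤ K * m₀ / R := by
    rw [le_div_iff₀ (by positivity)]
    nlinarith
  have h7 := pow_le_pow_right₀ h6 hlL.le
  gcongr

open Finset Filter in
theorem eventually_two_mul_rpow_le_card_primes {κ : ℝ} (hκ : 0 < κ) (hκ1 : κ < 1) :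
    ∀ᶠ Y : ℝ in atTop, 
    2 * Y ^ (1 - κ) ≤ (#{p ∈ Icc 1 ⌊Y⌋₊ | Nat.Prime p ∧ Y ^ (1 - κ) < (p : ℝ)} : ℕ) := by
  have h1 : ∀ᶠ Y : ℝ in atTop, ‖Real.log Y‖ ≤ (Real.log 2 / 12) * ‖Y ^ κ‖ :=
    (isLittleO_log_rpow_atTop hκ).def (by positivity)
  have h2 : ∀ᶠ Y : ℝ in atTop, ‖Real.log Y‖ ≤ (Real.log 2 / 8) * ‖Y ^ (1 : ℝ)‖ :=
    (isLittleO_log_rpow_atTop one_pos).def (by positivity)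
  filter_upwards [h1, h2, eventually_ge_atTop 8] with Y hY1 hY2 hY8
  have hY0 : (0 : ℝ) < Y := by linarith
  have hlog : 0 < Real.log Y := Real.log_pos (by linarith)
  have hl2 : 0 < Real.log 2 := Real.log_pos one_lt_two
  rw [Real.norm_of_nonneg hlog.le, Real.norm_of_nonneg (by positivity)] at hY1 hY2
  rw [Real.rpow_one] at hY2
  have hpi := Chebyshev.pi_ge' (x := Y) (by linarith)
  have h3 : Real.log (Y + 2) ≤ 2 * Real.log Y := by
    rw [show 2 * Real.log Y = Real.log (Y ^ 2) by rw [Real.log_pow]; norm_cast]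
    exact Real.log_le_log (by linarith) (by nlinarith)
  have h4 : 3 * Y ^ (1 - κ) ≤ Nat.primeCounting ⌊Y⌋₊ := by
    refine le_trans ?_ hpi
    rw [le_div_iff₀ hlog]
    have h5 : Y ^ (1 - κ) * Y ^ κ = Y := by rw [← Real.rpow_add hY0]; simp
    have h6 : Y ^ (1 - κ) * Real.log Y ≤ Y ^ (1 - κ) * (Real.log 2 / 12 * Y ^ κ) := by gcongr
    nlinarith
  have h7 : Nat.primeCounting ⌊Y⌋₊ ≤ ⌊Y ^ (1 - κ)⌋₊ +
      #{p ∈ Icc 1 ⌊Y⌋₊ | Nat.Prime p ∧ Y ^ (1 - κ) < (p : ℝ)} := by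
    rw [Nat.primeCounting, Nat.primeCounting', Nat.count_eq_card_filter_range]
    calc #{p ∈ range (⌊Y⌋₊ + 1) | p.Prime} ≤ #(Icc 1 ⌊Y ^ (1 - κ)⌋₊ ∪
          {p ∈ Icc 1 ⌊Y⌋₊ | p.Prime ∧ Y ^ (1 - κ) < p}) := by
          refine card_le_card fun p hp => ?_
          simp only [mem_filter, mem_range, mem_union, mem_Icc] at hp ⊢
          by_cases h : Y ^ (1 - κ) < p
          · exact Or.inr ⟨⟨hp.2.one_le, by omega⟩, hp.2, h⟩
          · exact Or.inl ⟨hp.2.one_le, Nat.le_floor (not_lt.1 h)⟩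
      _ ≤ _ := (card_union_le _ _).trans (by simp)
  have h8 : (⌊Y ^ (1 - κ)⌋₊ : ℝ) ≤ Y ^ (1 - κ) := Nat.floor_le (by positivity)
  have h9 : (Nat.primeCounting ⌊Y⌋₊ : ℝ) ≤ ⌊Y ^ (1 - κ)⌋₊ +
      (#{p ∈ Icc 1 ⌊Y⌋₊ | Nat.Prime p ∧ Y ^ (1 - κ) < (p : ℝ)} : ℕ) := by exact_mod_cast h7
  linarith

open Finset in
theorem card_mul_log_le_of_primes_dvd {n : ℤ} (hn : n ≠ 0) {I : Finset ℕ} {y : ℝ} (hy : 0 < y)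
    (hI : ∀ p ∈ I, p.Prime ∧ y < p ∧ (p : ℤ) ∣ n) : #I * Real.log y ≤ Real.log |(n : ℝ)| := by
  have h1 : ∏ p ∈ I, p ∣ n.natAbs :=
    prod_primes_dvd _ (fun p hp => (hI p hp).1.prime) fun p hp =>
      Int.natCast_dvd.1 (hI p hp).2.2
  have h2 : ∏ p ∈ I, p ≤ n.natAbs := Nat.le_of_dvd (Int.natAbs_pos.2 hn) h1
  have h3 : y ^ #I ≤ |(n : ℝ)| := by
    calc y ^ #I = ∏ _p ∈ I, y := by simp
      _ ≤ ∏ p ∈ I, (p : ℝ) := prod_le_prod (fun _ _ => hy.le) fun p hp => (hI p hp).2.1.le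
      _ ≤ n.natAbs := by rw [← Nat.cast_prod]; exact Nat.cast_le.2 h2
      _ = |(n : ℝ)| := by simp
  rw [← Real.log_pow]
  exact Real.log_le_log (by positivity) h3

open Finset in
theorem card_zeros_zmod_le {p : ℕ} [Fact p.Prime] {F : MvPolynomial (Fin 3) (ZMod p)} (hF : F ≠ 0) :
    #{x : Fin 3 → ZMod p | MvPolynomial.eval x F = 0} ≤ F.totalDegree * p ^ 2 := by
  have h1 := MvPolynomial.schwartz_zippel_totalDegree hF (univ : Finset (ZMod p))
  have hp : 0 < p := (Fact.out : p.Prime).pos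
  rw [Fintype.piFinset_univ, card_univ, ZMod.card, div_le_div_iff₀ (by positivity) (by positivity)]
    at h1
  have h2 : #{x : Fin 3 → ZMod p | MvPolynomial.eval x F = 0} * p ≤ F.totalDegree * p ^ 3 := by
    exact_mod_cast h1
  refine Nat.le_of_mul_le_mul_right ?_ hp
  linarith

open Finset in
theorem card_image_mod_le {F : MvPolynomial (Fin 3) ℤ} {p : ℕ} (hp : p.Prime)
    (hF : ¬ MvPolynomial.C (p : ℤ) ∣ F) {S : Finset (Fin 3 → ℤ)}
    (hS : ∀ x ∈ S, MvPolynomial.eval x F = 0) :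
    #(S.image fun x i => x i % (p : ℤ)) ≤ F.totalDegree * p ^ 2 := by
  have : Fact p.Prime := ⟨hp⟩
  have h0 : MvPolynomial.map (Int.castRingHom (ZMod p)) F ≠ 0 := by
    contrapose! hF
    rw [MvPolynomial.C_dvd_iff_dvd_coeff]
    intro e
    have := congrArg (MvPolynomial.coeff e) hF
    rw [MvPolynomial.coeff_map] at this
    simpa [ZMod.intCast_zmod_eq_zero_iff_dvd] using this
  have h1 := card_zeros_zmod_le h0
  refine le_trans ?_ (h1.trans (Nat.mul_le_mul_right _ (sup_mono
    (MvPolynomial.support_map_subset _ _))))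
  refine card_le_card_of_injOn (fun y i => (y i : ZMod p)) ?_ ?_
  · intro y hy
    obtain ⟨x, hx, rfl⟩ := mem_image.1 hy
    simp only [coe_filter, mem_univ, true_and, Set.mem_ofPred_eq, ZMod.intCast_mod]
    have h2 := congrArg (Int.castRingHom (ZMod p)) (hS x hx)
    rw [map_zero, MvPolynomial.eval₂_comp] at h2
    rw [MvPolynomial.eval_map]
    exact h2
  · intro y hy z hz hyz
    obtain ⟨x, hx, rfl⟩ := mem_image.1 hy
    obtain ⟨x', hx', rfl⟩ := mem_image.1 hz
    funext i
    have := congrFun hyz i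
    simp only [ZMod.intCast_mod, ZMod.intCast_eq_intCast_iff] at this
    exact this

open MvPolynomial in
theorem dvd_of_C_dvd_C_mul_of_primitive {σ : Type*} {F : MvPolynomial σ ℤ}
    (hF : ∀ k : ℤ, C k ∣ F → IsUnit k) {a b : ℤ} (ha : a ≠ 0) (h : ∀ e, a ∣ b * coeff e F) :
    a ∣ b := by
  have hg : 0 < Int.gcd a b := Int.gcd_pos_of_ne_zero_left _ ha
  obtain ⟨a', b', hcop, ha', hb'⟩ := Int.exists_gcd_one hg
  set h₀ : ℤ := ((Int.gcd a b : ℕ) : ℤ) with hh₀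
  have hh : h₀ ∣ b := Int.gcd_dvd_right _ _
  have hg' : h₀ ≠ 0 := by positivity
  clear_value h₀
  have h1 : IsUnit a' := by
    refine hF a' ((C_dvd_iff_dvd_coeff _ _).2 fun e => ?_)
    have h2 := h e
    rw [ha', hb', mul_comm a', mul_comm b', mul_assoc] at h2
    exact (Int.isCoprime_iff_gcd_eq_one.2 hcop).dvd_of_dvd_mul_left (Int.dvd_of_mul_dvd_mul_left hg' h2)
  rw [ha']
  exact (h1.mul_left_dvd).2 hh

open MvPolynomial Finset in
theorem abs_coeff_le_or_exists_vanishing {σ : Type*} [Fintype σ] {F : MvPolynomial σ ℤ}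
    (hF : ∀ k : ℤ, C k ∣ F → IsUnit k) {m : σ →₀ ℕ} (hm : m ∈ F.support) {B : σ → ℝ} {T : ℝ}
    (hT1 : 1 ≤ T) (hT : ∀ e ∈ F.support, ∏ i, B i ^ e i ≤ T) :
    (∃ g : MvPolynomial σ ℤ, g ≠ 0 ∧ (∀ e ∈ g.support, e ∈ F.support ∧ e ≠ m) ∧
      ∀ x : σ → ℤ, (∀ i, |(x i : ℝ)| ≤ B i) → eval x F = 0 → eval x g = 0) ∨
    ∀ e, |((coeff e F : ℤ) : ℝ)| ≤ ((#F.support).factorial * T ^ #F.support) ^ 2 := by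
  classical
  set E := F.support.erase m with hE
  rcases exists_poly_or_exists_det_ne_zero E
    {x : σ → ℤ | (∀ i, |(x i : ℝ)| ≤ B i) ∧ eval x F = 0} with ⟨g, hg0, hgE, hg⟩ | ⟨y, hy, hdet⟩
  · exact Or.inl ⟨g, hg0, fun e he => (mem_erase.1 (hgE he)).symm, fun x hx hx' => hg x ⟨hx, hx'⟩⟩
  right
  set M : Matrix E E ℤ := Matrix.of fun k e => ∏ i, y k i ^ e.1 i with hM
  set v : E → ℤ := fun k => ∏ i, y k i ^ m i with hv
  set c : E → ℤ := fun e => coeff e.1 F with hc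
  have hEs : ∀ e ∈ E, e ∈ F.support := fun e he => mem_of_mem_erase he
  have hmon : ∀ k : E, ∀ e ∈ F.support, |((∏ i, y k i ^ e i : ℤ) : ℝ)| ≤ T := fun k e he =>
    (abs_monomial_le (hy k).1 e).trans (hT e he)
  have hMc : M.mulVec c = (-coeff m F) • v := by
    ext k
    have h1 := (hy k).2
    rw [eval_eq' , ← add_sum_erase _ _ hm, ← sum_coe_sort] at h1
    simp only [Matrix.mulVec, dotProduct, hM, hc, hv, Matrix.of_apply, Pi.smul_apply, smul_eq_mul]
    rw [sum_congr rfl fun e _ => mul_comm _ _]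
    linarith
  have hcr : M.det • c = (-coeff m F) • Matrix.cramer M v := by
    rw [← map_smul, ← hMc, Matrix.cramer_eq_adjugate_mulVec, Matrix.mulVec_mulVec,
      Matrix.adjugate_mul, Matrix.smul_mulVec, Matrix.one_mulVec]
  have hcr' : ∀ e : E, M.det * coeff e.1 F = -coeff m F * (M.updateCol e v).det := by
    intro e
    have := congrFun hcr e
    simpa [hc, Matrix.cramer_apply] using this
  set A : ℝ := (#F.support).factorial * T ^ #F.support with hA
  have hcardE : #E ≤ #F.support := card_le_card (erase_subset _ _)
  have hdetle : ∀ N : Matrix E E ℤ, (∀ k e, |(N k e : ℝ)| ≤ T) → |(N.det : ℝ)| ≤ A := by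
    intro N hN
    refine (abs_det_le_of_abs_le (c := fun _ => T) hN).trans ?_
    rw [prod_const, card_univ, Fintype.card_coe]
    have h1 : (#E).factorial ≤ (#F.support).factorial := Nat.factorial_le hcardE
    exact mul_le_mul (by exact_mod_cast h1) (pow_le_pow_right₀ hT1 hcardE) (by positivity)
      (by positivity)
  have hA1 : 1 ≤ A := by
    have : (1 : ℝ) ≤ (#F.support).factorial := by exact_mod_cast Nat.one_le_iff_ne_zero.2 (Nat.factorial_ne_zero _)
    exact one_le_mul_of_one_le_of_one_le this (one_le_pow₀ hT1)
  have hMdet : |(M.det : ℝ)| ≤ A := hdetle M fun k e => hmon k e.1 (hEs _ e.2)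
  have hm0 : coeff m F ≠ 0 := mem_support_iff.1 hm
  have hdvd : coeff m F ∣ M.det := by
    refine dvd_of_C_dvd_C_mul_of_primitive hF hm0 fun e => ?_
    by_cases he : e ∈ E
    · rw [hcr' ⟨e, he⟩]
      exact Dvd.intro _ (by ring : coeff m F * -(M.updateCol ⟨e, he⟩ v).det = _)
    · by_cases hem : e = m
      · rw [hem]; exact dvd_mul_left _ _
      · have : coeff e F = 0 := by
          by_contra h
          exact he (mem_erase.2 ⟨hem, mem_support_iff.2 h⟩)
        rw [this, mul_zero]; exact dvd_zero _
  have hmA : |((coeff m F : ℤ) : ℝ)| ≤ A := by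
    refine le_trans ?_ hMdet
    rw [← Int.cast_abs, ← Int.cast_abs]
    exact_mod_cast Int.le_of_dvd (abs_pos.2 hdet) (abs_dvd_abs _ _ |>.2 hdvd)
  intro e
  by_cases he : e ∈ E
  · have h1 : |((coeff e F : ℤ) : ℝ)| ≤ |(M.det : ℝ)| * |((coeff e F : ℤ) : ℝ)| := by
      refine le_mul_of_one_le_left (abs_nonneg _) ?_
      rw [← Int.cast_abs]
      exact_mod_cast Int.one_le_abs hdet
    have h2 : |(M.det : ℝ)| * |((coeff e F : ℤ) : ℝ)| = |((coeff m F : ℤ) : ℝ)| * |((M.updateCol ⟨e, he⟩ v).det : ℝ)| := by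
      rw [← abs_mul, ← abs_mul, ← abs_neg (((coeff m F : ℤ) : ℝ) * _), ← neg_mul]
      have := hcr' ⟨e, he⟩
      rw [← Int.cast_neg]
      exact_mod_cast congrArg abs this
    rw [h2] at h1
    refine h1.trans ?_
    rw [sq]
    refine mul_le_mul hmA (hdetle _ fun k e' => ?_) (abs_nonneg _) (by linarith)
    rw [Matrix.updateCol_apply]
    split_ifs
    · exact hmon k m hm
    · exact hmon k e'.1 (hEs _ e'.2)
  · by_cases hem : e = m
    · rw [hem]; nlinarith
    · have : coeff e F = 0 := by
        by_contra h
        exact he (mem_erase.2 ⟨hem, mem_support_iff.2 h⟩)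
      rw [this]; simp; positivity

open MvPolynomial Finset in
theorem abs_eval_pderiv_le {σ : Type*} [Fintype σ] {F : MvPolynomial σ ℤ} {B : σ → ℝ}
    (hB : ∀ i, 1 ≤ B i) {T A : ℝ} (hA0 : 0 ≤ A) (hT : ∀ e ∈ F.support, ∏ i, B i ^ e i ≤ T)
    (hA : ∀ e, |((coeff e F : ℤ) : ℝ)| ≤ A) (j : σ) {x : σ → ℤ} (hx : ∀ i, |(x i : ℝ)| ≤ B i) :
    |((eval x (pderiv j F) : ℤ) : ℝ)| ≤ #F.support * (A * F.totalDegree * T) := by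
  classical
  conv_lhs => rw [F.as_sum]
  rw [map_sum, map_sum, Int.cast_sum]
  refine (abs_sum_le_sum_abs _ _).trans ?_
  rw [← nsmul_eq_mul]
  refine sum_le_card_nsmul _ _ _ fun e he => ?_
  rw [pderiv_monomial, eval_monomial, Finsupp.prod_fintype _ _ (by simp), Int.cast_mul, abs_mul, Int.cast_mul,
    abs_mul]
  have h1 : |((∏ i, x i ^ (e - Finsupp.single j 1 : σ →₀ ℕ) i : ℤ) : ℝ)| ≤ T := by
    refine ((abs_monomial_le hx (e - Finsupp.single j 1 : σ →₀ ℕ)).trans ?_).trans (hT e he)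
    refine prod_le_prod (fun i _ => by have := hB i; positivity) fun i _ => ?_
    exact pow_le_pow_right₀ (hB i) (by simp)
  have h2 : |(((e j : ℕ) : ℤ) : ℝ)| ≤ F.totalDegree := by
    rw [abs_of_nonneg (by positivity)]
    have h3 : e j ≤ F.totalDegree := by
      refine le_trans ?_ (le_totalDegree he)
      by_cases h : e j = 0
      · simp [h]
      · exact single_le_sum (f := fun i => e i) (by simp) (Finsupp.mem_support_iff.2 h)
    exact_mod_cast h3
  have h4 := hA e
  exact mul_le_mul (mul_le_mul h4 h2 (abs_nonneg _) hA0) h1 (abs_nonneg _) (by positivity)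

open Finset in
theorem sqrt_prod_div_le {b w : Fin 3 → ℝ} {τ η M : ℝ} (hb : ∀ i, 0 ≤ b i) (hbτ : ∀ i, b i ≤ τ)
    (hτ : 0 < τ) (hη : 0 < η) (hητ : η ≤ τ) (hw : ∀ i, 0 ≤ w i) (hwb : ∀ i, w i * η ≤ b i + η)
    (hM : τ ≤ η * M) :
    η * Real.sqrt ((∏ i, w i) / M) ≤ Real.sqrt ((∏ i, b i) / τ) + Real.sqrt (7 * τ * η) := by
  have hM0 : 0 < M := by
    by_contra h
    nlinarith
  have h1 : η * Real.sqrt ((∏ i, w i) / M) = Real.sqrt (η ^ 2 * ((∏ i, w i) / M)) := by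
    rw [Real.sqrt_mul (by positivity), Real.sqrt_sq hη.le]
  rw [h1]
  have hb0 : 0 ≤ ∏ i, b i := prod_nonneg fun i _ => hb i
  have hadd : Real.sqrt ((∏ i, b i) / τ + 7 * τ * η) ≤
      Real.sqrt ((∏ i, b i) / τ) + Real.sqrt (7 * τ * η) := by
    refine Real.sqrt_le_iff.2 ⟨by positivity, ?_⟩
    have e1 := Real.sq_sqrt (show 0 ≤ (∏ i, b i) / τ by positivity)
    have e2 := Real.sq_sqrt (show 0 ≤ 7 * τ * η by positivity)
    have e3 : 0 ≤ Real.sqrt ((∏ i, b i) / τ) * Real.sqrt (7 * τ * η) := by positivity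
    nlinarith
  refine le_trans ?_ hadd
  refine Real.sqrt_le_sqrt ?_
  have h2 : ∏ i, (w i * η) ≤ ∏ i, (b i + η) :=
    prod_le_prod (fun i _ => mul_nonneg (hw i) hη.le) fun i _ => hwb i
  rw [prod_mul_distrib, prod_const, card_univ, Fintype.card_fin] at h2
  have h3 : ∏ i, (b i + η) ≤ ∏ i, b i + 7 * τ ^ 2 * η := by
    rw [Fin.prod_univ_three, Fin.prod_univ_three]
    have h0 := hb 0
    have h1 := hb 1
    have h2 := hb 2
    have e1 : b 0 * b 1 ≤ τ * τ := mul_le_mul (hbτ 0) (hbτ 1) h1 hτ.le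
    have e2 : b 0 * b 2 ≤ τ * τ := mul_le_mul (hbτ 0) (hbτ 2) h2 hτ.le
    have e3 : b 1 * b 2 ≤ τ * τ := mul_le_mul (hbτ 1) (hbτ 2) h2 hτ.le
    have f0 : b 0 * η ≤ τ * τ := mul_le_mul (hbτ 0) hητ hη.le hτ.le
    have f1 : b 1 * η ≤ τ * τ := mul_le_mul (hbτ 1) hητ hη.le hτ.le
    have f2 : b 2 * η ≤ τ * τ := mul_le_mul (hbτ 2) hητ hη.le hτ.le
    have f3 : η * η ≤ τ * τ := mul_le_mul hητ hητ hη.le hτ.le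
    nlinarith
  have hP : 0 ≤ ∏ i, w i := prod_nonneg fun i _ => hw i
  calc η ^ 2 * ((∏ i, w i) / M) = (∏ i, w i) * η ^ 3 / (η * M) := by field_simp
    _ ≤ (∏ i, w i) * η ^ 3 / τ := by gcongr
    _ ≤ (∏ i, b i + 7 * τ ^ 2 * η) / τ := by gcongr; linarith
    _ = (∏ i, b i) / τ + 7 * τ * η := by field_simp

open Finset Filter in
theorem exists_uniform_weighted_exponent_set (d n : ℕ) :
    ∃ C : ℕ, ∀ w : Fin 3 → ℕ, (∀ i, 0 < w i) → (∀ i, w i ≤ n) → ∀ m : Fin 3 →₀ ℕ, (∀ i, m i ≤ d) →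
      0 < ∑ i, w i * m i → ∃ E : Finset (Fin 3 →₀ ℕ), #E ≤ C ∧ (∀ e ∈ E, ∑ i, e i ≤ C) ∧
        (∀ e ∈ E, ¬ m ≤ e) ∧ ∃ A D : ℕ, 1 ≤ A ∧
      6 * A + D * (D + 1) * (D + 2) ≤ 6 * D * #E ∧
      ∑ e ∈ E, ∑ i, (w i : ℝ) * e i ≤
        (Real.sqrt ((∏ i, (w i : ℝ)) / ∑ i, (w i : ℝ) * m i) + 1) * A := by
  have h : ∀ᶠ C : ℕ in atTop, ∀ wm ∈ (Fintype.piFinset fun _ : Fin 3 => Icc 1 n) ×ˢ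
      (Iic (Finsupp.equivFunOnFinite.symm fun _ : Fin 3 => d)), 0 < ∑ i, wm.1 i * wm.2 i →
      ∃ E : Finset (Fin 3 →₀ ℕ), #E ≤ C ∧ (∀ e ∈ E, ∑ i, e i ≤ C) ∧
        (∀ e ∈ E, ¬ wm.2 ≤ e) ∧ ∃ A D : ℕ, 1 ≤ A ∧
      6 * A + D * (D + 1) * (D + 2) ≤ 6 * D * #E ∧
      ∑ e ∈ E, ∑ i, (wm.1 i : ℝ) * e i ≤
        (Real.sqrt ((∏ i, (wm.1 i : ℝ)) / ∑ i, (wm.1 i : ℝ) * wm.2 i) + 1) * A := by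
    refine (eventually_all_finset _).2 fun wm hwm => ?_
    by_cases h0 : 0 < ∑ i, wm.1 i * wm.2 i
    swap
    · exact Eventually.of_forall fun _ h => absurd h h0
    rw [mem_product, Fintype.mem_piFinset] at hwm
    obtain ⟨E, hE, hA⟩ := exists_weighted_exponent_set
      (fun i => (mem_Icc.1 (hwm.1 i)).1) h0 one_pos
    filter_upwards [eventually_ge_atTop #E, eventually_ge_atTop (E.sup fun e => ∑ i, e i)] with C h1 h2 _
    exact ⟨E, h1, fun e he => (le_sup (f := fun e : Fin 3 →₀ ℕ => ∑ i, e i) he).trans h2, hE, hA⟩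
  obtain ⟨C, hC⟩ := h.exists
  refine ⟨C, fun w hw hwn m hm h0 => hC (w, m) ?_ h0⟩
  rw [mem_product, Fintype.mem_piFinset, mem_Iic]
  exact ⟨fun i => mem_Icc.2 ⟨hw i, hwn i⟩, fun i => hm i⟩

open Finset in
theorem exists_exponent_data (d : ℕ) {ε : ℝ} (hε : 0 < ε) :
    ∃ C : ℕ, ∀ (b : Fin 3 → ℝ) (τ : ℝ), 0 < τ → (∀ i, 0 ≤ b i) → (∀ i, b i < τ) →
      ∀ s : Finset (Fin 3 →₀ ℕ), (∀ e ∈ s, ∀ i, e i ≤ d) → (∃ e ∈ s, τ ≤ ∑ i, b i * e i) →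
      ∃ m ∈ s, (∃ ω : Fin 3 → ℕ, ∀ e ∈ s, e ≠ m → ∑ i, ω i * e i < ∑ i, ω i * m i) ∧
      ∃ E : Finset (Fin 3 →₀ ℕ), #E ≤ C ∧ (∀ e ∈ E, ∑ i, e i ≤ C) ∧ (∀ e ∈ E, ¬ m ≤ e) ∧
      ∃ A D : ℕ, 1 ≤ A ∧ 6 * A + D * (D + 1) * (D + 2) ≤ 6 * D * #E ∧
      ∑ e ∈ E, ∑ i, b i * e i ≤ (Real.sqrt ((∏ i, b i) / τ) + ε * τ) * A := by
  obtain ⟨n, hn⟩ := exists_nat_gt (max (max 1 (2 / ε)) (28 / ε ^ 2))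
  simp only [max_lt_iff] at hn
  obtain ⟨⟨hn1, hn2⟩, hn3⟩ := hn
  obtain ⟨C, hC⟩ := exists_uniform_weighted_exponent_set d n
  refine ⟨C, fun b τ hτ hb hbτ s hs ⟨e₀, he₀, hτe⟩ => ?_⟩
  have hn0 : (0 : ℝ) < n := by linarith
  set η : ℝ := τ / n with hη
  have hη0 : 0 < η := by positivity
  have hητ : η ≤ τ := div_le_self hτ.le hn1.le
  set w : Fin 3 → ℕ := fun i => ⌊b i / η⌋₊ + 1 with hw
  have hbw : ∀ i, b i ≤ w i * η := fun i => by
    have := (Nat.lt_floor_add_one (b i / η)).le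
    rw [div_le_iff₀ hη0] at this
    simpa [hw] using this
  have hwb : ∀ i, w i * η ≤ b i + η := fun i => by
    have := Nat.floor_le (div_nonneg (hb i) hη0.le)
    rw [le_div_iff₀ hη0] at this
    simp only [hw]
    push_cast
    linarith
  have hwn : ∀ i, w i ≤ n := fun i => by
    have h1 : b i / η < n := by
      rw [div_lt_iff₀ hη0, hη]
      have := hbτ i
      field_simp
      exact this
    have h2 : ⌊b i / η⌋₊ < n := (Nat.floor_lt (div_nonneg (hb i) hη0.le)).2 h1
    simp only [hw]
    omega
  obtain ⟨m, hm, hmax, hω⟩ := exists_maximal_exponent w d s ⟨e₀, he₀⟩ hs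
  have hM : τ ≤ η * ∑ i, (w i : ℝ) * m i := by
    calc τ ≤ ∑ i, b i * e₀ i := hτe
      _ ≤ ∑ i, w i * η * e₀ i := by
        gcongr with i
        exact hbw i
      _ = η * ∑ i, (w i : ℝ) * e₀ i := by rw [mul_sum]; exact sum_congr rfl fun _ _ => by ring
      _ ≤ η * ∑ i, (w i : ℝ) * m i := by
        have : (∑ i, (w i : ℝ) * e₀ i) ≤ ∑ i, (w i : ℝ) * m i := by exact_mod_cast hmax e₀ he₀
        gcongr
  have hM0 : 0 < ∑ i, w i * m i := by
    have : 0 < ∑ i, (w i : ℝ) * m i := by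
      by_contra h
      nlinarith
    exact_mod_cast this
  obtain ⟨E, hE1, hE2, hE3, A, D, hA, hAD, hsum⟩ := hC w (fun i => Nat.succ_pos _) hwn m (hs m hm) hM0
  refine ⟨m, hm, hω, E, hE1, hE2, hE3, A, D, hA, hAD, ?_⟩
  have h1 := sqrt_prod_div_le (w := fun i => (w i : ℝ)) hb (fun i => (hbτ i).le) hτ hη0 hητ
    (fun i => by positivity) hwb hM
  have h2 : Real.sqrt (7 * τ * η) ≤ ε / 2 * τ := by
    rw [Real.sqrt_le_left (by positivity), hη]
    rw [div_lt_iff₀ (by positivity)] at hn3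
    rw [show 7 * τ * (τ / n) = 7 * τ ^ 2 / n by ring, div_le_iff₀ hn0]
    nlinarith [sq_nonneg τ]
  have h3 : η ≤ ε / 2 * τ := by
    rw [div_lt_iff₀ hε] at hn2
    rw [hη, div_le_iff₀ hn0]
    nlinarith
  calc ∑ e ∈ E, ∑ i, b i * e i ≤ ∑ e ∈ E, ∑ i, w i * η * e i := by
        gcongr with e _ i
        exact hbw i
    _ = η * ∑ e ∈ E, ∑ i, (w i : ℝ) * e i := by
        rw [mul_sum]
        refine sum_congr rfl fun _ _ => ?_
        rw [mul_sum]
        exact sum_congr rfl fun _ _ => by ring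
    _ ≤ η * ((Real.sqrt ((∏ i, (w i : ℝ)) / ∑ i, (w i : ℝ) * m i) + 1) * A) := by gcongr
    _ = (η * Real.sqrt ((∏ i, (w i : ℝ)) / ∑ i, (w i : ℝ) * m i) + η) * A := by ring
    _ ≤ (Real.sqrt ((∏ i, b i) / τ) + ε * τ) * A := by
        refine mul_le_mul_of_nonneg_right ?_ (Nat.cast_nonneg _)
        linarith

open MvPolynomial in
theorem not_map_dvd_of_support {σ : Type*} [Fintype σ] {F g : MvPolynomial σ ℤ} {m : σ →₀ ℕ}
    {ω : σ → ℕ} (hm : m ∈ F.support)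
    (hω : ∀ e ∈ F.support, e ≠ m → ∑ i, ω i * e i < ∑ i, ω i * m i) (hg : g ≠ 0)
    (hgm : ∀ e ∈ g.support, ¬ m ≤ e) :
    ¬ map (Int.castRingHom ℂ) F ∣ map (Int.castRingHom ℂ) g := by
  intro h
  have hinj : Function.Injective (Int.castRingHom ℂ) := Int.cast_injective
  rw [← support_map_of_injective F hinj] at hm hω
  obtain ⟨e, he, hme⟩ := exists_le_mem_support_of_dvd ω hm hω
    ((map_injective _ hinj).ne_iff' (map_zero _) |>.2 hg) h
  rw [support_map_of_injective g hinj] at he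
  exact hgm e he hme

theorem sum_mul_le_sum_mul_of_le {σ : Type*} [Fintype σ] {m e : σ →₀ ℕ} (ω : σ → ℕ) (h : m ≤ e) :
    ∑ i, ω i * m i ≤ ∑ i, ω i * e i :=
  Finset.sum_le_sum fun i _ => Nat.mul_le_mul_left _ (h i)

open MvPolynomial in
theorem not_map_dvd_pderiv {σ : Type*} [Fintype σ] {F : MvPolynomial σ ℤ} {m : σ →₀ ℕ}
    {ω : σ → ℕ} (hm : m ∈ F.support)
    (hω : ∀ e ∈ F.support, e ≠ m → ∑ i, ω i * e i < ∑ i, ω i * m i) {j : σ} (hj : pderiv j F ≠ 0) :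
    ¬ map (Int.castRingHom ℂ) F ∣ map (Int.castRingHom ℂ) (pderiv j F) := by
  refine not_map_dvd_of_support hm hω hj fun e he hme => ?_
  rw [mem_support_iff, coeff_pderiv] at he
  have h1 : e + Finsupp.single j 1 ∈ F.support := mem_support_iff.2 (left_ne_zero_of_mul he)
  have h2 : m ≤ e + Finsupp.single j 1 := hme.trans le_self_add
  have h3 : e + Finsupp.single j 1 ≠ m := by
    rintro h
    have := hme j
    rw [← h] at this
    simp at this
  exact absurd (hω _ h1 h3) (not_lt.2 (sum_mul_le_sum_mul_of_le ω h2))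

open MvPolynomial in
theorem totalDegree_pderiv_le {σ R : Type*} [CommSemiring R] (F : MvPolynomial σ R) (j : σ) :
    (pderiv j F).totalDegree ≤ F.totalDegree := by
  refine Finset.sup_le fun e he => ?_
  rw [mem_support_iff, coeff_pderiv] at he
  have h1 : e + Finsupp.single j 1 ∈ F.support := mem_support_iff.2 (left_ne_zero_of_mul he)
  refine le_trans ?_ (le_totalDegree h1)
  change e.degree ≤ (e + Finsupp.single j 1).degree
  simp

open MvPolynomial in
theorem exists_pderiv_ne_zero {σ : Type*} {F : MvPolynomial σ ℤ} (hF : F.totalDegree ≠ 0) :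
    ∃ j, pderiv j F ≠ 0 := by
  obtain ⟨e, he, he0⟩ : ∃ e ∈ F.support, e ≠ 0 := by
    by_contra! h
    refine hF (Nat.le_zero.1 (Finset.sup_le fun e he => ?_))
    simp [h e he]
  obtain ⟨j, hj⟩ := Finsupp.ne_iff.1 he0
  refine ⟨j, fun h0 => ?_⟩
  have h1 := congrArg (coeff (e - Finsupp.single j 1)) h0
  rw [coeff_pderiv, tsub_add_cancel_of_le (by
    rw [Finsupp.single_le_iff]; exact Nat.one_le_iff_ne_zero.2 hj), coeff_zero] at h1
  rcases mul_eq_zero.1 h1 with h | h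
  · exact mem_support_iff.1 he h
  · have : (0 : ℤ) < ((e - Finsupp.single j 1 : σ →₀ ℕ) j : ℤ) + 1 := by positivity
    exact this.ne' h

open MvPolynomial in
theorem exponent_le_totalDegree {σ R : Type*} [CommSemiring R] {F : MvPolynomial σ R} {e : σ →₀ ℕ}
    (he : e ∈ F.support) (i : σ) : e i ≤ F.totalDegree := by
  refine le_trans ?_ (le_totalDegree he)
  change e i ≤ e.degree
  exact Finsupp.le_degree i e

open MvPolynomial Finset in
theorem card_support_le {R : Type*} [CommSemiring R] (F : MvPolynomial (Fin 3) R) :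
    #F.support ≤ (F.totalDegree + 1) ^ 3 := by
  have h : #F.support ≤ #(Fintype.piFinset fun _ : Fin 3 => range (F.totalDegree + 1)) := by
    refine card_le_card_of_injOn (fun e => ⇑e) (fun e he => ?_) DFunLike.coe_injective.injOn
    rw [mem_coe, Fintype.mem_piFinset]
    exact fun i => mem_range.2 (Nat.lt_succ_of_le (exponent_le_totalDegree he i))
  simpa using h

open MvPolynomial Finset in
theorem span_ne_top_of_forall_modEq {E : Finset (Fin 3 →₀ ℕ)} {F : MvPolynomial (Fin 3) ℤ}
    {j : Fin 3} {I : Finset ℕ} (hI : ∀ p ∈ I, p.Prime) {B : Fin 3 → ℝ} (P : Fin 3 → ℤ)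
    (hP : ∀ p ∈ I, ¬ (p : ℤ) ∣ eval P (pderiv j F)) {S : Set (Fin 3 → ℤ)}
    (hSF : ∀ x ∈ S, eval x F = 0) (hSP : ∀ x ∈ S, ∀ p ∈ I, ∀ i, x i ≡ P i [ZMOD p])
    (hSB : ∀ x ∈ S, ∀ i, |(x i : ℝ)| ≤ B i) {A D : ℕ}
    (hA : 6 * A + D * (D + 1) * (D + 2) ≤ 6 * D * #E)
    (hbig : (#E).factorial * ∏ e ∈ E, ∏ i, B i ^ e i < (∏ p ∈ I, (p : ℝ)) ^ A) :
    Submodule.span ℚ (monomialVec E '' S) ≠ ⊤ := by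
  classical
  intro h
  obtain ⟨y, hy, hdet⟩ := exists_det_ne_zero_of_span_eq_top h
  exact hdet (det_eq_zero_of_modEq hI y P hP (fun k => hSF _ (hy k))
    (fun p hp k i => hSP _ (hy k) p hp i) (fun k i => hSB _ (hy k) i) hA hbig)

open MvPolynomial Finset in
set_option maxHeartbeats 1000000 in
theorem exists_dense_polynomial {F : MvPolynomial (Fin 3) ℤ} (hprim : ∀ k : ℤ, C k ∣ F → IsUnit k)
    (hF : F.totalDegree ≠ 0) {j : Fin 3} {B : Fin 3 → ℝ}
    {E : Finset (Fin 3 →₀ ℕ)} {c A D : ℕ} (hE : #E ≤ c)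
    (hA : 6 * A + D * (D + 1) * (D + 2) ≤ 6 * D * #E) {S : Finset (Fin 3 → ℤ)} (hS : S.Nonempty)
    (hSF : ∀ x ∈ S, eval x F = 0) (hSB : ∀ x ∈ S, ∀ i, |(x i : ℝ)| ≤ B i)
    (hSj : ∀ x ∈ S, eval x (pderiv j F) ≠ 0) {Y y H : ℝ} (hy : 1 < y) {t L m₀ G : ℕ}
    (hL : 0 < L) (hm₀ : 1 ≤ m₀)
    (hpool : 2 * y ≤ (#{p ∈ Icc 1 ⌊Y⌋₊ | Nat.Prime p ∧ y < (p : ℝ)} : ℕ))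
    (hG : ∀ x ∈ S, Real.log |((eval x (pderiv j F) : ℤ) : ℝ)| ≤ G * Real.log y)
    (hm : ∀ i, Real.log (2 * B i) ≤ m₀ * Real.log y)
    (hGy : (G : ℝ) ≤ y) (hN : 2 * ((t : ℝ) + L) ^ 2 ≤ y)
    (hdet : (#E).factorial * ∏ e ∈ E, ∏ i, B i ^ e i < (y ^ t) ^ A)
    (hH1 : 1 ≤ H) (hH : Y ^ (8 * ((t + L : ℕ) : ℝ) * c / L) ≤ H)
    (hbig : 4 * L * 2 ^ (t + L) * H * (F.totalDegree * Y ^ 2) ^ (t + L) ≤ #S) :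
    ∃ g : MvPolynomial (Fin 3) ℤ, g ≠ 0 ∧ g.support ⊆ E ∧
      (#S : ℝ) ≤ 8 * L * 2 ^ (t + L) * H ^ 2 * (F.totalDegree * Y ^ 2 * m₀ / y) ^ (t + L) *
        #{x ∈ S | eval x g = 0} := by
  classical
  set pool : Finset ℕ := {p ∈ Icc 1 ⌊Y⌋₊ | Nat.Prime p ∧ y < (p : ℝ)} with hpooldef
  have hmem : ∀ p ∈ pool, p.Prime ∧ y < (p : ℝ) ∧ (p : ℝ) ≤ Y := by
    intro p hp
    rw [hpooldef, mem_filter, mem_Icc] at hp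
    exact ⟨hp.2.1, hp.2.2, (Nat.le_floor_iff' (by omega)).1 hp.1.2⟩
  have hYy : y ≤ Y := by
    have h1 : 0 < #pool := by
      have : (0 : ℝ) < #pool := by linarith
      exact_mod_cast this
    obtain ⟨p, hp⟩ := card_pos.1 h1
    linarith [hmem p hp]
  have hpoolY : (#pool : ℝ) ≤ Y := by
    have h1 : #pool ≤ ⌊Y⌋₊ := (card_filter_le _ _).trans (by simp)
    exact (Nat.le_floor_iff (by linarith)).1 h1
  have hlogy : 0 < Real.log y := Real.log_pos hy
  set good : (Fin 3 → ℤ) → Finset ℕ := fun x => {p ∈ pool | ¬ (p : ℤ) ∣ eval x (pderiv j F)}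
    with hgood
  have hcardgood : ∀ x ∈ S, (#pool : ℝ) ≤ #(good x) + G := by
    intro x hx
    have h1 := card_mul_log_le_of_primes_dvd (hSj x hx)
      (I := {p ∈ pool | (p : ℤ) ∣ eval x (pderiv j F)}) (y := y) (by linarith) fun p hp => by
        rw [mem_filter] at hp
        exact ⟨(hmem p hp.1).1, (hmem p hp.1).2.1, hp.2⟩
    have h2 : ((#(pool.filter fun p : ℕ => (p : ℤ) ∣ eval x (pderiv j F)) : ℕ) : ℝ) ≤ G :=
      le_of_mul_le_mul_right (h1.trans (hG x hx)) hlogy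
    have h3 : ((#(pool.filter fun p : ℕ => (p : ℤ) ∣ eval x (pderiv j F)) : ℕ) : ℝ) + #(good x) = #pool := by
      exact_mod_cast card_filter_add_card_filter_not (s := pool)
        (fun p : ℕ => (p : ℤ) ∣ eval x (pderiv j F))
    linarith
  have hd1 : (1 : ℝ) ≤ F.totalDegree := by exact_mod_cast Nat.one_le_iff_ne_zero.2 hF
  obtain ⟨W₀, hW₀, S', hS'S, hS'W, hS'⟩ := exists_dense_subspace hS (pool := pool)
    (fun p x i => x i % (p : ℤ)) good (monomialVec E) (t := t) (L := L) (m₀ := m₀)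
    (K := F.totalDegree * Y ^ 2) (R := y) (H := H) hL hm₀ hy.le
    (by nlinarith [mul_le_mul hd1 (show Y ≤ Y ^ 2 by nlinarith) (by linarith) (by linarith)]) hH1
    (fun x _ => filter_subset _ _)
    (fun x hx => by
      have := hcardgood x hx
      have h2 : (#pool : ℝ) ≤ 2 * #(good x) := by linarith
      exact_mod_cast h2)
    (fun x hx => by linarith [hcardgood x hx])
    (fun x hx => by
      have h2 : 2 * ((t : ℝ) + L) ^ 2 ≤ #(good x) := by linarith [hcardgood x hx]
      exact_mod_cast h2)
    (fun p hp => by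
      obtain ⟨h1, h2, h3⟩ := hmem p hp
      have h4 : #(S.image fun x i => x i % (p : ℤ)) ≤ F.totalDegree * p ^ 2 :=
        card_image_mod_le h1 (fun h => by
          have h5 := hprim p h
          exact (Nat.prime_iff_prime_int.1 h1).not_isUnit h5) hSF
      calc (#(S.image fun x i => x i % (p : ℤ)) : ℝ) ≤ F.totalDegree * (p : ℝ) ^ 2 := by
            exact_mod_cast h4
        _ ≤ F.totalDegree * Y ^ 2 := by gcongr)
    (fun x hx z hz hzx => by
      obtain ⟨i, hi⟩ := Function.ne_iff.1 hzx
      have h1 := card_mul_log_le_of_primes_dvd (sub_ne_zero.2 hi)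
        (I := {p ∈ pool | (fun i => z i % (p : ℤ)) = fun i => x i % (p : ℤ)}) (y := y)
        (by linarith) fun p hp => by
          rw [mem_filter] at hp
          exact ⟨(hmem p hp.1).1, (hmem p hp.1).2.1,
            Int.ModEq.dvd (congrFun hp.2 i).symm⟩
      have h2 : Real.log |((z i - x i : ℤ) : ℝ)| ≤ Real.log (2 * B i) := by
        refine Real.log_le_log (abs_pos.2 (by exact_mod_cast sub_ne_zero.2 hi)) ?_
        push_cast
        have := abs_sub (z i : ℝ) (x i)
        linarith [hSB x hx i, hSB z hz i]
      have h3 := le_of_mul_le_mul_right ((h1.trans h2).trans (hm i)) hlogy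
      exact_mod_cast h3)
    (by
      refine le_trans ?_ hH
      rw [Module.finrank_fintype_fun_eq_card, Fintype.card_coe]
      have h1 : (#E : ℝ) ≤ c := by exact_mod_cast hE
      calc (#pool : ℝ) ^ (8 * ((t + L : ℕ) : ℝ) * #E / L)
          ≤ Y ^ (8 * ((t + L : ℕ) : ℝ) * #E / L) := by gcongr
        _ ≤ Y ^ (8 * ((t + L : ℕ) : ℝ) * c / L) := by
          refine Real.rpow_le_rpow_of_exponent_le (by linarith) ?_
          gcongr)
    (fun x hx I hI htI => by
      have hIp : ∀ p ∈ I, p ∈ pool := fun p hp => (mem_filter.1 (hI hp)).1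
      refine span_ne_top_of_forall_modEq (j := j) (I := I) (B := B) (fun p hp => (hmem p (hIp p hp)).1) x
        (fun p hp => (mem_filter.1 (hI hp)).2) (fun z hz => hSF z hz.1)
        (fun z hz p hp i => congrFun (hz.2 p hp) i) (fun z hz => hSB z hz.1) hA
        (hdet.trans_le ?_)
      refine pow_le_pow_left₀ (by positivity) ?_ _
      calc y ^ t ≤ y ^ #I := pow_le_pow_right₀ hy.le htI
        _ = ∏ _p ∈ I, y := by simp
        _ ≤ ∏ p ∈ I, (p : ℝ) := prod_le_prod (fun _ _ => by linarith)
            fun p hp => (hmem p (hIp p hp)).2.1.le)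
    hbig
  obtain ⟨g, hg0, hgE, hg⟩ := exists_poly_vanishing_of_ne_top hW₀
  refine ⟨g, hg0, hgE, hS'.trans ?_⟩
  have h1 : #S' ≤ #{x ∈ S | eval x g = 0} :=
    card_le_card fun x hx => mem_filter.2 ⟨hS'S hx, hg x (hS'W x hx)⟩
  have : (0 : ℝ) ≤ 8 * L * 2 ^ (t + L) * H ^ 2 * (F.totalDegree * Y ^ 2 * m₀ / y) ^ (t + L) := by
    positivity
  gcongr

open Filter in
theorem eventually_le_exp_mul {a : ℝ} (ha : 0 < a) (b : ℝ) :
    ∀ᶠ τ : ℝ in atTop, b < Real.exp (a * τ) :=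
  (Real.tendsto_exp_atTop.comp (tendsto_id.const_mul_atTop ha)).eventually_gt_atTop b

open MvPolynomial Finset Filter in
set_option maxHeartbeats 1000000 in
theorem exists_dense_polynomial_of_large {d : ℕ} (hd : d ≠ 0) (c : ℕ) {μ : ℝ} (hμ0 : 0 < μ)
    (hμ : μ ≤ 1 / 64) (G₀ : ℝ) :
    ∀ᶠ τ : ℝ in atTop, ∀ F : MvPolynomial (Fin 3) ℤ, (∀ k : ℤ, C k ∣ F → IsUnit k) →
      F.totalDegree = d → ∀ (j : Fin 3) (v : ℝ), 0 ≤ v → v ≤ τ → ∀ B : Fin 3 → ℝ,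
      (∀ i, 1 ≤ B i) → (∀ i, Real.log (B i) ≤ τ) → ∀ (E : Finset (Fin 3 →₀ ℕ)) (A D : ℕ), #E ≤ c →
      1 ≤ A → 6 * A + D * (D + 1) * (D + 2) ≤ 6 * D * #E →
      ∑ e ∈ E, ∑ i, Real.log (B i) * e i ≤ (v + μ * τ) * A → ∀ S : Finset (Fin 3 → ℤ),
      (∀ x ∈ S, eval x F = 0) → (∀ x ∈ S, ∀ i, |(x i : ℝ)| ≤ B i) →
      (∀ x ∈ S, eval x (pderiv j F) ≠ 0) →
      (∀ x ∈ S, Real.log |((eval x (pderiv j F) : ℤ) : ℝ)| ≤ G₀ * τ) →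
      Real.exp (2 * v + 64 * μ * τ) ≤ #S →
      ∃ g : MvPolynomial (Fin 3) ℤ, g ≠ 0 ∧ g.support ⊆ E ∧
        (#S : ℝ) ≤ Real.exp (v + 64 * μ * τ) * #{x ∈ S | eval x g = 0} := by
  obtain ⟨L, hL⟩ := exists_nat_gt (c / μ)
  have hLpos : (0 : ℝ) < L := lt_of_le_of_lt (by positivity) hL
  have hL0 : 0 < L := by exact_mod_cast hLpos
  have hcL : (c : ℝ) / L ≤ μ := by
    rw [div_lt_iff₀ hμ0] at hL
    rw [div_le_iff₀ hLpos]
    linarith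
  set α : ℝ := μ / (L + c + 1) with hα
  have hα0 : 0 < α := by positivity
  have hαμ : α * (L + c + 1) = μ := by rw [hα]; field_simp
  have hαL0 : 0 ≤ α * L := by positivity
  have hαc0 : 0 ≤ α * c := by positivity
  have hαL : α * L ≤ μ := by linarith
  have hαc : α * c ≤ μ := by linarith
  have hα1 : α ≤ μ := by linarith
  obtain ⟨t₁, ht₁⟩ := exists_nat_ge (2 / α)
  obtain ⟨m₀, hm₀⟩ := exists_nat_ge (4 / α)
  obtain ⟨G, hG⟩ := exists_nat_ge (2 * G₀ / α)
  have hm₀1 : 1 ≤ m₀ := by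
    have : (0 : ℝ) < m₀ := lt_of_lt_of_le (by positivity) hm₀
    exact_mod_cast this
  have hβ : 0 < (1 - μ) * α := mul_pos (by linarith) hα0
  have hYtop : Tendsto (fun τ : ℝ => Real.exp (α * τ)) atTop atTop :=
    Real.tendsto_exp_atTop.comp (tendsto_id.const_mul_atTop hα0)
  filter_upwards [eventually_ge_atTop 1,
    hYtop.eventually (eventually_two_mul_rpow_le_card_primes hμ0 (by linarith)),
    eventually_le_exp_mul hβ G, eventually_le_exp_mul hβ (2 * ((t₁ : ℝ) + L) ^ 2),
    eventually_le_exp_mul (mul_pos three_pos hμ0) c.factorial,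
    eventually_le_exp_mul (mul_pos (by norm_num : (0 : ℝ) < 5) hμ0)
      (8 * L * (2 * d * m₀) ^ (t₁ + L))] with τ hτ1 hpool hGτ htτ hcτ hQτ
  intro F hprim hFd j v hv0 hvτ B hB hBτ E A D hE hA1 hA hsum S hSF hSB hSj hSG hSbig
  have hτ0 : 0 < τ := by linarith
  have hy : Real.exp (α * τ) ^ (1 - μ) = Real.exp ((1 - μ) * α * τ) := by
    rw [← Real.exp_mul]; congr 1; ring
  rw [hy] at hpool
  set β : ℝ := (1 - μ) * α * τ with hβτ
  have hβ0 : 0 < β := by positivity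
  set t : ℕ := ⌈(v + 4 * μ * τ) / β⌉₊ with ht
  have ht_ge : v + 4 * μ * τ ≤ β * t := by
    have := Nat.le_ceil ((v + 4 * μ * τ) / β)
    rw [div_le_iff₀ hβ0] at this
    linarith
  have ht_le : β * t ≤ v + 4 * μ * τ + β := by
    have := (Nat.ceil_lt_add_one (show 0 ≤ (v + 4 * μ * τ) / β by positivity)).le
    rw [← ht, ← sub_le_iff_le_add, le_div_iff₀ hβ0] at this
    linarith
  set u : ℝ := α * τ * t with hu
  have hu0 : 0 ≤ u := by positivity
  have hβu : β * t = (1 - μ) * u := by rw [hβτ, hu]; ring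
  have hατ : α * τ ≤ μ * τ := by gcongr
  have hβα : β ≤ μ * τ := by
    have : 0 < μ * (α * τ) := by positivity
    linarith
  have hμv : μ * v ≤ μ * τ := by gcongr
  have hμτ0 : 0 < μ * τ := by positivity
  have hμμ : μ * (μ * τ) ≤ 1 / 64 * (μ * τ) := by gcongr
  have hu_le : u ≤ v + 8 * μ * τ := by
    rw [hβu] at ht_le
    have h1 : (1 - μ) * u ≤ (1 - μ) * (v + 8 * μ * τ) := by linarith
    exact le_of_mul_le_mul_left h1 (by linarith)
  have hμτ : μ * τ ≤ 1 / 64 * τ := by gcongr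
  have hu2 : u ≤ 2 * τ := by linarith
  have htt₁ : t ≤ t₁ := by
    have : α * τ * t ≤ α * τ * t₁ := by
      rw [div_le_iff₀ hα0] at ht₁
      have h1 := mul_le_mul_of_nonneg_right ht₁ hτ0.le
      linarith
    exact_mod_cast le_of_mul_le_mul_left this (by positivity)
  have hS : S.Nonempty := by
    rw [← card_pos]
    have : (0 : ℝ) < #S := lt_of_lt_of_le (Real.exp_pos _) hSbig
    exact_mod_cast this
  have hd1 : (1 : ℝ) ≤ d := by exact_mod_cast Nat.one_le_iff_ne_zero.2 hd
  have hm₀1' : (1 : ℝ) ≤ m₀ := by exact_mod_cast hm₀1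
  have hLτ : α * τ * L ≤ μ * τ := by
    have := mul_le_mul_of_nonneg_right hαL hτ0.le
    linarith
  have hcast : ((t + L : ℕ) : ℝ) = t + L := by push_cast; ring
  have hYpow : Real.exp (α * τ) ^ (t + L) ≤ Real.exp (v + 9 * μ * τ) := by
    rw [← Real.exp_nat_mul, hcast]
    refine Real.exp_le_exp.2 ?_
    linarith [hu]
  have hH : Real.exp (α * τ) ^ (8 * ((t + L : ℕ) : ℝ) * c / L) ≤ Real.exp (24 * μ * τ) := by
    rw [← Real.exp_mul]
    refine Real.exp_le_exp.2 ?_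
    have h1 : α * τ * (8 * ((t + L : ℕ) : ℝ) * c / L) = 8 * (c / L) * u + 8 * (α * c) * τ := by
      rw [hcast, hu]; field_simp
    rw [h1]
    have h2 : (c : ℝ) / L * u ≤ μ * (2 * τ) := mul_le_mul hcL hu2 hu0 hμ0.le
    have h3 : α * c * τ ≤ μ * τ := by gcongr
    linarith
  have hQ : (2 * d * m₀ : ℝ) ^ (t + L) ≤ (2 * d * m₀ : ℝ) ^ (t₁ + L) := by
    refine pow_le_pow_right₀ ?_ (by omega)
    have := one_le_mul_of_one_le_of_one_le hd1 hm₀1'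
    linarith
  refine Exists.imp (fun g ⟨hg0, hgE, hg⟩ => ?_) (exists_dense_polynomial (j := j) hprim (by rwa [hFd]) hE hA hS hSF hSB hSj
    (Y := Real.exp (α * τ)) (y := Real.exp β) (H := Real.exp (24 * μ * τ)) (t := t) (L := L)
    (m₀ := m₀) (G := G) (Real.one_lt_exp_iff.2 hβ0) hL0 hm₀1 hpool ?_ ?_ hGτ.le ?_ ?_
    (Real.one_le_exp (by positivity)) hH ?_)
  · intro x hx
    refine (hSG x hx).trans ?_
    rw [Real.log_exp, hβτ]
    rw [div_le_iff₀ hα0] at hG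
    have : (1 : ℝ) / 2 * (G * α) ≤ (1 - μ) * (G * α) := by
      gcongr
      linarith
    have h1 : G₀ * τ ≤ (1 - μ) * (G * α) * τ := by
      gcongr
      linarith
    linarith
  · intro i
    rw [Real.log_exp, Real.log_mul two_ne_zero (by linarith [hB i])]
    have h1 : Real.log 2 ≤ 1 := by linarith [Real.log_two_lt_d9]
    have h2 := hBτ i
    rw [div_le_iff₀ hα0] at hm₀
    have : (1 : ℝ) / 2 * (m₀ * α) ≤ (1 - μ) * (m₀ * α) := by
      gcongr
      linarith
    rw [hβτ]
    have h3 : 2 * τ ≤ (1 - μ) * (m₀ * α) * τ := by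
      gcongr
      linarith
    linarith
  · refine le_trans ?_ htτ.le
    have : (t : ℝ) ≤ t₁ := by exact_mod_cast htt₁
    gcongr
  · have h1 : ∏ e ∈ E, ∏ i, B i ^ e i = Real.exp (∑ e ∈ E, ∑ i, Real.log (B i) * e i) := by
      rw [Real.exp_sum]
      refine prod_congr rfl fun e _ => ?_
      rw [Real.exp_sum]
      refine prod_congr rfl fun i _ => ?_
      rw [mul_comm, Real.exp_nat_mul, Real.exp_log (by linarith [hB i])]
    have h2 : ((#E).factorial : ℝ) < Real.exp (3 * μ * τ) :=
      lt_of_le_of_lt (by exact_mod_cast Nat.factorial_le hE) hcτ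
    have hA1' : (1 : ℝ) ≤ A := by exact_mod_cast hA1
    rw [h1]
    calc (#E).factorial * Real.exp (∑ e ∈ E, ∑ i, Real.log (B i) * e i)
        < Real.exp (3 * μ * τ) * Real.exp ((v + μ * τ) * A) :=
          mul_lt_mul h2 (Real.exp_le_exp.2 hsum) (Real.exp_pos _) (Real.exp_pos _).le
      _ = Real.exp (3 * μ * τ + (v + μ * τ) * A) := by rw [Real.exp_add]
      _ ≤ (Real.exp β ^ t) ^ A := by
          rw [← Real.exp_nat_mul, ← Real.exp_nat_mul]
          refine Real.exp_le_exp.2 ?_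
          have h3 : (A : ℝ) * (v + 4 * μ * τ) ≤ A * (t * β) := by
            gcongr
            linarith
          have h4 : 3 * μ * τ * 1 ≤ 3 * μ * τ * A := by gcongr
          linarith
  · refine le_trans ?_ hSbig
    rw [hFd]
    calc 4 * L * 2 ^ (t + L) * Real.exp (24 * μ * τ) * (d * Real.exp (α * τ) ^ 2) ^ (t + L)
        = 4 * L * (2 * d : ℝ) ^ (t + L) * (Real.exp (24 * μ * τ) *
          (Real.exp (α * τ) ^ (t + L)) ^ 2) := by
          simp only [mul_pow]; ring
      _ ≤ Real.exp (5 * μ * τ) * (Real.exp (24 * μ * τ) * Real.exp (v + 9 * μ * τ) ^ 2) := by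
          refine mul_le_mul ?_ ?_ (by positivity) (by positivity)
          · refine le_trans ?_ hQτ.le
            have h1 : (2 * d : ℝ) ^ (t + L) ≤ (2 * d * m₀ : ℝ) ^ (t + L) := by
              exact pow_le_pow_left₀ (by positivity) (le_mul_of_one_le_right (by positivity) hm₀1') _
            have h2 := h1.trans hQ
            have : (4 : ℝ) * L ≤ 8 * L := by linarith
            exact mul_le_mul this h2 (by positivity) (by positivity)
          · gcongr
      _ = Real.exp (2 * v + 47 * μ * τ) := by
          rw [← Real.exp_nat_mul, ← Real.exp_add, ← Real.exp_add]; congr 1; push_cast; ring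
      _ ≤ Real.exp (2 * v + 64 * μ * τ) := by
          refine Real.exp_le_exp.2 ?_
          linarith [mul_pos hμ0 hτ0]
  · refine ⟨hg0, hgE, hg.trans ?_⟩
    refine mul_le_mul_of_nonneg_right ?_ (Nat.cast_nonneg _)
    rw [hFd]
    have h1 : (d * Real.exp (α * τ) ^ 2 * m₀ / Real.exp β) = d * m₀ * Real.exp ((1 + μ) * (α * τ)) := by
      rw [div_eq_iff (Real.exp_pos _).ne', mul_assoc (d * m₀ : ℝ), ← Real.exp_add, ← Real.exp_nat_mul,
        hβτ, show (1 + μ) * (α * τ) + (1 - μ) * α * τ = ((2 : ℕ) : ℝ) * (α * τ) by push_cast; ring]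
      ring
    have h2 : Real.exp ((1 + μ) * (α * τ)) ^ (t + L) ≤ Real.exp (v + 11 * μ * τ) := by
      rw [← Real.exp_nat_mul, hcast]
      refine Real.exp_le_exp.2 ?_
      have : (1 + μ) * (u + α * τ * L) ≤ (1 + μ) * (v + 9 * μ * τ) := by
        refine mul_le_mul_of_nonneg_left ?_ (by linarith)
        linarith
      have h3 : 0 < μ * τ := by positivity
      linarith [hu]
    calc 8 * L * 2 ^ (t + L) * Real.exp (24 * μ * τ) ^ 2 *
          (d * Real.exp (α * τ) ^ 2 * m₀ / Real.exp β) ^ (t + L)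
        = 8 * L * (2 * d * m₀ : ℝ) ^ (t + L) * (Real.exp (24 * μ * τ) ^ 2 *
          Real.exp ((1 + μ) * (α * τ)) ^ (t + L)) := by
          rw [h1]; simp only [mul_pow]; ring
      _ ≤ Real.exp (5 * μ * τ) * (Real.exp (48 * μ * τ) * Real.exp (v + 11 * μ * τ)) := by
          refine mul_le_mul ?_ ?_ (by positivity) (by positivity)
          · refine le_trans ?_ hQτ.le
            gcongr
          · refine mul_le_mul (le_of_eq ?_) h2 (by positivity) (by positivity)
            rw [← Real.exp_nat_mul]; congr 1; push_cast; ring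
      _ = Real.exp (v + 64 * μ * τ) := by
          rw [← Real.exp_add, ← Real.exp_add]; congr 1; ring

open MvPolynomial Finset in
theorem totalDegree_le_of_support_subset {σ R : Type*} [Fintype σ] [CommSemiring R]
    {g : MvPolynomial σ R} {E : Finset (σ →₀ ℕ)} {C : ℕ} (hg : g.support ⊆ E)
    (hE : ∀ e ∈ E, ∑ i, e i ≤ C) : g.totalDegree ≤ C := by
  refine Finset.sup_le fun e he => ?_
  change e.degree ≤ C
  rw [Finsupp.degree_eq_sum]
  exact hE e (hg he)

open Finset in
theorem sqrt_prod_div_le_self {b : Fin 3 → ℝ} {τ : ℝ} (hτ : 0 < τ) (hb : ∀ i, 0 ≤ b i)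
    (hbτ : ∀ i, b i ≤ τ) : Real.sqrt ((∏ i, b i) / τ) ≤ τ := by
  rw [Real.sqrt_le_iff, div_le_iff₀ hτ]
  refine ⟨hτ.le, ?_⟩
  calc ∏ i, b i ≤ ∏ _i : Fin 3, τ := prod_le_prod (fun i _ => hb i) fun i _ => hbτ i
    _ = τ ^ 2 * τ := by simp [pow_succ]

open MvPolynomial Finset in
theorem log_abs_eval_pderiv_le {F : MvPolynomial (Fin 3) ℤ} {d : ℕ} (hd : F.totalDegree = d)
    {B : Fin 3 → ℝ} (hB : ∀ i, 1 ≤ B i) {τ : ℝ} (hτ : 0 ≤ τ)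
    (hT : ∀ e ∈ F.support, ∏ i, B i ^ e i ≤ Real.exp τ)
    (hA : ∀ e, |((coeff e F : ℤ) : ℝ)| ≤
      ((#F.support).factorial * Real.exp τ ^ #F.support) ^ 2)
    (hK : ((d + 1) ^ 3 * (((d + 1) ^ 3).factorial ^ 2 * d) : ℝ) ≤ Real.exp τ)
    (j : Fin 3) {x : Fin 3 → ℤ} (hx : ∀ i, |(x i : ℝ)| ≤ B i) (h0 : eval x (pderiv j F) ≠ 0) :
    Real.log |((eval x (pderiv j F) : ℤ) : ℝ)| ≤ (2 * ((d + 1) ^ 3 : ℕ) + 2) * τ := by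
  set r : ℕ := (d + 1) ^ 3 with hr
  have hn : #F.support ≤ r := by rw [hr, ← hd]; exact card_support_le F
  have hT1 : 1 ≤ Real.exp τ := Real.one_le_exp hτ
  have h1 := abs_eval_pderiv_le hB (by positivity) hT hA j hx
  have h2 : ((#F.support).factorial * Real.exp τ ^ #F.support) ^ 2 ≤
      (r.factorial * Real.exp τ ^ r : ℝ) ^ 2 := by
    gcongr
  have hn' : (#F.support : ℝ) ≤ r := by exact_mod_cast hn
  have hK' : (r * (r.factorial ^ 2 * d) : ℝ) ≤ Real.exp τ := by
    refine le_trans (le_of_eq ?_) hK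
    rw [hr]; push_cast; ring
  rw [Real.log_le_iff_le_exp (by positivity)]
  calc |((eval x (pderiv j F) : ℤ) : ℝ)|
      ≤ #F.support * (((#F.support).factorial * Real.exp τ ^ #F.support) ^ 2 *
        F.totalDegree * Real.exp τ) := h1
    _ ≤ r * ((r.factorial * Real.exp τ ^ r : ℝ) ^ 2 * d * Real.exp τ) := by
        rw [hd]
        gcongr
    _ = (r * (r.factorial ^ 2 * d)) * Real.exp τ ^ (2 * r + 1) := by ring
    _ ≤ Real.exp τ * Real.exp τ ^ (2 * r + 1) := by gcongr
    _ = Real.exp ((2 * r + 2) * τ) := by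
        rw [← Real.exp_nat_mul, ← Real.exp_add]; congr 1; push_cast; ring

open MvPolynomial Finset Filter in
theorem exists_vanishing_or_dense_polynomial {d : ℕ} (hd : d ≠ 0) {ε : ℝ} (hε0 : 0 < ε)
    (hε1 : ε ≤ 1) :
    ∃ M : ℕ, ∀ᶠ τ : ℝ in atTop, ∀ F : MvPolynomial (Fin 3) ℤ, (∀ k : ℤ, C k ∣ F → IsUnit k) →
      F.totalDegree = d → ∀ B : Fin 3 → ℝ, (∀ i, 1 ≤ B i) → (∀ i, Real.log (B i) < τ) →
      (∀ e ∈ F.support, ∏ i, B i ^ e i ≤ Real.exp τ) →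
      (∃ e ∈ F.support, Real.exp τ ≤ ∏ i, B i ^ e i) →
      (∃ g : MvPolynomial (Fin 3) ℤ, ¬ map (Int.castRingHom ℂ) F ∣ map (Int.castRingHom ℂ) g ∧
        g.totalDegree ≤ M ∧
        ∀ x : Fin 3 → ℤ, (∀ i, |(x i : ℝ)| ≤ B i) → eval x F = 0 → eval x g = 0) ∨
      ∃ h : MvPolynomial (Fin 3) ℤ, ¬ map (Int.castRingHom ℂ) F ∣ map (Int.castRingHom ℂ) h ∧
        h.totalDegree ≤ M ∧
        ∀ S : Finset (Fin 3 → ℤ), (∀ x ∈ S, eval x F = 0) → (∀ x ∈ S, ∀ i, |(x i : ℝ)| ≤ B i) →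
          (∀ x ∈ S, eval x h ≠ 0) →
          Real.exp (2 * Real.sqrt ((∏ i, Real.log (B i)) / τ) + ε * τ) ≤ #S →
          ∃ g : MvPolynomial (Fin 3) ℤ, ¬ map (Int.castRingHom ℂ) F ∣ map (Int.castRingHom ℂ) g ∧
            g.totalDegree ≤ M ∧
            (#S : ℝ) ≤ Real.exp (Real.sqrt ((∏ i, Real.log (B i)) / τ) + ε * τ) *
              #{x ∈ S | eval x g = 0} := by
  have hμ0 : 0 < ε / 64 := by positivity
  obtain ⟨c, hc⟩ := exists_exponent_data d hμ0
  refine ⟨max c d, ?_⟩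
  filter_upwards [eventually_ge_atTop 1,
    Real.tendsto_exp_atTop.eventually_ge_atTop
      ((d + 1) ^ 3 * (((d + 1) ^ 3).factorial ^ 2 * d) : ℝ),
    exists_dense_polynomial_of_large hd c hμ0 (by linarith)
      (2 * ((d + 1) ^ 3 : ℕ) + 2)] with τ hτ1 hK hdense
  intro F hprim hFd B hB hBτ hT hT'
  have hτ0 : 0 < τ := by linarith
  have hb : ∀ i, 0 ≤ Real.log (B i) := fun i => Real.log_nonneg (hB i)
  obtain ⟨m, hm, ⟨ω, hω⟩, E, hEc, hEdeg, hEm, A, D, hA1, hA, hsum⟩ :=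
    hc (fun i => Real.log (B i)) τ hτ0 hb hBτ F.support
      (fun e he i => (exponent_le_totalDegree he i).trans hFd.le) (by
        obtain ⟨e, he, hle⟩ := hT'
        refine ⟨e, he, ?_⟩
        have hpos : ∀ i, B i ^ e i ≠ 0 := fun i => by have := hB i; positivity
        rw [← Real.le_log_iff_exp_le (prod_pos fun i _ => by have := hB i; positivity),
          Real.log_prod (fun i _ => hpos i)] at hle
        refine hle.trans (le_of_eq (sum_congr rfl fun i _ => ?_))
        rw [Real.log_pow, mul_comm])
  rcases abs_coeff_le_or_exists_vanishing hprim hm (Real.one_le_exp hτ0.le) hT with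
    ⟨g, hg0, hgF, hg⟩ | hcoeff
  · refine Or.inl ⟨g, not_map_dvd_of_support hm hω hg0 fun e he hme => ?_, ?_, hg⟩
    · exact absurd (sum_mul_le_sum_mul_of_le ω hme) (not_le.2 (hω e (hgF e he).1 (hgF e he).2))
    · refine le_trans ?_ (hFd.le.trans (le_max_right c d))
      exact Finset.sup_mono fun e he => (hgF e he).1
  right
  obtain ⟨j, hj⟩ := exists_pderiv_ne_zero (F := F) (by rwa [hFd])
  refine ⟨pderiv j F, not_map_dvd_pderiv hm hω hj,
    (totalDegree_pderiv_le F j).trans (hFd.le.trans (le_max_right c d)),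
    fun S hSF hSB hSj hSbig => ?_⟩
  obtain ⟨g, hg0, hgE, hg⟩ := hdense F hprim hFd j _ (Real.sqrt_nonneg _)
    (sqrt_prod_div_le_self hτ0 hb fun i => (hBτ i).le) B hB (fun i => (hBτ i).le) E A D hEc hA1 hA hsum S
    hSF hSB hSj
    (fun x hx => log_abs_eval_pderiv_le hFd hB hτ0.le hT hcoeff hK j (hSB x hx) (hSj x hx))
    (by rwa [mul_div_cancel₀ ε (by norm_num)])
  rw [mul_div_cancel₀ ε (by norm_num)] at hg
  exact ⟨g, not_map_dvd_of_support hm hω hg0 fun e he => hEm e (hgE he),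
    (totalDegree_le_of_support_subset hgE hEdeg).trans (le_max_left c d), hg⟩

open Finset in
theorem exists_list_cover {α ι : Type*} (R : ι → α → Prop) (P : ι → Prop) {a N : ℝ} (ha : 0 < a)
    (n : ℕ) (S : Finset α) (hn : #S = n) (h : ∀ S' ⊆ S, N ≤ (#S' : ℝ) →
      ∃ g, P g ∧ ∃ W ⊆ S', (#S' : ℝ) ≤ a * #W ∧ ∀ x ∈ W, R g x) :
    ∃ (l : List ι) (Z : Finset α), (∀ g ∈ l, P g) ∧ (#Z : ℝ) ≤ max N 0 ∧
      (l.length : ℝ) ≤ a * Real.log #S + 1 ∧ ∀ x ∈ S, x ∉ Z → ∃ g ∈ l, R g x := by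
  classical
  induction n using Nat.strong_induction_on generalizing S with
  | _ n ih =>
    have hlog : 0 ≤ Real.log #S := Real.log_natCast_nonneg _
    rcases S.eq_empty_or_nonempty with rfl | hS
    · exact ⟨[], ∅, by simp, by simp, by simp, by simp⟩
    have hS0 : (0 : ℝ) < #S := by exact_mod_cast hS.card_pos
    by_cases hN : N ≤ (#S : ℝ)
    · obtain ⟨g, hPg, W, hWS, hW, hWg⟩ := h S Subset.rfl hN
      have hW0 : (0 : ℝ) < #W := by
        by_contra h0
        nlinarith
      have hcard : #(S \ W) + #W = #S := card_sdiff_add_card_eq_card hWS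
      have hcard' : (#(S \ W) : ℝ) + #W = #S := by exact_mod_cast hcard
      have hlt : #(S \ W) < n := by
        have : 0 < #W := by exact_mod_cast hW0
        omega
      obtain ⟨l, Z, hl, hZ, hlen, hcov⟩ := ih _ hlt (S \ W) rfl
        fun S' hS' => h S' (hS'.trans sdiff_subset)
      by_cases hemp : (S \ W) = ∅
      · refine ⟨[g], ∅, by simpa using hPg, by simp, ?_, fun x hx _ => ⟨g, by simp, hWg x ?_⟩⟩
        · have : 0 ≤ a * Real.log #S := by positivity
          simpa using this
        · by_contra hxW
          exact notMem_empty x (hemp ▸ mem_sdiff.2 ⟨hx, hxW⟩)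
      have hpos : (0 : ℝ) < #(S \ W) := by
        exact_mod_cast (nonempty_iff_ne_empty.2 hemp).card_pos
      refine ⟨g :: l, Z, by simpa using ⟨hPg, hl⟩, hZ, ?_, fun x hx hxZ => ?_⟩
      · have h1 := Real.log_le_sub_one_of_pos (div_pos hpos hS0)
        rw [Real.log_div hpos.ne' hS0.ne'] at h1
        have h2 : (#(S \ W) : ℝ) / #S - 1 ≤ - (1 / a) := by
          rw [div_sub_one hS0.ne', div_le_iff₀ hS0]
          have h3 : 1 / a * #S ≤ #W := by
            rw [one_div, inv_mul_le_iff₀ ha]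
            exact hW
          linarith
        have h4 : a * Real.log #(S \ W) ≤ a * (Real.log #S - 1 / a) :=
          mul_le_mul_of_nonneg_left (by linarith) ha.le
        rw [mul_sub, mul_one_div_cancel ha.ne'] at h4
        rw [List.length_cons]
        push_cast
        linarith
      · by_cases hxW : x ∈ W
        · exact ⟨g, by simp, hWg x hxW⟩
        · obtain ⟨g', hg', hR⟩ := hcov x (mem_sdiff.2 ⟨hx, hxW⟩) hxZ
          exact ⟨g', List.mem_cons_of_mem _ hg', hR⟩
    · refine ⟨[], S, by simp, (not_le.1 hN).le.trans (le_max_left _ _), ?_,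
        fun x hx hxZ => absurd hx hxZ⟩
      have : 0 ≤ a * Real.log #S := by positivity
      simp only [List.length_nil, Nat.cast_zero]
      linarith

open Finset in
theorem exists_box_finset {B : Fin 3 → ℝ} (hB : ∀ i, 1 ≤ B i) :
    ∃ S : Finset (Fin 3 → ℤ), (∀ x, x ∈ S ↔ ∀ i, |(x i : ℝ)| ≤ B i) ∧ (#S : ℝ) ≤ 27 * ∏ i, B i := by
  refine ⟨Fintype.piFinset fun i => Icc (-⌊B i⌋) ⌊B i⌋, fun x => ?_, ?_⟩
  · rw [Fintype.mem_piFinset]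
    refine forall_congr' fun i => ?_
    rw [mem_Icc, abs_le, Int.le_floor, neg_le, Int.le_floor]
    push_cast
    rw [neg_le]
  · rw [Fintype.card_piFinset, Nat.cast_prod]
    calc ∏ i, ((#(Icc (-⌊B i⌋) ⌊B i⌋) : ℕ) : ℝ) ≤ ∏ i, 3 * B i := by
          refine prod_le_prod (fun i _ => Nat.cast_nonneg _) fun i _ => ?_
          have h1 : (1 : ℤ) ≤ ⌊B i⌋ := Int.le_floor.2 (by simpa using hB i)
          have h2 : ((#(Icc (-⌊B i⌋) ⌊B i⌋) : ℕ) : ℤ) = 2 * ⌊B i⌋ + 1 := by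
            rw [Int.card_Icc, Int.toNat_of_nonneg (by omega)]; ring
          have h3 : ((#(Icc (-⌊B i⌋) ⌊B i⌋) : ℕ) : ℝ) = 2 * ⌊B i⌋ + 1 := by exact_mod_cast h2
          linarith [Int.floor_le (B i), hB i]
      _ = 27 * ∏ i, B i := by
          rw [prod_mul_distrib]; norm_num

open MvPolynomial Finset Filter in
theorem exists_cover_of_large {d : ℕ} (hd : d ≠ 0) {ε : ℝ} (hε0 : 0 < ε) (hε1 : ε ≤ 1) :
    ∃ M : ℕ, ∀ᶠ τ : ℝ in atTop, ∀ F : MvPolynomial (Fin 3) ℤ,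
      F.totalDegree = d → ∀ B : Fin 3 → ℝ, (∀ i, 1 ≤ B i) → (∀ i, Real.log (B i) < τ) →
      (∀ e ∈ F.support, ∏ i, B i ^ e i ≤ Real.exp τ) →
      (∃ e ∈ F.support, Real.exp τ ≤ ∏ i, B i ^ e i) →
      ∃ (l : List (MvPolynomial (Fin 3) ℤ)) (Z : Finset (Fin 3 → ℤ)),
        (∀ g ∈ l, ¬ map (Int.castRingHom ℂ) F ∣ map (Int.castRingHom ℂ) g ∧ g.totalDegree ≤ M) ∧
        (l.length : ℝ) ≤ Real.exp (ε * τ) * Real.exp (Real.sqrt ((∏ i, Real.log (B i)) / τ)) ∧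
        (#Z : ℝ) ≤ Real.exp (ε * τ) * Real.exp (Real.sqrt ((∏ i, Real.log (B i)) / τ)) ^ 2 ∧
        ∀ x : Fin 3 → ℤ, (∀ i, |(x i : ℝ)| ≤ B i) → x ∉ Z → eval x F = 0 →
          ∃ g ∈ l, eval x g = 0 := by
  obtain ⟨M, hM⟩ := exists_vanishing_or_dense_polynomial hd (half_pos hε0) (by linarith)
  refine ⟨M, ?_⟩
  have hlin : ∀ᶠ τ : ℝ in atTop, 6 + 3 * τ ≤ Real.exp (ε / 2 * τ) := by
    have h1 : Tendsto (fun τ : ℝ => ε / 2 * τ) atTop atTop :=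
      tendsto_id.const_mul_atTop (half_pos hε0)
    have h2 := h1.eventually ((Real.tendsto_exp_div_pow_atTop 1).eventually_ge_atTop (12 / ε))
    filter_upwards [h2, eventually_ge_atTop 2] with τ hτ hτ2
    rw [pow_one, le_div_iff₀ (by positivity)] at hτ
    have h3 : 12 / ε * (ε / 2 * τ) = 6 * τ := by field_simp; ring
    linarith
  filter_upwards [hM, hlin, eventually_ge_atTop 1] with τ hτ hlinτ hτ1
  intro F hFd B hB hBτ hT hT'
  have hτ0 : 0 < τ := by linarith
  have hF0 : F ≠ 0 := by rintro rfl; exact hd (by simpa using hFd.symm)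
  obtain ⟨k, F', hk, rfl, hprim⟩ := exists_eq_C_mul_primitive hF0
  have hsupp : (C k * F').support = F'.support := by
    rw [C_mul']
    exact support_smul_eq hk F'
  have hdeg : F'.totalDegree = d := by
    rw [← hFd, totalDegree, totalDegree, hsupp]
  have hmap : ∀ g : MvPolynomial (Fin 3) ℤ,
      ¬ map (Int.castRingHom ℂ) F' ∣ map (Int.castRingHom ℂ) g →
      ¬ map (Int.castRingHom ℂ) (C k * F') ∣ map (Int.castRingHom ℂ) g := fun g hg h =>
    hg ((map_dvd _ (Dvd.intro_left _ rfl)).trans h)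
  have heval : ∀ x : Fin 3 → ℤ, eval x (C k * F') = 0 → eval x F' = 0 := fun x hx => by
    rw [map_mul, eval_C] at hx
    exact (mul_eq_zero.1 hx).resolve_left hk
  rw [hsupp] at hT hT'
  set v := Real.sqrt ((∏ i, Real.log (B i)) / τ) with hv
  have hv0 : 0 ≤ v := Real.sqrt_nonneg _
  have hE1 : 1 ≤ Real.exp (v + ε / 2 * τ) := Real.one_le_exp (by positivity)
  have hexp : Real.exp (v + ε / 2 * τ) * Real.exp (ε / 2 * τ) = Real.exp (ε * τ) * Real.exp v := by
    rw [← Real.exp_add, ← Real.exp_add]; congr 1; ring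
  have h6 : Real.exp (v + ε / 2 * τ) * (6 + 3 * τ) ≤ Real.exp (ε * τ) * Real.exp v := by
    rw [← hexp]
    gcongr
  rcases hτ F' hprim hdeg B hB hBτ hT hT' with ⟨g, hg, hgM, hgv⟩ | ⟨h, hh, hhM, hdense⟩
  · refine ⟨[g], ∅, fun g' hg' => by rw [List.mem_singleton.1 hg']; exact ⟨hmap g hg, hgM⟩, ?_, ?_, fun x hx _ hFx =>
      ⟨g, by simp, hgv x hx (heval x hFx)⟩⟩
    · simp only [List.length_singleton, Nat.cast_one]
      nlinarith
    · simp only [card_empty, Nat.cast_zero]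
      positivity
  obtain ⟨S₀, hS₀, hS₀card⟩ := exists_box_finset hB
  set S : Finset (Fin 3 → ℤ) := {x ∈ S₀ | eval x F' = 0 ∧ eval x h ≠ 0} with hS
  have hSmem : ∀ x ∈ S, (∀ i, |(x i : ℝ)| ≤ B i) ∧ eval x F' = 0 ∧ eval x h ≠ 0 := fun x hx => by
    rw [hS, mem_filter, hS₀] at hx
    exact hx
  have hlogS : Real.log #S ≤ 4 + 3 * τ := by
    rcases S.eq_empty_or_nonempty with h0 | h0
    · rw [h0]; simp; linarith
    have h1 : (#S : ℝ) ≤ 27 * ∏ i, B i :=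
      le_trans (by exact_mod_cast card_filter_le _ _) hS₀card
    have h2 : ∏ i, B i ≤ ∏ _i : Fin 3, Real.exp τ :=
      prod_le_prod (fun i _ => by linarith [hB i]) fun i _ => by
        rw [← Real.log_le_iff_le_exp (by linarith [hB i])]
        exact (hBτ i).le
    have h3 : (27 : ℝ) ≤ Real.exp 4 := by
      have : Real.exp 4 = Real.exp 1 ^ 4 := by rw [← Real.exp_nat_mul]; norm_num
      rw [this]
      have := Real.exp_one_gt_d9
      calc (27 : ℝ) ≤ 2.7 ^ 4 := by norm_num
        _ ≤ Real.exp 1 ^ 4 := by gcongr; linarith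
    rw [Real.log_le_iff_le_exp (by exact_mod_cast h0.card_pos), Real.exp_add]
    calc (#S : ℝ) ≤ 27 * ∏ i, B i := h1
      _ ≤ Real.exp 4 * ∏ _i : Fin 3, Real.exp τ :=
          mul_le_mul h3 h2 (prod_nonneg fun i _ => by linarith [hB i]) (Real.exp_pos _).le
      _ = Real.exp 4 * Real.exp (3 * τ) := by
          rw [prod_const, card_univ, Fintype.card_fin, ← Real.exp_nat_mul]; norm_num
  obtain ⟨l, Z, hl, hZ, hlen, hcov⟩ := exists_list_cover
    (fun (g : MvPolynomial (Fin 3) ℤ) (x : Fin 3 → ℤ) => eval x g = 0)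
    (fun g => ¬ map (Int.castRingHom ℂ) F' ∣ map (Int.castRingHom ℂ) g ∧ g.totalDegree ≤ M)
    (Real.exp_pos (v + ε / 2 * τ)) (N := Real.exp (2 * v + ε / 2 * τ)) _ S rfl fun S' hS' hN => by
      obtain ⟨g, hg1, hg2, hg3⟩ := hdense S' (fun x hx => (hSmem x (hS' hx)).2.1)
        (fun x hx => (hSmem x (hS' hx)).1) (fun x hx => (hSmem x (hS' hx)).2.2) hN
      exact ⟨g, ⟨hg1, hg2⟩, _, filter_subset _ _, hg3, fun x hx => (mem_filter.1 hx).2⟩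
  refine ⟨h :: l, Z, ?_, ?_, ?_, fun x hx hxZ hFx => ?_⟩
  · intro g hg
    rcases List.mem_cons.1 hg with rfl | hg
    · exact ⟨hmap _ hh, hhM⟩
    · exact ⟨hmap g (hl g hg).1, (hl g hg).2⟩
  · rw [List.length_cons]
    push_cast
    have h1 : Real.exp (v + ε / 2 * τ) * Real.log #S ≤
        Real.exp (v + ε / 2 * τ) * (4 + 3 * τ) := by gcongr
    linarith
  · rw [max_eq_left (Real.exp_pos _).le] at hZ
    refine hZ.trans ?_
    rw [← Real.exp_nat_mul, ← Real.exp_add]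
    refine Real.exp_le_exp.2 ?_
    have : 0 < ε * τ := by positivity
    push_cast
    linarith
  · by_cases hxh : eval x h = 0
    · exact ⟨h, by simp, hxh⟩
    · obtain ⟨g, hg, hgx⟩ := hcov x
        (by rw [hS, mem_filter, hS₀]; exact ⟨hx, heval x hFx, hxh⟩) hxZ
      exact ⟨g, List.mem_cons_of_mem _ hg, hgx⟩

open MvPolynomial in
theorem exponent_le_degreeOf_of_map_dvd {σ : Type*} {F g : MvPolynomial σ ℤ}
    (h : map (Int.castRingHom ℂ) F ∣ map (Int.castRingHom ℂ) g) (hg : g ≠ 0) {e : σ →₀ ℕ}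
    (he : e ∈ F.support) (i : σ) : e i ≤ degreeOf i g := by
  have hinj : Function.Injective (Int.castRingHom ℂ) := Int.cast_injective
  have hg' : map (Int.castRingHom ℂ) g ≠ 0 := (map_ne_zero_iff _ (map_injective _ hinj)).2 hg
  have hgdeg : degreeOf i (map (Int.castRingHom ℂ) g) = degreeOf i g := by
    rw [degreeOf_eq_sup, degreeOf_eq_sup, support_map_of_injective g hinj]
  obtain ⟨q, hq⟩ := h
  rw [← support_map_of_injective F hinj] at he
  rw [hq] at hg'
  rw [← hgdeg, hq, degreeOf_mul_eq (left_ne_zero_of_mul hg') (right_ne_zero_of_mul hg')]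
  exact (monomial_le_degreeOf i he).trans (Nat.le_add_right _ _)

open MvPolynomial in
theorem X_sub_C_ne_zero_int {σ : Type*} (l : σ) (a : ℤ) : (X l - C a : MvPolynomial σ ℤ) ≠ 0 := by
  intro h
  have h1 := congrArg (eval fun _ => a + 1) h
  simp at h1

open MvPolynomial in
theorem exponent_le_of_map_dvd_X_sub_C {σ : Type*} [DecidableEq σ] {F : MvPolynomial σ ℤ} {l : σ}
    {a : ℤ} (h : map (Int.castRingHom ℂ) F ∣ map (Int.castRingHom ℂ) (X l - C a))
    {e : σ →₀ ℕ} (he : e ∈ F.support) (i : σ) : e i ≤ if i = l then 1 else 0 := by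
  refine (exponent_le_degreeOf_of_map_dvd h (X_sub_C_ne_zero_int l a) he i).trans ?_
  refine (degreeOf_sub_le i _ _).trans ?_
  rw [degreeOf_X, degreeOf_C]
  simp

open MvPolynomial Finset in
theorem exists_slices {F : MvPolynomial (Fin 3) ℤ} {B : Fin 3 → ℝ} (hB : ∀ i, 1 ≤ B i) {τ : ℝ}
    (hτ : 0 < τ) {i : Fin 3} (hi : τ ≤ Real.log (B i))
    (h : ∀ l ≠ i, ∀ a : ℤ,
      ¬ map (Int.castRingHom ℂ) F ∣ map (Int.castRingHom ℂ) (X l - C a)) :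
    ∃ L : List (MvPolynomial (Fin 3) ℤ),
      (∀ g ∈ L, ¬ map (Int.castRingHom ℂ) F ∣ map (Int.castRingHom ℂ) g ∧ g.totalDegree ≤ 1) ∧
      (L.length : ℝ) ≤ 3 * Real.exp (Real.sqrt ((∏ i, Real.log (B i)) / τ)) ∧
      ∀ x : Fin 3 → ℤ, (∀ i, |(x i : ℝ)| ≤ B i) → ∃ g ∈ L, eval x g = 0 := by
  have hb : ∀ i, 0 ≤ Real.log (B i) := fun i => Real.log_nonneg (hB i)
  obtain ⟨l, hl, hmin⟩ := exists_min_image (univ.erase i) (fun l => Real.log (B l))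
    (card_pos.1 (by rw [card_erase_of_mem (mem_univ i)]; simp))
  have hBl : B l ≤ Real.exp (Real.sqrt ((∏ i, Real.log (B i)) / τ)) := by
    rw [← Real.log_le_iff_le_exp (by linarith [hB l])]
    refine Real.le_sqrt_of_sq_le ?_
    rw [le_div_iff₀ hτ, ← mul_prod_erase univ _ (mem_univ i), mul_comm]
    have h1 : Real.log (B l) ^ 2 ≤ ∏ k ∈ univ.erase i, Real.log (B k) := by
      calc Real.log (B l) ^ 2 = ∏ _k ∈ univ.erase i, Real.log (B l) := by
            rw [prod_const, card_erase_of_mem (mem_univ i)]; simp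
        _ ≤ _ := prod_le_prod (fun _ _ => hb l) hmin
    exact mul_le_mul hi h1 (sq_nonneg _) (hb i)
  have hli : l ≠ i := (mem_erase.1 hl).1
  refine ⟨(Icc (-⌊B l⌋) ⌊B l⌋).toList.map fun a => X l - C a, ?_, ?_, fun x hx => ?_⟩
  · intro g hg
    obtain ⟨a, -, rfl⟩ := List.mem_map.1 hg
    refine ⟨h l hli a, (totalDegree_sub _ _).trans ?_⟩
    rw [totalDegree_X, totalDegree_C]
    simp
  · rw [List.length_map, length_toList]
    have h1 : (1 : ℤ) ≤ ⌊B l⌋ := Int.le_floor.2 (by simpa using hB l)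
    have h2 : ((#(Icc (-⌊B l⌋) ⌊B l⌋) : ℕ) : ℤ) = 2 * ⌊B l⌋ + 1 := by
      rw [Int.card_Icc, Int.toNat_of_nonneg (by omega)]; ring
    have h3 : ((#(Icc (-⌊B l⌋) ⌊B l⌋) : ℕ) : ℝ) = 2 * ⌊B l⌋ + 1 := by exact_mod_cast h2
    linarith [Int.floor_le (B l), hB l]
  · refine ⟨X l - C (x l), List.mem_map.2 ⟨x l, ?_, rfl⟩, by simp⟩
    rw [mem_toList, mem_Icc, Int.le_floor, neg_le, Int.le_floor]
    have := abs_le.1 (hx l)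
    push_cast
    exact ⟨by linarith, this.2⟩

open MvPolynomial Finset Filter in
theorem exists_cover_of_log_le {F : MvPolynomial (Fin 3) ℤ} {B : Fin 3 → ℝ} (hB : ∀ i, 1 ≤ B i)
    {τ : ℝ} (hτ : 0 < τ) (hT : ∃ e ∈ F.support, Real.exp τ ≤ ∏ i, B i ^ e i)
    (h : ∃ i, τ ≤ Real.log (B i)) :
    ∃ L : List (MvPolynomial (Fin 3) ℤ),
      (∀ g ∈ L, ¬ map (Int.castRingHom ℂ) F ∣ map (Int.castRingHom ℂ) g ∧ g.totalDegree ≤ 1) ∧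
      (L.length : ℝ) ≤ 3 * Real.exp (Real.sqrt ((∏ i, Real.log (B i)) / τ)) ∧
      ∀ x : Fin 3 → ℤ, (∀ i, |(x i : ℝ)| ≤ B i) → ∃ g ∈ L, eval x g = 0 := by
  obtain ⟨i, hi⟩ := h
  obtain ⟨e, he, hle⟩ := hT
  by_cases hlin : ∃ (l : Fin 3) (a : ℤ),
      map (Int.castRingHom ℂ) F ∣ map (Int.castRingHom ℂ) (X l - C a)
  · obtain ⟨l, a, hla⟩ := hlin
    have hel := exponent_le_of_map_dvd_X_sub_C hla he
    refine exists_slices hB hτ (i := l) ?_ fun l' hl' a' hla' => ?_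
    · rw [Real.le_log_iff_exp_le (by linarith [hB l])]
      refine hle.trans ?_
      rw [prod_eq_single l (fun k _ hk => by
        have := hel k
        rw [if_neg hk, Nat.le_zero] at this
        rw [this, pow_zero]) (by simp)]
      have := hel l
      rw [if_pos rfl] at this
      simpa using pow_le_pow_right₀ (hB l) this
    · have hel' := exponent_le_of_map_dvd_X_sub_C hla' he
      have h0 : ∀ k, e k = 0 := fun k => by
        have h1 := hel k
        have h2 := hel' k
        by_cases hk : k = l
        · rw [if_neg (fun h => hl' (h.symm.trans hk))] at h2
          exact Nat.le_zero.1 h2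
        · rw [if_neg hk] at h1
          exact Nat.le_zero.1 h1
      have h1 := Real.one_lt_exp_iff.2 hτ
      simp only [h0, pow_zero, prod_const_one] at hle
      linarith
  · push Not at hlin
    exact exists_slices hB hτ hi fun l _ a => hlin l a

open MvPolynomial Finset Filter in
theorem exists_cover {d : ℕ} (hd : d ≠ 0) {ε : ℝ} (hε : 0 < ε) :
    ∃ c : ℝ, 0 < c ∧ ∀ F : MvPolynomial (Fin 3) ℤ, F.totalDegree = d → ∀ B : Fin 3 → ℝ,
      (∀ i, 1 ≤ B i) → ∀ τ : ℝ, 0 < τ → (∀ e ∈ F.support, ∏ i, B i ^ e i ≤ Real.exp τ) →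
      (∃ e ∈ F.support, Real.exp τ ≤ ∏ i, B i ^ e i) →
      ∃ (L : List (MvPolynomial (Fin 3) ℤ)) (Z : Finset (Fin 3 → ℤ)),
        (∀ g ∈ L, ¬ map (Int.castRingHom ℂ) F ∣ map (Int.castRingHom ℂ) g ∧
          (g.totalDegree : ℝ) ≤ c) ∧
        (L.length : ℝ) ≤ c * Real.exp (ε * τ) *
          Real.exp (Real.sqrt ((∏ i, Real.log (B i)) / τ)) ∧
        (#Z : ℝ) ≤ c * Real.exp (ε * τ) *
          Real.exp (Real.sqrt ((∏ i, Real.log (B i)) / τ)) ^ 2 ∧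
        ∀ x : Fin 3 → ℤ, (∀ i, |(x i : ℝ)| ≤ B i) → x ∉ Z → eval x F = 0 →
          ∃ g ∈ L, eval x g = 0 := by
  obtain ⟨M, hM⟩ := exists_cover_of_large hd (lt_min hε one_pos) (min_le_right ε 1)
  obtain ⟨τ₀, hτ₀⟩ := eventually_atTop.1 hM
  have hE0 := Real.exp_pos (3 * τ₀)
  refine ⟨M + 3 + 27 * Real.exp (3 * τ₀), by positivity, fun F hFd B hB τ hτ hT hT' => ?_⟩
  have hM0 : (0 : ℝ) ≤ M := Nat.cast_nonneg M
  have hετ : 1 ≤ Real.exp (ε * τ) := Real.one_le_exp (by positivity)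
  set V := Real.exp (Real.sqrt ((∏ i, Real.log (B i)) / τ)) with hV
  have hV1 : 1 ≤ V := Real.one_le_exp (Real.sqrt_nonneg _)
  by_cases h : ∃ i, τ ≤ Real.log (B i)
  · obtain ⟨L, hL, hlen, hcov⟩ := exists_cover_of_log_le hB hτ hT' h
    refine ⟨L, ∅, fun g hg => ⟨(hL g hg).1, ?_⟩, ?_, ?_, fun x hx _ _ => hcov x hx⟩
    · have : (g.totalDegree : ℝ) ≤ 1 := by exact_mod_cast (hL g hg).2
      linarith
    · refine hlen.trans ?_
      gcongr
      calc (3 : ℝ) = 3 * 1 := by norm_num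
        _ ≤ _ := mul_le_mul (by linarith) hετ zero_le_one (by positivity)
    · simp only [card_empty, Nat.cast_zero]
      positivity
  push Not at h
  by_cases hττ : τ₀ ≤ τ
  · obtain ⟨L, Z, hL, hlen, hZ, hcov⟩ := hτ₀ τ hττ F hFd B hB h hT hT'
    have hexp : Real.exp (min ε 1 * τ) ≤
        (M + 3 + 27 * Real.exp (3 * τ₀)) * Real.exp (ε * τ) := by
      calc Real.exp (min ε 1 * τ) ≤ 1 * Real.exp (ε * τ) := by
            rw [one_mul]
            gcongr
            exact min_le_left _ _
        _ ≤ _ := by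
            gcongr
            linarith
    refine ⟨L, Z, fun g hg => ⟨(hL g hg).1, ?_⟩, ?_, ?_, hcov⟩
    · have : (g.totalDegree : ℝ) ≤ M := by exact_mod_cast (hL g hg).2
      linarith
    · exact hlen.trans (by gcongr)
    · exact hZ.trans (by gcongr)
  · obtain ⟨S, hS, hScard⟩ := exists_box_finset hB
    refine ⟨[], S, by simp, ?_, ?_, fun x hx hxS _ => absurd ((hS x).2 hx) hxS⟩
    · simp only [List.length_nil, Nat.cast_zero]
      positivity
    · have h2 : ∏ i, B i ≤ Real.exp (3 * τ₀) := by
        calc ∏ i, B i ≤ ∏ _i : Fin 3, Real.exp τ₀ :=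
              prod_le_prod (fun i _ => by linarith [hB i]) fun i _ => by
                rw [← Real.log_le_iff_le_exp (by linarith [hB i])]
                linarith [h i]
          _ = Real.exp (3 * τ₀) := by
              rw [prod_const, card_univ, Fintype.card_fin, ← Real.exp_nat_mul]; norm_num
      calc (#S : ℝ) ≤ (M + 3 + 27 * Real.exp (3 * τ₀)) * 1 * 1 ^ 2 := by linarith
        _ ≤ _ := by gcongr

/-- (Salberger; see Browning, Lemma 1.) Let `F ∈ ℤ[x₁,x₂,x₃]` be
absolutely irreducible of degree `d`, let `B₁,B₂,B₃ ≥ 1`, let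
`T = max B₁^{e₁}B₂^{e₂}B₃^{e₃}` over monomials occurring in `F` (with `T > 1`), and
`V₃ = exp(√(log B₁ · log B₂ · log B₃ / log T))`. Then there are auxiliary polynomials
`g₁,…,g_J`, each coprime to `F` of bounded degree, with `J ≪_{d,ε} T^ε·V₃`, and an
exceptional set `Z ⊂ ℤ³` with `|Z| ≪_{d,ε} T^ε·V₃²`, such that every integer point of
the box `[−B₁,B₁]×[−B₂,B₂]×[−B₃,B₃]` on `F = 0` outside `Z` lies on some `g_j = 0`. -/
theorem salberger_determinant_method (d : ℕ) (hd : 1 ≤ d) (ε : ℝ) (hε : 0 < ε) :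
    ∃ c : ℝ, 0 < c ∧
      ∀ F : MvPolynomial (Fin 3) ℤ, F.totalDegree = d →
        Irreducible (MvPolynomial.map (Int.castRingHom ℂ) F) →
        ∀ B₁ B₂ B₃ T : ℝ, 1 ≤ B₁ → 1 ≤ B₂ → 1 ≤ B₃ → 1 < T →
          IsGreatest
            ((fun m : Fin 3 →₀ ℕ => B₁ ^ m 0 * B₂ ^ m 1 * B₃ ^ m 2) '' ↑F.support) T →
          ∃ (J : ℕ) (g : Fin J → MvPolynomial (Fin 3) ℤ) (Z : Set (ℤ × ℤ × ℤ)),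
            Z.Finite ∧
            (J : ℝ) ≤ c * T ^ ε *
              Real.exp (Real.sqrt (Real.log B₁ * Real.log B₂ * Real.log B₃ / Real.log T)) ∧
            (Nat.card Z : ℝ) ≤ c * T ^ ε *
              Real.exp (Real.sqrt (Real.log B₁ * Real.log B₂ * Real.log B₃ / Real.log T)) ^ 2 ∧
            (∀ j : Fin J,
              (∀ q : MvPolynomial (Fin 3) ℤ, q ∣ F → q ∣ g j → IsUnit q) ∧
                ((g j).totalDegree : ℝ) ≤ c) ∧
            ∀ x : ℤ × ℤ × ℤ,
              |(x.1 : ℝ)| ≤ B₁ → |(x.2.1 : ℝ)| ≤ B₂ → |(x.2.2 : ℝ)| ≤ B₃ → x ∉ Z →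
              MvPolynomial.eval ![x.1, x.2.1, x.2.2] F = 0 →
              ∃ j, MvPolynomial.eval ![x.1, x.2.1, x.2.2] (g j) = 0 := by
  obtain ⟨c, hc, h⟩ := exists_cover (Nat.one_le_iff_ne_zero.1 hd) hε
  refine ⟨c, hc, fun F hFd hF B₁ B₂ B₃ T hB₁ hB₂ hB₃ hT hgreat => ?_⟩
  have hτ : 0 < Real.log T := Real.log_pos hT
  have hexp : Real.exp (Real.log T) = T := Real.exp_log (by linarith)
  have hprod : ∀ e : Fin 3 →₀ ℕ, ∏ i, ![B₁, B₂, B₃] i ^ e i = B₁ ^ e 0 * B₂ ^ e 1 * B₃ ^ e 2 :=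
    fun e => by simp [Fin.prod_univ_three]
  obtain ⟨L, Z, hL, hlen, hZ, hcov⟩ := h F hFd ![B₁, B₂, B₃]
    (by intro i; fin_cases i <;> simpa) (Real.log T) hτ
    (fun e he => by rw [hexp, hprod]; exact hgreat.2 ⟨e, he, rfl⟩)
    (by
      obtain ⟨e, he, hTe⟩ := hgreat.1
      exact ⟨e, he, by rw [hexp, hprod]; exact hTe.ge⟩)
  have hpow : Real.exp (ε * Real.log T) = T ^ ε := by
    rw [Real.rpow_def_of_pos (by linarith), mul_comm]
  have hlog : ∏ i, Real.log (![B₁, B₂, B₃] i) = Real.log B₁ * Real.log B₂ * Real.log B₃ := by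
    simp [Fin.prod_univ_three]
  rw [hpow, hlog] at hlen hZ
  choose g hgF hgdeg hgv using fun j : Fin L.length =>
    exists_coprime_of_not_map_dvd hF (hL (L.get j) (L.get_mem j)).1
  have hinj : Function.Injective fun x : ℤ × ℤ × ℤ => ![x.1, x.2.1, x.2.2] := by
    intro x y hxy
    have h0 := congrFun hxy 0
    have h1 := congrFun hxy 1
    have h2 := congrFun hxy 2
    exact Prod.ext h0 (Prod.ext h1 h2)
  refine ⟨L.length, g, (fun x : ℤ × ℤ × ℤ => ![x.1, x.2.1, x.2.2]) ⁻¹' Z,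
    Z.finite_toSet.preimage hinj.injOn, hlen, le_trans ?_ hZ,
    fun j => ⟨hgF j, le_trans (by exact_mod_cast hgdeg j) (hL _ (L.get_mem j)).2⟩,
    fun x hx₁ hx₂ hx₃ hxZ hFx => ?_⟩
  · rw [Nat.card_preimage_of_injective hinj fun x _ =>
      ⟨(x 0, x 1, x 2), by ext i; fin_cases i <;> rfl⟩, Nat.card_coe_set_eq, Set.ncard_coe_finset]
  · obtain ⟨p, hp, hpx⟩ := hcov ![x.1, x.2.1, x.2.2]
      (by intro i; fin_cases i <;> simpa) hxZ hFx
    obtain ⟨j, rfl⟩ := List.get_of_mem hp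
    exact ⟨j, hgv j _ hpx⟩
end

section
/- Let n ≥ 3 be an integer that is not of the form m² or m²+1 for any odd positive integer m, let a_1,…,a_{n−2} ∈ ℤ, and let c_1, c_2 ∈ ℚ. Then the polynomial z² − Δ(a_1,…,a_{n−2}, c_1 a_n + c_2, a_n), regarded as a polynomial in the two variables z and a_n over ℚ, is irreducible over ℚ. -/
open Polynomial

section

open Filter Topology

theorem eval_derivative_prod_X_sub_C {n : ℕ} (α : Fin n → ℂ) (i : Fin n) :
    (derivative (∏ j, (X - C (α j)))).eval (α i) = ∏ j ∈ {i}ᶜ, (α i - α j) := by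
  rw [derivative_prod_finset, eval_finsetSum, Finset.sum_eq_single i]
  · simp [eval_prod, Finset.compl_singleton]
  · intro j _ hj
    simp only [eval_mul, eval_prod]
    rw [Finset.prod_eq_zero (i := i) (by simp [hj.symm]) (by simp), zero_mul]
  · simp

theorem norm_prod_lt_sq {n : ℕ} (α : Fin n → ℂ) :
    ‖∏ p ∈ Finset.univ.filter (fun p : Fin n × Fin n => p.1 < p.2), (α p.1 - α p.2) ^ 2‖ =
      ∏ i, ‖(derivative (∏ j, (X - C (α j)))).eval (α i)‖ := by
  simp_rw [eval_derivative_prod_X_sub_C, norm_prod, Finset.prod_filter, Fintype.prod_prod_type, ← Finset.prod_filter,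
    Finset.filter_lt_eq_Ioi]
  have h (i j : Fin n) : ‖α i - α j‖ = ‖α j - α i‖ := norm_sub_rev _ _
  rw [Finset.prod_congr rfl fun i _ => Finset.prod_congr rfl fun j _ => h i j,
    ← Finset.prod_prod_Ioi_mul_eq_prod_prod_off_diag (fun i j => ‖α i - α j‖)]
  refine Finset.prod_congr rfl fun i _ => Finset.prod_congr rfl fun j _ => ?_
  rw [norm_pow, sq, h j i]

theorem exists_eq_prod_X_sub_C {n : ℕ} {P : ℂ[X]} (hP : P.Monic) (hn : P.natDegree = n) :
    ∃ α : Fin n → ℂ, P = ∏ i, (X - C (α i)) := by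
  have hs := IsAlgClosed.splits P
  have hc : P.roots.toList.length = n := by
    rw [Multiset.length_toList, ← hn, hs.natDegree_eq_card_roots]
  subst hc
  refine ⟨P.roots.toList.get, ?_⟩
  conv_lhs => rw [hs.eq_prod_roots_of_monic hP, ← Multiset.coe_toList P.roots]
  rw [Multiset.map_coe, Multiset.prod_coe, ← Fin.prod_univ_fun_getElem]
  rfl

theorem prod_X_sub_C_mul {n : ℕ} (α : Fin n → ℂ) (l : ℂ) :
    ∏ i, (X - C (l * α i)) = (∏ i, (X - C (α i))).scaleRoots l := by
  induction n with
  | zero => simp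
  | succ n ih =>
    rw [Fin.prod_univ_succ, Fin.prod_univ_succ, mul_scaleRoots_of_noZeroDivisors, ih,
      X_sub_C_scaleRoots, mul_comm l]

theorem natDegree_eq_and_leadingCoeff_eq_of_tendsto {P : ℝ[X]} {K : ℕ} {L : ℝ} (hL : L ≠ 0)
    (h : Tendsto (fun s => P.eval s / s ^ K) atTop (𝓝 L)) :
    P.natDegree = K ∧ P.leadingCoeff = L := by
  have h' : Tendsto (fun s => P.eval s / (X ^ K : ℝ[X]).eval s) atTop (𝓝 L) := by simpa using h
  have h2 := (isEquivalent_atTop_div P (X ^ K)).tendsto_nhds h'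
  have hP : P.leadingCoeff ≠ 0 := by
    intro h0
    simp only [h0, zero_div, zero_mul, tendsto_const_nhds_iff] at h2
    exact hL h2.symm
  rw [tendsto_const_mul_zpow_atTop_nhds_iff (by simpa using hP)] at h2
  rcases h2 with ⟨h3, h4⟩ | ⟨-, h4⟩
  · rw [natDegree_X_pow] at h3
    exact ⟨by omega, by simpa using h4⟩
  · exact absurd h4 hL

theorem irreducible_X_sq_sub_C {R : Type*} [CommRing R] [IsDomain R] {d : R} (h : ¬ IsSquare d) :
    Irreducible (X ^ 2 - C d : R[X]) := by
  have hd : (X ^ 2 - C d).natDegree = 2 := natDegree_X_pow_sub_C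
  rw [(monic_X_pow_sub_C d two_ne_zero).irreducible_iff_roots_eq_zero_of_degree_le_three
    hd.ge (by omega), Multiset.eq_zero_iff_forall_notMem]
  intro r hr
  have := (mem_roots'.1 hr).2
  simp [sub_eq_zero] at this
  exact h ⟨r, by rw [← this, sq]⟩

theorem irreducible_X_zero_sq_sub_aeval_X_one {D : ℚ[X]} (h : ¬ IsSquare D) :
    Irreducible (MvPolynomial.X 0 ^ 2 - Polynomial.aeval (MvPolynomial.X 1) D :
      MvPolynomial (Fin 2) ℚ) := by
  let e := MvPolynomial.finSuccEquiv ℚ 1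
  let d : MvPolynomial (Fin 1) ℚ := Polynomial.aeval (MvPolynomial.X 0) D
  have he : e (MvPolynomial.X 0 ^ 2 - Polynomial.aeval (MvPolynomial.X 1) D) = X ^ 2 - C d := by
    rw [map_sub, map_pow, MvPolynomial.finSuccEquiv_X_zero, ← Polynomial.aeval_algHom_apply]
    have h1 : e (MvPolynomial.X 1) = CAlgHom (R := ℚ) (MvPolynomial.X 0) :=
      MvPolynomial.finSuccEquiv_X_succ (j := 0)
    rw [h1, Polynomial.aeval_algHom_apply]
    rfl
  rw [← MulEquiv.irreducible_iff e, he]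
  refine irreducible_X_sq_sub_C fun hs => h ?_
  have := hs.map (MvPolynomial.aeval (fun _ => X) : MvPolynomial (Fin 1) ℚ →ₐ[ℚ] ℚ[X])
  simpa [d, ← Polynomial.aeval_algHom_apply] using this

/-- `Δ` has the absolute value of the discriminant on coefficient vectors. -/
def HasDiscNorm {n : ℕ} (Δ : MvPolynomial (Fin n) ℚ) : Prop :=
  ∀ α : Fin n → ℂ,
    ‖MvPolynomial.aeval (fun j : Fin n => (∏ i, (X - C (α i))).coeff (n - 1 - (j : ℕ))) Δ‖ =
      ∏ i, ‖(derivative (∏ j, (X - C (α j)))).eval (α i)‖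

variable {n : ℕ} {Δ : MvPolynomial (Fin n) ℚ}

theorem exists_coeff_prod_X_sub_C (b : Fin n → ℂ) :
    ∃ α : Fin n → ℂ, ∀ j : Fin n, (∏ i, (X - C (α i))).coeff (n - 1 - (j : ℕ)) = b j := by
  have hdeg : (∑ j : Fin n, C (b j) * X ^ (n - 1 - (j : ℕ))).degree < (n : WithBot ℕ) := by
    refine (degree_sum_le _ _).trans_lt ((Finset.sup_lt_iff (WithBot.bot_lt_coe n)).2 ?_)
    intro j _
    refine (degree_C_mul_X_pow_le _ _).trans_lt ?_
    have := j.2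
    exact Nat.cast_lt.2 (by omega)
  obtain ⟨α, hα⟩ := exists_eq_prod_X_sub_C (monic_X_pow_add hdeg)

    (natDegree_eq_of_degree_eq_some (by
      rw [degree_add_eq_left_of_degree_lt (by rwa [degree_X_pow]), degree_X_pow]))
  refine ⟨α, fun j => ?_⟩
  have hj := j.2
  rw [← hα, coeff_add, coeff_X_pow, if_neg (by omega), zero_add, finsetSum_coeff,
    Finset.sum_eq_single j]
  · simp
  · intro k _ hk
    have := k.2
    rw [coeff_C_mul_X_pow, if_neg]
    intro h
    exact hk (Fin.ext (by omega))
  · simp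

theorem HasDiscNorm.scale (hΔ : HasDiscNorm Δ) (b : Fin n → ℂ) (l : ℂ) :
    ‖MvPolynomial.aeval (fun j : Fin n => l ^ ((j : ℕ) + 1) * b j) Δ‖ =
      ‖l‖ ^ (n * (n - 1)) * ‖MvPolynomial.aeval b Δ‖ := by
  obtain ⟨α, hα⟩ := exists_coeff_prod_X_sub_C b
  have hd : (∏ i, (X - C (α i))).natDegree = n := by
    simp [natDegree_prod_of_monic _ _ fun i _ => monic_X_sub_C (α i)]
  have h1 := hΔ α
  have h2 := hΔ fun i => l * α i
  have hc (j : Fin n) : (∏ i, (X - C (l * α i))).coeff (n - 1 - (j : ℕ)) =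
      l ^ ((j : ℕ) + 1) * b j := by
    have := j.2
    rw [prod_X_sub_C_mul, coeff_scaleRoots, hα, hd, mul_comm]
    congr 2
    omega
  simp_rw [hα] at h1
  simp_rw [hc] at h2
  have he (i : Fin n) : ‖(derivative (∏ j, (X - C (l * α j)))).eval (l * α i)‖ =
      ‖l‖ ^ (n - 1) * ‖(derivative (∏ j, (X - C (α j)))).eval (α i)‖ := by
    rw [eval_derivative_prod_X_sub_C (fun i => l * α i), eval_derivative_prod_X_sub_C]
    simp [← mul_sub, Finset.prod_mul_distrib, Finset.card_compl]
  rw [h1, h2, Finset.prod_congr rfl fun i _ => he i, Finset.prod_mul_distrib]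
  simp [← pow_mul, mul_comm]

theorem HasDiscNorm.of_aeval_eq_sq (hΔ : HasDiscNorm Δ) {g : Fin n → ℚ[X]} {q : ℚ[X]}
    (hq : MvPolynomial.aeval g Δ = q * q) {M N : ℕ} (hMN : M * N = n * (n - 1)) (hM : 0 < M)
    {b : Fin n → ℝ}
    (hb : ∀ j : Fin n, Tendsto (fun s : ℝ => s⁻¹ ^ (j.val + 1) * Polynomial.aeval (s ^ M) (g j)) atTop
      (𝓝 (b j)))
    {L : ℝ} (hL : L ≠ 0) (hbL : ‖MvPolynomial.aeval (fun j => (b j : ℂ)) Δ‖ = L) :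
    2 * q.natDegree = N ∧ (q.leadingCoeff : ℝ) ^ 2 = L := by
  let r : ℝ[X] := q.map (algebraMap ℚ ℝ)
  have hlim : Tendsto (fun s : ℝ => ((expand ℝ M r) ^ 2).eval s / s ^ (n * (n - 1))) atTop
      (𝓝 L) := by
    have hcont : Continuous fun x : Fin n → ℂ => ‖MvPolynomial.aeval x Δ‖ := by
      simp_rw [MvPolynomial.aeval_def, ← MvPolynomial.eval_map]
      exact (MvPolynomial.continuous_eval _).norm
    have hb' : Tendsto (fun (s : ℝ) (j : Fin n) =>
        ((s⁻¹ ^ ((j : ℕ) + 1) * Polynomial.aeval (s ^ M) (g j) : ℝ) : ℂ)) atTop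
        (𝓝 fun j => (b j : ℂ)) :=
      tendsto_pi_nhds.2 fun j => (Complex.continuous_ofReal.tendsto _).comp (hb j)
    have h := (hcont.tendsto _).comp hb'
    rw [hbL] at h
    refine h.congr' ?_
    filter_upwards [eventually_gt_atTop 0] with s hs
    have h1 (p : ℚ[X]) : ((Polynomial.aeval (s ^ M) p : ℝ) : ℂ) =
        Polynomial.aeval ((s : ℂ) ^ M) p := by
      rw [← Complex.ofReal_pow]
      exact (Polynomial.aeval_algebraMap_apply ℂ (s ^ M) p).symm
    simp only [Function.comp_apply, Complex.ofReal_mul, Complex.ofReal_pow, Complex.ofReal_inv, h1]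
    rw [hΔ.scale, ← MvPolynomial.comp_aeval_apply, hq, ← h1, Complex.norm_real, norm_inv,
      Complex.norm_real, Real.norm_of_nonneg hs.le, map_mul, Real.norm_of_nonneg (mul_self_nonneg _),
      eval_pow, expand_eval, eval_map_algebraMap, inv_pow, sq, inv_mul_eq_div]
  obtain ⟨h1, h2⟩ := natDegree_eq_and_leadingCoeff_eq_of_tendsto hL hlim
  rw [natDegree_pow, natDegree_expand, natDegree_map, ← hMN] at h1
  rw [leadingCoeff_pow, leadingCoeff_expand hM, leadingCoeff_map] at h2
  exact ⟨by nlinarith, h2⟩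

theorem HasDiscNorm.X_pow_add_one (hΔ : HasDiscNorm Δ) (hn : 1 ≤ n) :
    ‖MvPolynomial.aeval (fun j : Fin n => (((if (j : ℕ) = n - 1 then 1 else 0 : ℝ)) : ℂ)) Δ‖ =
      (n : ℝ) ^ n := by
  obtain ⟨α, hα⟩ := exists_eq_prod_X_sub_C (monic_X_pow_add_C (1 : ℂ) (by omega : n ≠ 0))
    (natDegree_X_pow_add_C (n := n))
  have h := hΔ α
  have hc (j : Fin n) : (X ^ n + C 1 : ℂ[X]).coeff (n - 1 - (j : ℕ)) =
      (((if (j : ℕ) = n - 1 then 1 else 0 : ℝ)) : ℂ) := by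
    have := j.2
    rw [coeff_add, coeff_X_pow, if_neg (by omega), coeff_C, zero_add]
    split_ifs <;> first | (exfalso; omega) | simp
  have hr (i : Fin n) : ‖(derivative (X ^ n + C 1 : ℂ[X])).eval (α i)‖ = n := by
    have h0 : (X ^ n + C 1 : ℂ[X]).eval (α i) = 0 := by
      rw [hα, eval_prod]
      exact Finset.prod_eq_zero (Finset.mem_univ i) (by simp)
    have h1 : ‖α i‖ = 1 := by
      refine (pow_eq_one_iff_of_nonneg (norm_nonneg _) (by omega : n ≠ 0)).1 ?_
      have : α i ^ n = -1 := by
        simpa [add_eq_zero_iff_eq_neg] using h0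
      rw [← norm_pow, this, norm_neg, norm_one]
    simp [derivative_X_pow, h1]
  rw [← hα] at h
  simp_rw [hc, hr] at h
  simpa using h

theorem HasDiscNorm.X_pow_add_C_mul_X (hΔ : HasDiscNorm Δ) (hn : 2 ≤ n) (c : ℝ) :
    ‖MvPolynomial.aeval (fun j : Fin n => (((if (j : ℕ) = n - 2 then c else 0 : ℝ)) : ℂ)) Δ‖ =
      |c| ^ n * ((n - 1 : ℕ) : ℝ) ^ (n - 1) := by
  obtain ⟨k, rfl⟩ : ∃ k, n = k + 1 := ⟨n - 1, by omega⟩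
  obtain ⟨β, hβ⟩ := exists_eq_prod_X_sub_C (monic_X_pow_add_C (c : ℂ) (by omega : k ≠ 0))
    (natDegree_X_pow_add_C (n := k))
  have hα : X ^ (k + 1) + C (c : ℂ) * X = ∏ i, (X - C ((Fin.cons 0 β : Fin (k + 1) → ℂ) i)) := by
    rw [Fin.prod_univ_succ]
    simp only [Fin.cons_zero, Fin.cons_succ, ← hβ, C_0]
    ring
  have h := hΔ (Fin.cons 0 β)
  have hc (j : Fin (k + 1)) : (X ^ (k + 1) + C (c : ℂ) * X : ℂ[X]).coeff (k + 1 - 1 - (j : ℕ)) =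
      (((if (j : ℕ) = k + 1 - 2 then c else 0 : ℝ)) : ℂ) := by
    have := j.2
    rw [coeff_add, coeff_X_pow, if_neg (by omega), coeff_C_mul, coeff_X, zero_add]
    split_ifs <;> first | (exfalso; omega) | simp
  have hr (i : Fin k) :
      ‖(derivative (X ^ (k + 1) + C (c : ℂ) * X : ℂ[X])).eval (β i)‖ = k * |c| := by
    have h0 : (X ^ k + C (c : ℂ)).eval (β i) = 0 := by
      rw [hβ, eval_prod]
      exact Finset.prod_eq_zero (Finset.mem_univ i) (by simp)
    have h1 : β i ^ k = -c := by simpa [add_eq_zero_iff_eq_neg] using h0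
    have h2 : (derivative (X ^ (k + 1) + C (c : ℂ) * X : ℂ[X])).eval (β i) = -(k * c) := by
      simp [h1]
      ring
    rw [h2, norm_neg, norm_mul, Complex.norm_natCast, Complex.norm_real, Real.norm_eq_abs]
  have h0 : ‖(derivative (X ^ (k + 1) + C (c : ℂ) * X : ℂ[X])).eval 0‖ = |c| := by
    simp [zero_pow (by omega : k ≠ 0)]
  rw [← hα, Fin.prod_univ_succ] at h
  simp_rw [hc, Fin.cons_succ, Fin.cons_zero, hr, h0] at h
  rw [h]
  simp [mul_pow]
  ring

/-- The line of coefficients `aₙ₋₁ = c₁ t + c₂`, `aₙ = t`. -/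
noncomputable def lineCoeff (n : ℕ) (a : ℕ → ℤ) (c₁ c₂ : ℚ) (j : Fin n) : ℚ[X] :=
  if (j : ℕ) < n - 2 then C ((a ((j : ℕ) + 1) : ℚ))
  else if (j : ℕ) = n - 2 then C c₁ * X + C c₂
  else X

theorem tendsto_inv_pow_mul_const {m : ℕ} (hm : m ≠ 0) (x : ℝ) :
    Tendsto (fun s : ℝ => s⁻¹ ^ m * x) atTop (𝓝 0) := by
  simpa [hm] using ((tendsto_inv_atTop_zero (𝕜 := ℝ)).pow m).mul_const x

theorem HasDiscNorm.line_of_eq_zero (hΔ : HasDiscNorm Δ) (hn : 3 ≤ n) {a : ℕ → ℤ} {c₂ : ℚ}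
    {q : ℚ[X]} (hq : MvPolynomial.aeval (lineCoeff n a 0 c₂) Δ = q * q) :
    2 * q.natDegree = n - 1 ∧ (q.leadingCoeff : ℝ) ^ 2 = (n : ℝ) ^ n := by
  refine hΔ.of_aeval_eq_sq hq rfl (by omega) (fun j => ?_) (by positivity)
    (hΔ.X_pow_add_one (by omega))
  have := j.2
  simp only [lineCoeff]
  split_ifs with h1 h2 h3
  any_goals omega
  · simpa using tendsto_inv_pow_mul_const (Nat.succ_ne_zero _) _
  · simpa using tendsto_inv_pow_mul_const (Nat.succ_ne_zero _) _
  · refine tendsto_const_nhds.congr' ?_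
    filter_upwards [eventually_gt_atTop 0] with s hs
    rw [aeval_X, show j.val + 1 = n by omega, ← mul_pow, inv_mul_cancel₀ hs.ne', one_pow]

theorem HasDiscNorm.line_of_ne_zero (hΔ : HasDiscNorm Δ) (hn : 3 ≤ n) {a : ℕ → ℤ} {c₁ c₂ : ℚ}
    (hc : c₁ ≠ 0) {q : ℚ[X]} (hq : MvPolynomial.aeval (lineCoeff n a c₁ c₂) Δ = q * q) :
    2 * q.natDegree = n ∧
      (q.leadingCoeff : ℝ) ^ 2 = |(c₁ : ℝ)| ^ n * ((n - 1 : ℕ) : ℝ) ^ (n - 1) := by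
  have hc' : (c₁ : ℝ) ≠ 0 := by exact_mod_cast hc
  have hn' : ((n - 1 : ℕ) : ℝ) ≠ 0 := by
    have : n - 1 ≠ 0 := by omega
    exact_mod_cast this
  refine hΔ.of_aeval_eq_sq hq (mul_comm _ _) (by omega) (fun j => ?_) (by positivity)
    (hΔ.X_pow_add_C_mul_X (by omega) c₁)
  have := j.2
  simp only [lineCoeff]
  split_ifs with h1 h2 h3
  any_goals omega
  · simpa using tendsto_inv_pow_mul_const (Nat.succ_ne_zero _) _
  · have h := (tendsto_inv_pow_mul_const (m := n - 1) (by omega) c₂).const_add (c₁ : ℝ)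
    rw [add_zero] at h
    refine h.congr' ?_
    filter_upwards [eventually_gt_atTop 0] with s hs
    simp only [show j.val + 1 = n - 1 by omega, map_add, map_mul, aeval_C, aeval_X, mul_add,
      eq_ratCast, mul_left_comm _ (c₁ : ℝ)]
    rw [← mul_pow, inv_mul_cancel₀ hs.ne', one_pow, mul_one]
  · refine tendsto_inv_atTop_zero.congr' ?_
    filter_upwards [eventually_gt_atTop 0] with s hs
    rw [aeval_X, show j.val + 1 = (n - 1) + 1 by omega, pow_succ, mul_right_comm, ← mul_pow,
      inv_mul_cancel₀ hs.ne', one_pow, one_mul]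

theorem isSquare_of_sq_eq_sq_mul_pow {m : ℕ} (hm : Odd m) {x y : ℚ} (hy : y ≠ 0)
    (h : x ^ 2 = y ^ 2 * (m : ℚ) ^ m) : IsSquare m := by
  obtain ⟨k, hk⟩ := hm
  have hm0 : (m : ℚ) ≠ 0 := by exact_mod_cast (by omega : m ≠ 0)
  rw [← Rat.isSquare_natCast_iff]
  refine ⟨x / (y * (m : ℚ) ^ k), ?_⟩
  have h2 : (m : ℚ) ^ m = (m : ℚ) ^ k * (m : ℚ) ^ k * m := by
    rw [← pow_add, ← pow_succ, ← two_mul, ← hk]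
  rw [h2] at h
  field_simp
  linear_combination -h

theorem not_isSquare_aeval_lineCoeff (hΔ : HasDiscNorm Δ) (hn : 3 ≤ n)
    (hshape : ∀ m : ℕ, Odd m → n ≠ m ^ 2 ∧ n ≠ m ^ 2 + 1) (a : ℕ → ℤ) (c₁ c₂ : ℚ) :
    ¬ IsSquare (MvPolynomial.aeval (lineCoeff n a c₁ c₂) Δ) := by
  rintro ⟨q, hq⟩
  by_cases hc : c₁ = 0
  · subst hc
    obtain ⟨h1, h2⟩ := hΔ.line_of_eq_zero hn hq
    have hodd : Odd n := ⟨q.natDegree, by omega⟩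
    obtain ⟨m, hm⟩ := isSquare_of_sq_eq_sq_mul_pow hodd (x := q.leadingCoeff) one_ne_zero
      (by rw [one_pow, one_mul]; exact_mod_cast h2)
    rw [hm, Nat.odd_mul] at hodd
    exact (hshape m hodd.1).1 (by rw [hm, sq])
  · obtain ⟨h1, h2⟩ := hΔ.line_of_ne_zero hn hc hq
    have hodd : Odd (n - 1) := by
      rw [Nat.odd_iff]
      omega
    obtain ⟨m, hm⟩ := isSquare_of_sq_eq_sq_mul_pow hodd (x := q.leadingCoeff)
      (pow_ne_zero q.natDegree hc)
      (by
        rw [← pow_mul, mul_comm _ 2, h1]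
        rw [Even.pow_abs ⟨q.natDegree, by omega⟩] at h2
        exact_mod_cast h2)
    rw [hm, Nat.odd_mul] at hodd
    exact (hshape m hodd.1).2 (by rw [sq]; omega)

end

/-- (Dietmann.) Let `n ≥ 3` not be of the form `m²` or `m²+1` with `m`
odd, let `a₁,…,a_{n−2} ∈ ℤ` and `c₁,c₂ ∈ ℚ`. Then
`z² − Δ(a₁,…,a_{n−2}, c₁·aₙ + c₂, aₙ)` is irreducible as a polynomial in the two
variables `z = X 0` and `aₙ = X 1` over `ℚ`. Here `Δ` is the discriminant of
`xⁿ + a₁xⁿ⁻¹ + ⋯ + aₙ` as a polynomial in the coefficients, characterized by the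
property that it evaluates to `Π_{i<j} (αᵢ − αⱼ)²` on the coefficients of
`Π (x − αᵢ)`. -/
theorem disc_slice_irreducible_general_line (n : ℕ) (hn : 3 ≤ n)
    (hshape : ∀ m : ℕ, Odd m → n ≠ m ^ 2 ∧ n ≠ m ^ 2 + 1)
    (Δ : MvPolynomial (Fin n) ℚ)
    (hΔ : ∀ α : Fin n → ℂ,
      MvPolynomial.eval
          (fun j : Fin n =>
            (∏ i : Fin n, (Polynomial.X - Polynomial.C (α i))).coeff (n - 1 - (j : ℕ)))
          (MvPolynomial.map (algebraMap ℚ ℂ) Δ) =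
        ∏ p ∈ Finset.univ.filter (fun p : Fin n × Fin n => p.1 < p.2),
          (α p.1 - α p.2) ^ 2)
    (a : ℕ → ℤ) (c₁ c₂ : ℚ) :
    Irreducible
      ((MvPolynomial.X 0) ^ 2 -
        MvPolynomial.aeval
          (fun j : Fin n =>
            if (j : ℕ) < n - 2 then MvPolynomial.C ((a ((j : ℕ) + 1) : ℚ))
            else if (j : ℕ) = n - 2 then
              MvPolynomial.C c₁ * MvPolynomial.X 1 + MvPolynomial.C c₂
            else MvPolynomial.X 1) Δ :
        MvPolynomial (Fin 2) ℚ) := by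
  have hΔ' : HasDiscNorm Δ := fun α => by
    rw [← norm_prod_lt_sq, ← hΔ α, MvPolynomial.eval_map, MvPolynomial.aeval_def]
  have h := irreducible_X_zero_sq_sub_aeval_X_one
    (not_isSquare_aeval_lineCoeff hΔ' hn hshape a c₁ c₂)
  rw [MvPolynomial.comp_aeval_apply] at h
  convert h using 4
  ext1 j
  simp only [lineCoeff]
  split_ifs <;> simp [MvPolynomial.algebraMap_eq]
end
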